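/- arXiv:2409.06027 — 3 statements merged into one kernel-verified Lean document; each statement's English description precedes it below -/
import Mathlib

section
/- Let p be a prime and x, y, z ∈ ℚ_p. Set n = [[1,x,z,y],[0,1,y,0],[0,0,1,0],[0,0,−x,1]] and σ = s₁s₂s₁. Then σ·n ∈ P_K(ℚ_p)·s₁s₂·B(p) if and only if v_p(x) ≤ min{−1, v_p(y), v_p(z)}. Moreover, in that case, whenever σ·n = q·s₁s₂·γ with q ∈ P_K(ℚ_p) and γ ∈ B(p), one has m₁(q) ∈ x⁻¹·ℤ_p^× and m₂(q) ∈ [[−x⁻¹, −y + z/x],[0, x]]·Γ₀(p). -/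
open Matrix

/-- The standard symplectic similitude matrix `J`. -/
noncomputable def J4 (p : ℕ) [Fact p.Prime] : Matrix (Fin 4) (Fin 4) ℚ_[p] :=
  !![0, 0, 1, 0; 0, 0, 0, 1; -1, 0, 0, 0; 0, -1, 0, 0]

/-- `GSp₄(ℚ_p)`: invertible 4×4 matrices `g` with `gᵀ·J·g = μ·J` for some `μ ≠ 0`. -/
def GSp4 (p : ℕ) [Fact p.Prime] : Set (Matrix (Fin 4) (Fin 4) ℚ_[p]) :=
  {g | g.det ≠ 0 ∧ ∃ μ : ℚ_[p], μ ≠ 0 ∧ gᵀ * J4 p * g = μ • J4 p}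

/-- The congruence subgroup `B(p)` of `GSp₄(ℤ_p)`: all entries in `ℤ_p`, similitude factor a
unit, and the entries at positions (2,1), (3,1), (4,1), (3,2), (4,2), (3,4) in `pℤ_p`. -/
def Bp (p : ℕ) [Fact p.Prime] : Set (Matrix (Fin 4) (Fin 4) ℚ_[p]) :=
  {g | (∀ i j, ‖g i j‖ ≤ 1) ∧ (∃ μ : ℚ_[p], ‖μ‖ = 1 ∧ gᵀ * J4 p * g = μ • J4 p) ∧
    ‖g 1 0‖ ≤ (p : ℝ)⁻¹ ∧ ‖g 2 0‖ ≤ (p : ℝ)⁻¹ ∧ ‖g 3 0‖ ≤ (p : ℝ)⁻¹ ∧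
    ‖g 2 1‖ ≤ (p : ℝ)⁻¹ ∧ ‖g 3 1‖ ≤ (p : ℝ)⁻¹ ∧ ‖g 2 3‖ ≤ (p : ℝ)⁻¹}

/-- The Klingen parabolic `P_K(ℚ_p)`: entries at positions (2,1), (3,1), (4,1), (3,2),
(3,4) vanish. -/
def PK (p : ℕ) [Fact p.Prime] : Set (Matrix (Fin 4) (Fin 4) ℚ_[p]) :=
  {g | g ∈ GSp4 p ∧ g 1 0 = 0 ∧ g 2 0 = 0 ∧ g 3 0 = 0 ∧ g 2 1 = 0 ∧ g 2 3 = 0}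

/-- The `GL₂`-block `m₂(q)` of an element of the Klingen parabolic. -/
def m2K (p : ℕ) [Fact p.Prime] (q : Matrix (Fin 4) (Fin 4) ℚ_[p]) :
    Matrix (Fin 2) (Fin 2) ℚ_[p] :=
  !![q 1 1, q 1 3; q 3 1, q 3 3]

/-- `Γ₀(p) = {γ ∈ GL₂(ℤ_p) : γ₂₁ ∈ pℤ_p}`. -/
def Gamma0 (p : ℕ) [Fact p.Prime] : Set (Matrix (Fin 2) (Fin 2) ℚ_[p]) :=
  {γ | (∀ i j, ‖γ i j‖ ≤ 1) ∧ ‖γ.det‖ = 1 ∧ ‖γ 1 0‖ ≤ (p : ℝ)⁻¹}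

/-- The Weyl element `s₁`. -/
noncomputable def s1 (p : ℕ) [Fact p.Prime] : Matrix (Fin 4) (Fin 4) ℚ_[p] :=
  !![0, 1, 0, 0; 1, 0, 0, 0; 0, 0, 0, 1; 0, 0, 1, 0]

/-- The Weyl element `s₂`. -/
noncomputable def s2 (p : ℕ) [Fact p.Prime] : Matrix (Fin 4) (Fin 4) ℚ_[p] :=
  !![1, 0, 0, 0; 0, 0, 0, 1; 0, 0, 1, 0; 0, -1, 0, 0]

/-- The unipotent matrix `n` attached to `(x, y, z)` (Klingen setting). -/
noncomputable def nK (p : ℕ) [Fact p.Prime] (x y z : ℚ_[p]) : Matrix (Fin 4) (Fin 4) ℚ_[p] :=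
  !![1, x, z, y; 0, 1, y, 0; 0, 0, 1, 0; 0, 0, -x, 1]


theorem Padic.addValuation_le_addValuation_iff {p : ℕ} [Fact p.Prime] {x y : ℚ_[p]} :
    Padic.addValuation x ≤ Padic.addValuation y ↔ ‖y‖ ≤ ‖x‖ := by
  have hp : (1 : ℝ) < p := mod_cast (Fact.out : p.Prime).one_lt
  rcases eq_or_ne y 0 with rfl | hy
  · simp
  rcases eq_or_ne x 0 with rfl | hx
  · simp [hy]
  rw [Padic.addValuation.apply hx, Padic.addValuation.apply hy, WithTop.coe_le_coe,
    Padic.norm_eq_zpow_neg_valuation hx, Padic.norm_eq_zpow_neg_valuation hy,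
    zpow_le_zpow_iff_right₀ hp, neg_le_neg_iff]

theorem Padic.addValuation_le_neg_one_iff {p : ℕ} [Fact p.Prime] {x : ℚ_[p]} :
    Padic.addValuation x ≤ ((-1 : ℤ) : WithTop ℤ) ↔ (p : ℝ) ≤ ‖x‖ := by
  have hp0 : p ≠ 0 := (Fact.out : p.Prime).ne_zero
  have h : Padic.addValuation ((p : ℚ_[p])⁻¹) = ((-1 : ℤ) : WithTop ℤ) := by
    rw [Padic.addValuation.apply (inv_ne_zero (mod_cast hp0)), Padic.valuation_inv,
      Padic.valuation_p]
  rw [← h, Padic.addValuation_le_addValuation_iff]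
  simp

namespace Padic

variable {p : ℕ} [Fact p.Prime]

theorem norm_add_le_of_le {a b : ℚ_[p]} {c : ℝ} (ha : ‖a‖ ≤ c) (hb : ‖b‖ ≤ c) : ‖a + b‖ ≤ c :=
  (Padic.nonarchimedean a b).trans (max_le ha hb)

theorem norm_sub_le_of_le {a b : ℚ_[p]} {c : ℝ} (ha : ‖a‖ ≤ c) (hb : ‖b‖ ≤ c) : ‖a - b‖ ≤ c := by
  rw [sub_eq_add_neg]
  exact norm_add_le_of_le ha (by rwa [norm_neg])

theorem norm_mul_le_of_le_one_right {a b : ℚ_[p]} {c : ℝ} (ha : ‖a‖ ≤ c) (hb : ‖b‖ ≤ 1) :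
    ‖a * b‖ ≤ c := by
  rw [norm_mul]
  exact (mul_le_of_le_one_right (norm_nonneg a) hb).trans ha

theorem norm_mul_le_of_le_one_left {a b : ℚ_[p]} {c : ℝ} (ha : ‖a‖ ≤ 1) (hb : ‖b‖ ≤ c) :
    ‖a * b‖ ≤ c := by
  rw [mul_comm]
  exact norm_mul_le_of_le_one_right hb ha

theorem norm_eq_one_of_norm_sub_lt_one {a b : ℚ_[p]} (ha : ‖a‖ = 1) (h : ‖a - b‖ < 1) :
    ‖b‖ = 1 := by
  have hlt : ‖a + -b‖ < ‖a‖ := by rwa [ha, ← sub_eq_add_neg]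
  rw [← ha, Padic.norm_eq_of_norm_add_lt_left hlt, norm_neg]

theorem norm_eq_one_of_norm_mul_eq_one {a b : ℚ_[p]} (ha : ‖a‖ ≤ 1) (hb : ‖b‖ ≤ 1)
    (h : ‖a * b‖ = 1) : ‖a‖ = 1 ∧ ‖b‖ = 1 := by
  rw [norm_mul] at h
  have := norm_nonneg a
  have := norm_nonneg b
  constructor <;> nlinarith

theorem inv_prime_lt_one : (p : ℝ)⁻¹ < 1 :=
  inv_lt_one_of_one_lt₀ (mod_cast (Fact.out : p.Prime).one_lt)

end Padic

section Similitude

variable {p : ℕ} [Fact p.Prime] {g : Matrix (Fin 4) (Fin 4) ℚ_[p]} {μ : ℚ_[p]}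

theorem similitude_eq_of_cols_zero_two (h : gᵀ * J4 p * g = μ • J4 p) :
    g 0 0 * g 2 2 + g 1 0 * g 3 2 - g 2 0 * g 0 2 - g 3 0 * g 1 2 = μ := by
  have := congrFun (congrFun h 0) 2
  simp [J4, Matrix.mul_apply, Fin.sum_univ_four] at this
  linear_combination this

theorem similitude_eq_of_cols_one_three (h : gᵀ * J4 p * g = μ • J4 p) :
    g 0 1 * g 2 3 + g 1 1 * g 3 3 - g 2 1 * g 0 3 - g 3 1 * g 1 3 = μ := by
  have := congrFun (congrFun h 1) 3
  simp [J4, Matrix.mul_apply, Fin.sum_univ_four] at this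
  linear_combination this

end Similitude

theorem Bp_diagonal_norm_eq_one {p : ℕ} [Fact p.Prime] {γ : Matrix (Fin 4) (Fin 4) ℚ_[p]}
    (hγ : γ ∈ Bp p) : ‖γ 0 0‖ = 1 ∧ ‖γ 1 1‖ = 1 ∧ ‖γ 2 2‖ = 1 := by
  obtain ⟨hint, ⟨μ, hμ, hsim⟩, h10, h20, h30, h21, h31, h23⟩ := hγ
  have h02 : ‖γ 0 0 * γ 2 2‖ = 1 := by
    refine Padic.norm_eq_one_of_norm_sub_lt_one hμ (lt_of_le_of_lt ?_ (Padic.inv_prime_lt_one (p := p)))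
    rw [show μ - γ 0 0 * γ 2 2 = γ 1 0 * γ 3 2 - γ 2 0 * γ 0 2 - γ 3 0 * γ 1 2 by
      linear_combination -similitude_eq_of_cols_zero_two hsim]
    exact Padic.norm_sub_le_of_le (Padic.norm_sub_le_of_le
      (Padic.norm_mul_le_of_le_one_right h10 (hint _ _))
      (Padic.norm_mul_le_of_le_one_right h20 (hint _ _)))
      (Padic.norm_mul_le_of_le_one_right h30 (hint _ _))
  have h13 : ‖γ 1 1 * γ 3 3‖ = 1 := by
    refine Padic.norm_eq_one_of_norm_sub_lt_one hμ (lt_of_le_of_lt ?_ (Padic.inv_prime_lt_one (p := p)))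
    rw [show μ - γ 1 1 * γ 3 3 = γ 0 1 * γ 2 3 - γ 2 1 * γ 0 3 - γ 3 1 * γ 1 3 by
      linear_combination -similitude_eq_of_cols_one_three hsim]
    exact Padic.norm_sub_le_of_le (Padic.norm_sub_le_of_le
      (Padic.norm_mul_le_of_le_one_left (hint _ _) h23)
      (Padic.norm_mul_le_of_le_one_right h21 (hint _ _)))
      (Padic.norm_mul_le_of_le_one_right h31 (hint _ _))
  obtain ⟨h0, h2⟩ := Padic.norm_eq_one_of_norm_mul_eq_one (hint _ _) (hint _ _) h02
  exact ⟨h0, (Padic.norm_eq_one_of_norm_mul_eq_one (hint _ _) (hint _ _) h13).1, h2⟩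

section Factorization

variable {p : ℕ} [Fact p.Prime] {x y z : ℚ_[p]}

theorem s1_s2_s1_mul_nK :
    s1 p * s2 p * s1 p * nK p x y z =
      !![0, 0, 1, 0; 0, 1, y, 0; -1, -x, -z, -y; 0, 0, -x, 1] := by
  ext i j
  fin_cases i <;> fin_cases j <;> simp [s1, s2, nK, Matrix.mul_apply, Fin.sum_univ_four]

theorem s1_s2_mul (γ : Matrix (Fin 4) (Fin 4) ℚ_[p]) :
    s1 p * s2 p * γ = Matrix.of ![γ 3, γ 0, -γ 1, γ 2] := by
  ext i j
  fin_cases i <;> fin_cases j <;> simp [s1, s2, Matrix.mul_apply, Fin.sum_univ_four]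

theorem exists_mem_PK_mem_Bp (hx : (p : ℝ) ≤ ‖x‖) (hy : ‖y‖ ≤ ‖x‖) (hz : ‖z‖ ≤ ‖x‖) :
    ∃ q ∈ PK p, ∃ γ ∈ Bp p, s1 p * s2 p * s1 p * nK p x y z = q * (s1 p * s2 p * γ) := by
  have hp : (0 : ℝ) < p := mod_cast (Fact.out : p.Prime).pos
  have hx0 : x ≠ 0 := norm_pos_iff.1 (hp.trans_le hx)
  have hxi : ‖x‖⁻¹ ≤ (p : ℝ)⁻¹ := inv_anti₀ hp hx
  have hxi1 : ‖x‖⁻¹ ≤ 1 := hxi.trans Padic.inv_prime_lt_one.le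
  have hyx : ‖y‖ / ‖x‖ ≤ 1 := div_le_one_of_le₀ hy (norm_nonneg _)
  have hzx : ‖z‖ / ‖x‖ ≤ 1 := div_le_one_of_le₀ hz (norm_nonneg _)
  refine ⟨!![x⁻¹, 0, 0, 1; 0, -x⁻¹, -1, y - z / x; 0, 0, x, 0; 0, 0, 0, -x], ?_,
    !![1, 0, 0, z / x; x⁻¹, 1, z / x, y / x; 0, 0, 1, -x⁻¹; 0, 0, 0, 1], ?_, ?_⟩
  · refine ⟨⟨?_, 1, one_ne_zero, ?_⟩, by simp⟩
    · simp [Matrix.det_succ_row_zero, Fin.sum_univ_succ, Fin.succAbove, hx0]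
    · ext i j
      fin_cases i <;> fin_cases j <;>
        simp [J4, Matrix.mul_apply, Fin.sum_univ_four, hx0]
      ring
  · refine ⟨?_, ⟨1, norm_one, ?_⟩, ?_⟩
    · intro i j
      fin_cases i <;> fin_cases j <;> simp [hxi1, hyx, hzx]
    · ext i j
      fin_cases i <;> fin_cases j <;> simp [J4, Matrix.mul_apply, Fin.sum_univ_four]
      ring
    · simp [hxi]
  · rw [s1_s2_s1_mul_nK, s1_s2_mul]
    ext i j
    fin_cases i <;> fin_cases j <;> simp [Matrix.mul_apply, Fin.sum_univ_four] <;>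
      field_simp
    ring

variable {q γ : Matrix (Fin 4) (Fin 4) ℚ_[p]}

theorem row_one_eq_of_factorization (hq : q ∈ PK p)
    (h : s1 p * s2 p * s1 p * nK p x y z = q * (s1 p * s2 p * γ)) :
    q 2 2 * γ 1 0 = 1 ∧ q 2 2 * γ 1 1 = x ∧ q 2 2 * γ 1 2 = z ∧ q 2 2 * γ 1 3 = y := by
  obtain ⟨-, -, h20, -, h21, h23⟩ := hq
  rw [s1_s2_s1_mul_nK, s1_s2_mul] at h
  have e (j : Fin 4) := congrFun (congrFun h 2) j
  simp only [Matrix.mul_apply, Fin.sum_univ_four, h20, h21, h23] at e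
  have e0 := e 0
  have e1 := e 1
  have e2 := e 2
  have e3 := e 3
  simp at e0 e1 e2 e3
  exact ⟨e0.symm, e1.symm, e2.symm, e3.symm⟩

theorem norm_q_two_two (hq : q ∈ PK p) (hγ : γ ∈ Bp p)
    (h : s1 p * s2 p * s1 p * nK p x y z = q * (s1 p * s2 p * γ)) : ‖q 2 2‖ = ‖x‖ := by
  rw [← (row_one_eq_of_factorization hq h).2.1, norm_mul, (Bp_diagonal_norm_eq_one hγ).2.1,
    mul_one]

theorem norm_bounds_of_factorization (hq : q ∈ PK p) (hγ : γ ∈ Bp p)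
    (h : s1 p * s2 p * s1 p * nK p x y z = q * (s1 p * s2 p * γ)) :
    (p : ℝ) ≤ ‖x‖ ∧ ‖y‖ ≤ ‖x‖ ∧ ‖z‖ ≤ ‖x‖ := by
  have hp : (0 : ℝ) < p := mod_cast (Fact.out : p.Prime).pos
  obtain ⟨e0, -, e2, e3⟩ := row_one_eq_of_factorization hq h
  have hn := norm_q_two_two hq hγ h
  refine ⟨?_, ?_, ?_⟩
  · have h1 : ‖x‖ * ‖γ 1 0‖ = 1 := by rw [← hn, ← norm_mul, e0, norm_one]
    have h2 := mul_le_mul_of_nonneg_left hγ.2.2.1 (norm_nonneg x)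
    rw [h1, ← div_eq_mul_inv, one_le_div hp] at h2
    exact h2
  · rw [← e3]
    exact Padic.norm_mul_le_of_le_one_right hn.le (hγ.1 _ _)
  · rw [← e2]
    exact Padic.norm_mul_le_of_le_one_right hn.le (hγ.1 _ _)

theorem norm_similitude_eq_one_of_factorization {μ : ℚ_[p]} (hμ : qᵀ * J4 p * q = μ • J4 p)
    (hγ : γ ∈ Bp p) (h : s1 p * s2 p * s1 p * nK p x y z = q * (s1 p * s2 p * γ)) : ‖μ‖ = 1 := by
  obtain ⟨-, ⟨ν, hν, hsim⟩, -⟩ := hγ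
  have hw : (s1 p * s2 p)ᵀ * J4 p * (s1 p * s2 p) = J4 p := by
    ext i j
    fin_cases i <;> fin_cases j <;> simp [s1, s2, J4, Matrix.mul_apply, Fin.sum_univ_four]
  have hl : (s1 p * s2 p * s1 p * nK p x y z)ᵀ * J4 p * (s1 p * s2 p * s1 p * nK p x y z) =
      J4 p := by
    rw [s1_s2_s1_mul_nK]
    ext i j
    fin_cases i <;> fin_cases j <;> simp [J4, Matrix.mul_apply, Fin.sum_univ_four]
    ring
  have hr : (q * (s1 p * s2 p * γ))ᵀ * J4 p * (q * (s1 p * s2 p * γ)) = (μ * ν) • J4 p := by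
    calc _ = γᵀ * ((s1 p * s2 p)ᵀ * (qᵀ * J4 p * q) * (s1 p * s2 p)) * γ := by
          simp only [Matrix.transpose_mul, Matrix.mul_assoc]
      _ = (μ * ν) • J4 p := by
          rw [hμ, Matrix.mul_smul, Matrix.smul_mul, hw, Matrix.mul_smul, Matrix.smul_mul, hsim,
            smul_smul]
  rw [← h, hl] at hr
  have he := congrFun (congrFun hr 0) 2
  simp [J4] at he
  have := congrArg norm he
  rw [norm_one, norm_mul, hν, mul_one] at this
  exact this.symm

theorem m1_mem_of_factorization (hq : q ∈ PK p) (hγ : γ ∈ Bp p)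
    (h : s1 p * s2 p * s1 p * nK p x y z = q * (s1 p * s2 p * γ)) :
    ∃ u : ℚ_[p], ‖u‖ = 1 ∧ q 0 0 = x⁻¹ * u := by
  have hp : (0 : ℝ) < p := mod_cast (Fact.out : p.Prime).pos
  have hx0 : x ≠ 0 := norm_pos_iff.1 (hp.trans_le (norm_bounds_of_factorization hq hγ h).1)
  have hn := norm_q_two_two hq hγ h
  refine ⟨x * q 0 0, ?_, by field_simp⟩
  obtain ⟨⟨-, μ, -, hμ⟩, h10, h20, h30, -⟩ := hq
  have hs := similitude_eq_of_cols_zero_two hμ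
  rw [h10, h20, h30] at hs
  rw [norm_mul, ← hn, ← norm_mul,
    ← norm_similitude_eq_one_of_factorization hμ hγ h, ← hs]
  ring_nf

theorem m2K_mul_of_factorization (hx0 : x ≠ 0) (hq : q ∈ PK p)
    (h : s1 p * s2 p * s1 p * nK p x y z = q * (s1 p * s2 p * γ)) :
    m2K p q * !![γ 0 0 - γ 0 1 / x, γ 0 2 - z / x * γ 0 1;
        γ 2 0 - γ 2 1 / x, γ 2 2 - z / x * γ 2 1] =
      !![-x⁻¹, y - z / x; 0, -x] := by
  obtain ⟨e0, e1, e2, -⟩ := row_one_eq_of_factorization hq h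
  have hq22 : q 2 2 ≠ 0 := left_ne_zero_of_mul_eq_one e0
  have f0 : γ 1 0 = γ 1 1 / x := by
    rw [eq_div_iff hx0]
    apply mul_left_cancel₀ hq22
    linear_combination x * e0 - e1
  have f2 : γ 1 2 = z / x * γ 1 1 := by
    field_simp
    apply mul_left_cancel₀ hq22
    linear_combination x * e2 - z * e1
  obtain ⟨-, h10, -, h30, -, -⟩ := hq
  rw [s1_s2_s1_mul_nK, s1_s2_mul] at h
  have e (i j : Fin 4) := congrFun (congrFun h i) j
  simp only [Matrix.mul_apply, Fin.sum_univ_four] at e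
  have r10 := e 1 0
  have r11 := e 1 1
  have r12 := e 1 2
  have r30 := e 3 0
  have r31 := e 3 1
  have r32 := e 3 2
  simp [h10, h30, f0, f2] at r10 r11 r12 r30 r31 r32
  ext i j
  fin_cases i <;> fin_cases j <;> simp [m2K]
  · linear_combination -r10 + r11 / x
  · linear_combination -r12 + z / x * r11
  · linear_combination -r30 + r31 / x
  · linear_combination -r32 + z / x * r31

theorem eq_mul_of_mul_mem_Gamma0 {M A D K : Matrix (Fin 2) (Fin 2) ℚ_[p]} (hK : K ∈ Gamma0 p)
    (h : M * K = A * D) : M = A * (D * K⁻¹) := by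
  have hu : IsUnit K.det := isUnit_iff_ne_zero.2 (norm_ne_zero_iff.1 (by simp [hK.2.1]))
  rw [← Matrix.mul_assoc, ← h, Matrix.mul_nonsing_inv_cancel_right _ _ hu]

theorem Gamma0_diag_mul_inv {K : Matrix (Fin 2) (Fin 2) ℚ_[p]} (hK : K ∈ Gamma0 p) :
    !![1, 0; 0, -1] * K⁻¹ ∈ Gamma0 p := by
  obtain ⟨hint, hdet, h10⟩ := hK
  have hinv : K⁻¹ = K.det⁻¹ • !![K 1 1, -K 0 1; -K 1 0, K 0 0] := by
    rw [Matrix.inv_def, Ring.inverse_eq_inv', Matrix.adjugate_fin_two]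
  refine ⟨?_, ?_, ?_⟩
  · intro i j
    rw [hinv]
    fin_cases i <;> fin_cases j <;> simp [Matrix.mul_apply, hdet, hint]
  · rw [Matrix.det_mul, norm_mul, Matrix.det_nonsing_inv, Ring.inverse_eq_inv', norm_inv, hdet]
    simp
  · rw [hinv]
    simpa [Matrix.mul_apply, hdet] using h10

theorem m2_mem_of_factorization (hq : q ∈ PK p) (hγ : γ ∈ Bp p)
    (h : s1 p * s2 p * s1 p * nK p x y z = q * (s1 p * s2 p * γ)) :
    ∃ γ' ∈ Gamma0 p, m2K p q = !![-x⁻¹, -y + z / x; 0, x] * γ' := by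
  have hp : (0 : ℝ) < p := mod_cast (Fact.out : p.Prime).pos
  obtain ⟨hx, -, hz⟩ := norm_bounds_of_factorization hq hγ h
  have hx0 : x ≠ 0 := norm_pos_iff.1 (hp.trans_le hx)
  have hxi : ‖x⁻¹‖ ≤ (p : ℝ)⁻¹ := by rw [norm_inv]; exact inv_anti₀ hp hx
  have hzx : ‖z / x‖ ≤ 1 := by rw [norm_div]; exact div_le_one_of_le₀ hz (norm_nonneg _)
  obtain ⟨u0, -, u2⟩ := Bp_diagonal_norm_eq_one hγ
  have hM := m2K_mul_of_factorization hx0 hq h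
  obtain ⟨hint, -, -, h20, -, h21, -, -⟩ := hγ
  have hp1 : (p : ℝ)⁻¹ < 1 := Padic.inv_prime_lt_one
  set K : Matrix (Fin 2) (Fin 2) ℚ_[p] := !![γ 0 0 - γ 0 1 / x, γ 0 2 - z / x * γ 0 1;
        γ 2 0 - γ 2 1 / x, γ 2 2 - z / x * γ 2 1] with hKdef
  have d0 : ‖γ 0 1 / x‖ ≤ (p : ℝ)⁻¹ := by
    rw [div_eq_mul_inv]
    exact Padic.norm_mul_le_of_le_one_left (hint _ _) hxi
  have d1 : ‖z / x * γ 2 1‖ ≤ (p : ℝ)⁻¹ := Padic.norm_mul_le_of_le_one_left hzx h21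
  have k00 : ‖K 0 0‖ = 1 :=
    Padic.norm_eq_one_of_norm_sub_lt_one u0 (by simpa [hKdef] using d0.trans_lt hp1)
  have k11 : ‖K 1 1‖ = 1 :=
    Padic.norm_eq_one_of_norm_sub_lt_one u2 (by simpa [hKdef] using d1.trans_lt hp1)
  have k01 : ‖K 0 1‖ ≤ 1 :=
    Padic.norm_sub_le_of_le (hint _ _) (Padic.norm_mul_le_of_le_one_left hzx (hint _ _))
  have k10 : ‖K 1 0‖ ≤ (p : ℝ)⁻¹ := by
    refine Padic.norm_sub_le_of_le h20 ?_
    rw [div_eq_mul_inv]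
    exact Padic.norm_mul_le_of_le_one_left (hint _ _) hxi
  have hK : K ∈ Gamma0 p := by
    refine ⟨?_, ?_, k10⟩
    · intro i j
      fin_cases i <;> fin_cases j
      exacts [k00.le, k01, k10.trans hp1.le, k11.le]
    · have hd : ‖K 0 0 * K 1 1‖ = 1 := by rw [norm_mul, k00, k11, mul_one]
      refine Padic.norm_eq_one_of_norm_sub_lt_one hd ?_
      rw [Matrix.det_fin_two, sub_sub_cancel]
      exact (Padic.norm_mul_le_of_le_one_left k01 k10).trans_lt hp1
  refine ⟨_, Gamma0_diag_mul_inv hK, eq_mul_of_mul_mem_Gamma0 hK (hM.trans ?_)⟩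
  ext i j
  fin_cases i <;> fin_cases j <;> simp [Matrix.mul_apply]
  ring

end Factorization

/-- `σ·n ∈ P_K(ℚ_p)·s₁s₂·B(p)` iff `v_p(x) ≤ min{−1, v_p(y), v_p(z)}`
(here `σ = s₁s₂s₁` and `n` is the unipotent matrix attached to `(x,y,z)`); moreover in that
case any factorization `σ·n = q·s₁s₂·γ` with `q ∈ P_K(ℚ_p)`, `γ ∈ B(p)` satisfies
`m₁(q) ∈ x⁻¹·ℤ_p^×` and `m₂(q) ∈ [[−x⁻¹, −y + z/x],[0, x]]·Γ₀(p)`. -/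
theorem stmt_8 (p : ℕ) [Fact p.Prime] (x y z : ℚ_[p]) :
    ((∃ q ∈ PK p, ∃ γ ∈ Bp p, s1 p * s2 p * s1 p * nK p x y z = q * (s1 p * s2 p * γ)) ↔
      Padic.addValuation x ≤
        min ((-1 : ℤ) : WithTop ℤ) (min (Padic.addValuation y) (Padic.addValuation z))) ∧
    (∀ q γ : Matrix (Fin 4) (Fin 4) ℚ_[p], q ∈ PK p → γ ∈ Bp p →
      s1 p * s2 p * s1 p * nK p x y z = q * (s1 p * s2 p * γ) →
      (∃ u : ℚ_[p], ‖u‖ = 1 ∧ q 0 0 = x⁻¹ * u) ∧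
      ∃ γ' ∈ Gamma0 p, m2K p q = !![-x⁻¹, -y + z / x; 0, x] * γ') := by
  rw [le_min_iff, le_min_iff, Padic.addValuation_le_neg_one_iff,
    Padic.addValuation_le_addValuation_iff, Padic.addValuation_le_addValuation_iff]
  refine ⟨⟨?_, fun ⟨hx, hy, hz⟩ => exists_mem_PK_mem_Bp hx hy hz⟩, fun q γ hq hγ h =>
    ⟨m1_mem_of_factorization hq hγ h, m2_mem_of_factorization hq hγ h⟩⟩
  rintro ⟨q, hq, γ, hγ, h⟩
  exact norm_bounds_of_factorization hq hγ h
end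

section
/- Let p be a prime, θ and W as below, and w = [[0,1],[1,0]]. Let R = { (x,y,z) ∈ ℚ_p³ : v_p(z) < min{0, v_p(x), v_p(y)} }. Then there exists ν₀ ∈ ℝ (depending on W) such that for every ν ∈ ℂ with Re(ν) > ν₀, the function (x,y,z) ↦ |z|^{−2−ν} · W([[xy−z, −y²],[−x², xy+z]]) · θ(−x) is absolutely integrable on R and ∫_R |z|^{−2−ν} W([[xy−z, −y²],[−x², xy+z]]) θ(−x) dx dy dz = W(1)·((1 − p⁻¹)(p^{−1−ν} + p^{−1−2ν}) − p^{−3−3ν}) − W(w)·p^{−1−2ν}(1 − p⁻¹), where 1 denotes the identity matrix of GL₂(ℚ_p). -/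
open Matrix MeasureTheory

namespace PadicWhittaker

variable {p : ℕ} [Fact p.Prime]

theorem one_lt_p : (1 : ℝ) < p := by exact_mod_cast (Fact.out : p.Prime).one_lt

theorem p_sub_one_ne_zero : (p : ℂ) - 1 ≠ 0 :=
  sub_ne_zero.2 (Nat.cast_ne_one.2 (Fact.out : p.Prime).ne_one)

theorem p_mul_norm_le_of_norm_lt {x y : ℚ_[p]} (h : ‖x‖ < ‖y‖) : p * ‖x‖ ≤ ‖y‖ := by
  have hy : 0 < ‖y‖ := (norm_nonneg x).trans_lt h
  have hp : (0 : ℝ) < p := one_lt_p.trans' one_pos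
  have h1 : ‖x / y‖ < (p : ℝ) ^ (0 : ℤ) := by
    rw [norm_div, zpow_zero, div_lt_one hy]; exact h
  rw [Padic.norm_lt_pow_iff_norm_le_pow_sub_one, norm_div, div_le_iff₀ hy] at h1
  have h2 : (p : ℝ) ^ ((0 : ℤ) - 1) = (p : ℝ)⁻¹ := by norm_num
  rw [h2, inv_mul_eq_div, le_div_iff₀ hp] at h1
  linarith

theorem norm_p_inv_pow (n : ℕ) : ‖(p : ℚ_[p])⁻¹ ^ n‖ = (p : ℝ) ^ n := by simp

theorem norm_le_pow_of_lt_pow_succ {x : ℚ_[p]} {n : ℕ} (h : ‖x‖ < (p : ℝ) ^ (n + 1)) :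
    ‖x‖ ≤ (p : ℝ) ^ n := by
  rw [← norm_p_inv_pow] at h
  have h1 := p_mul_norm_le_of_norm_lt h
  rw [norm_p_inv_pow, pow_succ', mul_le_mul_iff_right₀ (one_lt_p.trans' one_pos)] at h1
  exact h1

theorem pow_succ_le_norm_of_pow_lt {x : ℚ_[p]} {n : ℕ} (h : (p : ℝ) ^ n < ‖x‖) :
    (p : ℝ) ^ (n + 1) ≤ ‖x‖ := by
  rw [← norm_p_inv_pow] at h
  have h1 := p_mul_norm_le_of_norm_lt h
  rwa [norm_p_inv_pow, ← pow_succ'] at h1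

theorem exists_norm_eq_pow_succ {x : ℚ_[p]} (h : 1 < ‖x‖) : ∃ n : ℕ, ‖x‖ = (p : ℝ) ^ (n + 1) := by
  have hx : x ≠ 0 := by rintro rfl; simp at h; linarith
  have h2 := Padic.norm_eq_zpow_neg_valuation hx
  have h3 : 0 < -x.valuation := by
    rw [h2] at h
    exact (one_lt_zpow_iff_right₀ one_lt_p).1 h
  obtain ⟨n, hn⟩ := Int.eq_ofNat_of_zero_le h3.le
  obtain ⟨m, rfl⟩ : ∃ m, n = m + 1 := ⟨n - 1, by omega⟩
  exact ⟨m, by rw [h2, hn]; norm_cast⟩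

theorem norm_add_le_of_le {x y : ℚ_[p]} {r : ℝ} (hx : ‖x‖ ≤ r) (hy : ‖y‖ ≤ r) : ‖x + y‖ ≤ r :=
  (Padic.nonarchimedean x y).trans (max_le hx hy)

theorem norm_add_sq_lt {x y : ℚ_[p]} {r : ℝ} (hx : ‖x‖ ^ 2 < r) (hy : ‖y‖ ^ 2 < r) :
    ‖x + y‖ ^ 2 < r := by
  rcases le_max_iff.1 (Padic.nonarchimedean x y) with h | h
  · exact (pow_le_pow_left₀ (norm_nonneg _) h 2).trans_lt hx
  · exact (pow_le_pow_left₀ (norm_nonneg _) h 2).trans_lt hy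

theorem norm_add_lt_of_lt {x y : ℚ_[p]} {r : ℝ} (hx : ‖x‖ < r) (hy : ‖y‖ < r) : ‖x + y‖ < r :=
  (Padic.nonarchimedean x y).trans_lt (max_lt hx hy)

theorem norm_add_eq_left {x y : ℚ_[p]} (h : ‖y‖ < ‖x‖) : ‖x + y‖ = ‖x‖ := by
  rw [Padic.add_eq_max_of_ne h.ne', max_eq_left h.le]

theorem addValuation_lt_iff {x y : ℚ_[p]} :
    Padic.addValuation x < Padic.addValuation y ↔ ‖y‖ < ‖x‖ := by
  by_cases hx : x = 0
  · simp [hx]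
  by_cases hy : y = 0
  · subst hy
    simp [hx]
  rw [Padic.addValuation.apply hx, Padic.addValuation.apply hy,
    Padic.norm_eq_zpow_neg_valuation hx, Padic.norm_eq_zpow_neg_valuation hy,
    zpow_lt_zpow_iff_right₀ one_lt_p, neg_lt_neg_iff]
  norm_cast

/-- A continuous unitary additive character of `ℚ_p` with conductor `ℤ_p`. -/
structure IsStandardCharacter (θ : ℚ_[p] → ℂ) : Prop where
  continuous : Continuous θ
  map_add : ∀ a b : ℚ_[p], θ (a + b) = θ a * θ b
  norm_eq_one : ∀ a : ℚ_[p], ‖θ a‖ = 1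
  eq_one : ∀ a : ℚ_[p], ‖a‖ ≤ 1 → θ a = 1
  exists_ne_one : ∃ a : ℚ_[p], ‖a‖ ≤ (p : ℝ) ∧ θ a ≠ 1

namespace IsStandardCharacter

variable {θ : ℚ_[p] → ℂ}

theorem map_natCast_mul (hθ : IsStandardCharacter θ) (n : ℕ) (a : ℚ_[p]) : θ (n * a) = θ a ^ n := by
  induction n with
  | zero => simpa using hθ.eq_one 0 (by simp)
  | succ n ih => rw [Nat.cast_succ, add_mul, one_mul, hθ.map_add, ih, pow_succ]

theorem ne_one (hθ : IsStandardCharacter θ) {b : ℚ_[p]} (hb : ‖b‖ = p) : θ b ≠ 1 := by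
  intro h
  obtain ⟨a, ha, hne⟩ := hθ.exists_ne_one
  have hp : (0 : ℝ) < p := one_lt_p.trans' one_pos
  have hb0 : b ≠ 0 := by rintro rfl; simp at hb; linarith
  have hab : ‖a / b‖ ≤ 1 := by rw [norm_div, hb]; exact (div_le_one hp).2 ha
  obtain ⟨n, -, hn⟩ := PadicInt.exists_mem_range (⟨a / b, hab⟩ : ℤ_[p])
  rw [PadicInt.maximalIdeal_eq_span_p, Ideal.mem_span_singleton] at hn
  obtain ⟨c, hc⟩ := hn
  have hc' : a / b - n = p * c := congrArg Subtype.val hc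
  have ha' : a = n * b + p * b * c := by field_simp at hc'; linear_combination hc'
  apply hne
  rw [ha', hθ.map_add, hθ.map_natCast_mul, h, one_pow, one_mul]
  apply hθ.eq_one
  rw [norm_mul, norm_mul, hb, Padic.norm_p, inv_mul_cancel₀ hp.ne', one_mul]
  exact c.2

theorem sum_range_eq_zero (hθ : IsStandardCharacter θ) {b : ℚ_[p]} (hb : ‖b‖ = p) :
    ∑ j ∈ Finset.range p, θ (j * b) = 0 := by
  have hp : (0 : ℝ) < p := one_lt_p.trans' one_pos
  simp_rw [hθ.map_natCast_mul]
  have h1 := geom_sum_mul (θ b) p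
  rw [← hθ.map_natCast_mul, hθ.eq_one (p * b), sub_self, mul_eq_zero] at h1
  · exact h1.resolve_right (sub_ne_zero.2 (hθ.ne_one hb))
  · rw [norm_mul, hb, Padic.norm_p, inv_mul_cancel₀ hp.ne']

end IsStandardCharacter

/-- A translation invariant measure on `ℚ_p` giving `ℤ_p` measure `1`. -/
structure IsNormalizedHaar [MeasurableSpace ℚ_[p]] (μ : Measure ℚ_[p]) : Prop where
  map_add : ∀ a : ℚ_[p], μ.map (a + ·) = μ
  unit_ball : μ {x : ℚ_[p] | ‖x‖ ≤ 1} = 1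

namespace IsNormalizedHaar

variable [MeasurableSpace ℚ_[p]] [BorelSpace ℚ_[p]] {μ : Measure ℚ_[p]}

theorem measurePreserving_add (hμ : IsNormalizedHaar μ) (a : ℚ_[p]) :
    MeasurePreserving (a + ·) μ μ :=
  ⟨by fun_prop, hμ.map_add a⟩

theorem measurableSet_ball (r : ℝ) : MeasurableSet {x : ℚ_[p] | ‖x‖ ≤ r} :=
  measurableSet_le measurable_norm measurable_const

theorem measure_ball_pow (hμ : IsNormalizedHaar μ) (n : ℕ) :
    μ {x : ℚ_[p] | ‖x‖ ≤ (p : ℝ) ^ n} = (p : ENNReal) ^ n := by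
  have hp : (0 : ℝ) < p := one_lt_p.trans' one_pos
  induction n with
  | zero => simpa using hμ.unit_ball
  | succ n ih =>
    set a : ℚ_[p] := (p : ℚ_[p])⁻¹ ^ (n + 1) with ha_def
    have ha : ‖a‖ = (p : ℝ) ^ (n + 1) := norm_p_inv_pow _
    have ha0 : a ≠ 0 := norm_pos_iff.1 (by rw [ha]; positivity)
    have hiff : ∀ (x : ℚ_[p]) (j : ℕ), ‖-(j * a) + x‖ ≤ (p : ℝ) ^ n ↔ ‖x / a - j‖ < 1 := by
      intro x j
      have : -(j * a) + x = (x / a - j) * a := by field_simp; ring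
      rw [this, norm_mul, ha]
      constructor
      · intro h
        by_contra! h1
        have h2 := mul_le_mul_of_nonneg_right h1 (pow_nonneg hp.le (n + 1))
        have h3 := pow_lt_pow_right₀ (one_lt_p (p := p)) (Nat.lt_succ_self n)
        simp only [Nat.succ_eq_add_one] at h3
        linarith
      · intro h
        rw [← ha, ← norm_mul]
        apply norm_le_pow_of_lt_pow_succ
        rw [norm_mul, ha]
        exact mul_lt_of_lt_one_left (by positivity) h
    have hset : {x : ℚ_[p] | ‖x‖ ≤ (p : ℝ) ^ (n + 1)} =
        ⋃ j ∈ Finset.range p, (-(j * a) + ·) ⁻¹' {x : ℚ_[p] | ‖x‖ ≤ (p : ℝ) ^ n} := by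
      ext x
      simp only [Set.mem_ofPred_eq, Set.mem_iUnion, Set.mem_preimage, Finset.mem_range, hiff,
        exists_prop]
      constructor
      · intro h
        have hx : ‖x / a‖ ≤ 1 := by
          rw [norm_div, ha]; exact (div_le_one (by positivity)).2 h
        obtain ⟨j, hj, hj'⟩ := PadicInt.exists_mem_range (⟨x / a, hx⟩ : ℤ_[p])
        rw [PadicInt.maximalIdeal_eq_span_p, Ideal.mem_span_singleton,
          ← PadicInt.norm_lt_one_iff_dvd] at hj'
        exact ⟨j, hj, hj'⟩
      · rintro ⟨j, -, hj⟩
        have hx : ‖x / a‖ ≤ 1 := by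
          rw [← sub_add_cancel (x / a) (j : ℚ_[p])]
          exact norm_add_le_of_le hj.le (by simpa using Padic.norm_int_le_one (p := p) j)
        rw [norm_div, ha] at hx
        exact (div_le_one (by positivity)).1 hx
    rw [hset, measure_biUnion_finset]
    · simp_rw [(hμ.measurePreserving_add _).measure_preimage
        (measurableSet_ball _).nullMeasurableSet, ih]
      simp [pow_succ']
    · intro j hj k hk hjk
      rw [Function.onFun, Set.disjoint_left]
      intro x hxj hxk
      simp only [Set.mem_ofPred_eq, Set.mem_preimage, hiff] at hxj hxk
      apply hjk
      have h1 : ‖((j - k : ℤ) : ℚ_[p])‖ < 1 := by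
        have : ((j - k : ℤ) : ℚ_[p]) = (x / a - k) + -(x / a - j) := by push_cast; ring
        rw [this]
        exact norm_add_lt_of_lt hxk (by rwa [norm_neg])
      rw [Padic.norm_intCast_lt_one_iff] at h1
      simp only [Finset.coe_range, Set.mem_Iio] at hj hk
      have := Int.eq_zero_of_abs_lt_dvd h1 (by rw [abs_lt]; omega)
      omega
    · intro j _
      exact (hμ.measurePreserving_add _).measurable (measurableSet_ball _)

theorem measure_sphere_pow (hμ : IsNormalizedHaar μ) (n : ℕ) :
    μ {x : ℚ_[p] | ‖x‖ = (p : ℝ) ^ (n + 1)} = ENNReal.ofReal ((p : ℝ) ^ n * (p - 1)) := by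
  have hset : {x : ℚ_[p] | ‖x‖ = (p : ℝ) ^ (n + 1)} =
      {x : ℚ_[p] | ‖x‖ ≤ (p : ℝ) ^ (n + 1)} \ {x : ℚ_[p] | ‖x‖ ≤ (p : ℝ) ^ n} := by
    ext x
    simp only [Set.mem_ofPred_eq, Set.mem_sdiff, not_le]
    constructor
    · intro h
      exact ⟨h.le, h ▸ pow_lt_pow_right₀ one_lt_p (Nat.lt_succ_self n)⟩
    · rintro ⟨h1, h2⟩
      exact le_antisymm h1 (pow_succ_le_norm_of_pow_lt h2)
  rw [hset, measure_sdiff _ (measurableSet_ball _).nullMeasurableSet, hμ.measure_ball_pow,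
    hμ.measure_ball_pow]
  · rw [mul_sub, mul_one, ← pow_succ, ENNReal.ofReal_sub _ (by positivity)]
    simp [ENNReal.ofReal_pow]
  · rw [hμ.measure_ball_pow]; simp
  · intro x hx
    exact (show ‖x‖ ≤ (p : ℝ) ^ n from hx).trans
      (pow_le_pow_right₀ one_lt_p.le (Nat.le_succ n))

theorem isAddHaarMeasure (hμ : IsNormalizedHaar μ) : μ.IsAddHaarMeasure := by
  have : μ.IsAddLeftInvariant := ⟨hμ.map_add⟩
  refine Measure.isAddHaarMeasure_of_isCompact_nonempty_interior μ
    {x : ℚ_[p] | ‖x‖ ≤ 1} ?_ ?_ ?_ ?_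
  · have : {x : ℚ_[p] | ‖x‖ ≤ 1} = Metric.closedBall 0 1 := by ext; simp
    rw [this]; exact isCompact_closedBall _ _
  · refine ⟨0, interior_mono (s := Metric.ball 0 1) ?_ ?_⟩
    · intro x hx
      simpa using (mem_ball_zero_iff.1 hx).le
    · rw [Metric.isOpen_ball.interior_eq]; simp
  · rw [hμ.unit_ball]; simp
  · rw [hμ.unit_ball]; simp

theorem measurePreserving_mul (hμ : IsNormalizedHaar μ) {u : ℚ_[p]} (hu : ‖u‖ = 1) :
    MeasurePreserving (u * ·) μ μ := by
  have hm : Measurable (u * · : ℚ_[p] → ℚ_[p]) := by fun_prop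
  refine ⟨hm, ?_⟩
  have hu0 : u ≠ 0 := norm_pos_iff.1 (by rw [hu]; exact one_pos)
  have := hμ.isAddHaarMeasure
  have h2 : (μ.map (u * ·)).IsAddLeftInvariant := by
    refine ⟨fun a => ?_⟩
    rw [Measure.map_map (by fun_prop) hm]
    have : (a + ·) ∘ (u * · : ℚ_[p] → ℚ_[p]) = (u * ·) ∘ (a / u + ·) := by
      ext x; simp; field_simp
    rw [this, ← Measure.map_map hm (by fun_prop), hμ.map_add]
  have hball : μ.map (u * ·) {x : ℚ_[p] | ‖x‖ ≤ 1} = 1 := by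
    rw [Measure.map_apply hm (measurableSet_ball _), ← hμ.unit_ball]
    congr 1; ext x; simp [hu]
  have hμ' : IsNormalizedHaar (μ.map (u * ·)) := ⟨h2.1, hball⟩
  have := hμ'.isAddHaarMeasure
  have h3 := Measure.isAddLeftInvariant_eq_smul (μ.map (u * ·)) μ
  have h4 := congrArg (fun m : Measure ℚ_[p] => m {x : ℚ_[p] | ‖x‖ ≤ 1}) h3
  simp only [hball, Measure.smul_apply, hμ.unit_ball] at h4
  rw [h3]
  have h5 : Measure.addHaarScalarFactor (μ.map (u * ·)) μ = 1 := by
    rw [ENNReal.smul_def, smul_eq_mul, mul_one] at h4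
    exact_mod_cast h4.symm
  rw [h5, one_smul]

end IsNormalizedHaar

theorem preimage_unit_eq {X : Type*} {S : Set X} {T : ℚ_[p] → X → X}
    (hinv : ∀ u, ‖u‖ = 1 → ∀ q, T u⁻¹ (T u q) = q)
    (hTS : ∀ u, ‖u‖ = 1 → ∀ q ∈ S, T u q ∈ S) {u : ℚ_[p]} (hu : ‖u‖ = 1) : T u ⁻¹' S = S := by
  ext q
  refine ⟨fun h => ?_, hTS u hu q⟩
  rw [← hinv u hu q]
  exact hTS u⁻¹ (by rw [norm_inv, hu, inv_one]) _ h

theorem norm_natCast_eq_one_of_mem_Ico {j : ℕ} (hj : j ∈ Finset.Ico 1 p) :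
    ‖(j : ℚ_[p])‖ = 1 := by
  rw [Padic.norm_natCast_eq_one_iff]
  rw [Finset.mem_Ico] at hj
  exact Nat.coprime_of_lt_prime (by omega) hj.2 Fact.out

section Averaging

variable {X : Type*} [MeasurableSpace X] {m : Measure X} {S : Set X} {F : X → ℂ}

theorem setIntegral_comp_of_preimage_eq {T : X → X} (hT : MeasurePreserving T m m)
    (hS : MeasurableSet S) (hTS : T ⁻¹' S = S) (hF : IntegrableOn F S m) :
    IntegrableOn (fun q => F (T q)) S m ∧ ∫ q in S, F (T q) ∂m = ∫ q in S, F q ∂m := by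
  have h1 := hT.restrict_preimage hS
  rw [hTS] at h1
  refine ⟨h1.integrable_comp_of_integrable hF, ?_⟩
  have h2 := integral_map (φ := T) h1.measurable.aemeasurable (f := F)
    (by rw [h1.map_eq]; exact hF.aestronglyMeasurable)
  rw [h1.map_eq] at h2
  exact h2.symm

theorem setIntegral_eq_zero_of_comp_eq_mul {T : X → X} (hT : MeasurePreserving T m m)
    (hS : MeasurableSet S) (hTS : T ⁻¹' S = S) (hF : IntegrableOn F S m) {c : ℂ} (hc : c ≠ 1)
    (h : ∀ q ∈ S, F (T q) = c * F q) : ∫ q in S, F q ∂m = 0 := by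
  have h1 := (setIntegral_comp_of_preimage_eq hT hS hTS hF).2
  rw [setIntegral_congr_fun hS h, integral_const_mul] at h1
  have h2 : (c - 1) * ∫ q in S, F q ∂m = 0 := by linear_combination h1
  exact (mul_eq_zero.1 h2).resolve_left (sub_ne_zero.2 hc)

variable {θ : ℚ_[p] → ℂ} {T : ℚ_[p] → X → X}

/-- Averaging over the dilations by `1, …, p - 1` against a character of conductor exponent one. -/
theorem setIntegral_of_unit_dilation (hθ : IsStandardCharacter θ)
    (hT : ∀ u, ‖u‖ = 1 → MeasurePreserving (T u) m m)
    (hinv : ∀ u, ‖u‖ = 1 → ∀ q, T u⁻¹ (T u q) = q)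
    (hS : MeasurableSet S) (hTS : ∀ u, ‖u‖ = 1 → ∀ q ∈ S, T u q ∈ S)
    (hF : IntegrableOn F S m) {G : X → ℂ} {b : X → ℚ_[p]} (hb : ∀ q ∈ S, ‖b q‖ = p)
    (h : ∀ u, ‖u‖ = 1 → ∀ q ∈ S, F (T u q) = G q * θ (u * b q)) :
    IntegrableOn G S m ∧ ((p : ℂ) - 1) * ∫ q in S, F q ∂m = -∫ q in S, G q ∂m := by
  have key : ∀ j ∈ Finset.Ico 1 p, IntegrableOn (fun q => F (T j q)) S m ∧
      ∫ q in S, F (T j q) ∂m = ∫ q in S, F q ∂m := fun j hj =>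
    setIntegral_comp_of_preimage_eq (hT _ (norm_natCast_eq_one_of_mem_Ico hj)) hS
      (preimage_unit_eq hinv hTS (norm_natCast_eq_one_of_mem_Ico hj)) hF
  have hsum : ∀ q ∈ S, ∑ j ∈ Finset.Ico 1 p, F (T j q) = -G q := by
    intro q hq
    rw [Finset.sum_congr rfl fun (j : ℕ) hj =>
      h (j : ℚ_[p]) (norm_natCast_eq_one_of_mem_Ico hj) q hq,
      ← Finset.mul_sum]
    have h1 := hθ.sum_range_eq_zero (hb q hq)
    rw [Finset.range_eq_Ico, Finset.sum_eq_sum_Ico_succ_bot (Fact.out : p.Prime).pos] at h1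
    rw [Nat.cast_zero, zero_mul, hθ.eq_one 0 (by simp), zero_add] at h1
    linear_combination (G q) * h1
  have hint : IntegrableOn (fun q => ∑ j ∈ Finset.Ico 1 p, F (T j q)) S m :=
    integrable_finsetSum _ fun j hj => (key j hj).1
  constructor
  · have := (hint.congr_fun hsum hS).neg
    simpa [Function.comp_def] using this
  · rw [← integral_neg, ← setIntegral_congr_fun hS hsum,
      integral_finsetSum _ fun j hj => (key j hj).1,
      Finset.sum_congr rfl fun j hj => (key j hj).2]
    simp [Nat.cast_sub (Fact.out : p.Prime).one_le]

/-- Averaging over the dilations by `1 + j p ^ (k + 1)` against a character of conductor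
exponent `k + 2`. -/
theorem setIntegral_eq_zero_of_unit_dilation (hθ : IsStandardCharacter θ)
    (hT : ∀ u, ‖u‖ = 1 → MeasurePreserving (T u) m m)
    (hinv : ∀ u, ‖u‖ = 1 → ∀ q, T u⁻¹ (T u q) = q)
    (hS : MeasurableSet S) (hTS : ∀ u, ‖u‖ = 1 → ∀ q ∈ S, T u q ∈ S)
    (hF : IntegrableOn F S m) {G : X → ℂ} {b : X → ℚ_[p]} {k : ℕ}
    (hb : ∀ q ∈ S, ‖b q‖ = (p : ℝ) ^ (k + 2))
    (h : ∀ u, ‖u‖ = 1 → ∀ q ∈ S, F (T u q) = G q * θ (u * b q)) :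
    ∫ q in S, F q ∂m = 0 := by
  have hp : (0 : ℝ) < p := one_lt_p.trans' one_pos
  have hu : ∀ j : ℕ, ‖(1 + j * (p : ℚ_[p]) ^ (k + 1) : ℚ_[p])‖ = 1 := by
    intro j
    rw [norm_add_eq_left, norm_one]
    rw [norm_one, norm_mul, norm_pow, Padic.norm_p]
    have h1 : ‖(j : ℚ_[p])‖ ≤ 1 := by simpa using Padic.norm_int_le_one (p := p) j
    have h2 : ((p : ℝ)⁻¹) ^ (k + 1) < 1 :=
      pow_lt_one₀ (by positivity) (inv_lt_one_of_one_lt₀ one_lt_p) (by omega)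
    exact (mul_le_of_le_one_left (by positivity) h1).trans_lt h2
  have key : ∀ j ∈ Finset.range p,
      IntegrableOn (fun q => F (T (1 + j * (p : ℚ_[p]) ^ (k + 1)) q)) S m ∧
      ∫ q in S, F (T (1 + j * (p : ℚ_[p]) ^ (k + 1)) q) ∂m = ∫ q in S, F q ∂m := fun j _ =>
    setIntegral_comp_of_preimage_eq (hT _ (hu j)) hS (preimage_unit_eq hinv hTS (hu j)) hF
  have hsum : ∀ q ∈ S,
      ∑ j ∈ Finset.range p, F (T (1 + j * (p : ℚ_[p]) ^ (k + 1)) q) = 0 := by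
    intro q hq
    have h1 := hθ.sum_range_eq_zero (b := (p : ℚ_[p]) ^ (k + 1) * b q) (by
      rw [norm_mul, hb q hq, norm_pow, Padic.norm_p, pow_succ _ (k + 1), ← mul_assoc, ← mul_pow,
        inv_mul_cancel₀ hp.ne', one_pow, one_mul])
    rw [Finset.sum_congr rfl fun j _ => h _ (hu j) q hq]
    have h2 : ∀ j ∈ Finset.range p, G q * θ ((1 + j * (p : ℚ_[p]) ^ (k + 1)) * b q) =
        G q * θ (b q) * θ (j * ((p : ℚ_[p]) ^ (k + 1) * b q)) := by
      intro j _
      rw [add_mul, one_mul, hθ.map_add, mul_assoc (j : ℚ_[p]), mul_assoc (G q)]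
    rw [Finset.sum_congr rfl h2, ← Finset.mul_sum, h1, mul_zero]
  have h3 : ∫ q in S, ∑ j ∈ Finset.range p, F (T (1 + j * (p : ℚ_[p]) ^ (k + 1)) q) ∂m = 0 := by
    rw [setIntegral_congr_fun hS hsum]; simp
  rw [integral_finsetSum _ fun j hj => (key j hj).1,
    Finset.sum_congr rfl fun j hj => (key j hj).2] at h3
  simpa [(Fact.out : p.Prime).ne_zero] using h3

theorem setIntegral_eq_zero_of_iUnion {s : ℕ → Set X} (hs : ∀ i, MeasurableSet (s i))
    (hd : Pairwise (Function.onFun Disjoint s)) (hF : IntegrableOn F (⋃ i, s i) m)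
    (h : ∀ i, ∫ q in s i, F q ∂m = 0) : ∫ q in ⋃ i, s i, F q ∂m = 0 := by
  rw [integral_iUnion hs hd hF]; simp [h]

end Averaging

/-- A right `Γ₀(p)`-invariant Whittaker-type function with trivial central character. -/
structure IsWhittaker (θ : ℚ_[p] → ℂ) (W : Matrix (Fin 2) (Fin 2) ℚ_[p] → ℂ) : Prop where
  left : ∀ (t : ℚ_[p]) (g : Matrix (Fin 2) (Fin 2) ℚ_[p]), g.det ≠ 0 →
    W (!![1, t; 0, 1] * g) = θ t * W g
  right : ∀ (g : Matrix (Fin 2) (Fin 2) ℚ_[p]), g.det ≠ 0 → ∀ γ ∈ Gamma0 p, W (g * γ) = W g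
  center : ∀ (lam : ℚ_[p]) (g : Matrix (Fin 2) (Fin 2) ℚ_[p]), lam ≠ 0 → g.det ≠ 0 →
    W (lam • g) = W g

theorem mem_Gamma0_iff {a b c d : ℚ_[p]} : !![a, b; c, d] ∈ Gamma0 p ↔
    (‖a‖ ≤ 1 ∧ ‖b‖ ≤ 1 ∧ ‖c‖ ≤ 1 ∧ ‖d‖ ≤ 1) ∧ ‖a * d - b * c‖ = 1 ∧ ‖c‖ ≤ (p : ℝ)⁻¹ := by
  simp [Gamma0, Fin.forall_fin_two, det_fin_two, and_assoc]

theorem inv_p_le_one : (p : ℝ)⁻¹ ≤ 1 := inv_le_one_of_one_le₀ one_lt_p.le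

namespace IsWhittaker

variable {θ : ℚ_[p] → ℂ} {W : Matrix (Fin 2) (Fin 2) ℚ_[p] → ℂ}

theorem diag_congr (hW : IsWhittaker θ W) {s t : ℚ_[p]} (hs : s ≠ 0) (h : ‖t‖ = ‖s‖) :
    W !![t, 0; 0, 1] = W !![s, 0; 0, 1] := by
  have hs' : ‖s‖ ≠ 0 := norm_ne_zero_iff.2 hs
  have h1 := hW.right !![s, 0; 0, 1] (by simpa [det_fin_two] using hs) !![t / s, 0; 0, 1]
    (by rw [mem_Gamma0_iff]; simp [norm_div, h, hs'])
  rw [← h1]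
  simp [mul_div_cancel₀ _ hs]

theorem antidiag_congr (hW : IsWhittaker θ W) {s t : ℚ_[p]} (hs : s ≠ 0) (h : ‖t‖ = ‖s‖) :
    W !![0, t; 1, 0] = W !![0, s; 1, 0] := by
  have hs' : ‖s‖ ≠ 0 := norm_ne_zero_iff.2 hs
  have h1 := hW.right !![0, s; 1, 0] (by simpa [det_fin_two] using hs) !![1, 0; 0, t / s]
    (by rw [mem_Gamma0_iff]; simp [norm_div, h, hs'])
  rw [← h1]
  simp [mul_div_cancel₀ _ hs]

theorem diag_eq_zero (hθ : IsStandardCharacter θ) (hW : IsWhittaker θ W) {t : ℚ_[p]}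
    (h : 1 < ‖t‖) : W !![t, 0; 0, 1] = 0 := by
  have ht : t ≠ 0 := norm_pos_iff.1 (one_pos.trans h)
  obtain ⟨a, ha, hne⟩ := hθ.exists_ne_one
  have hdet : (!![t, 0; 0, 1] : Matrix (Fin 2) (Fin 2) ℚ_[p]).det ≠ 0 := by
    simpa [det_fin_two] using ht
  have hpt : (p : ℝ) ≤ ‖t‖ := by
    have := pow_succ_le_norm_of_pow_lt (p := p) (n := 0) (by simpa using h)
    simpa using this
  have h1 := hW.right _ hdet !![1, a / t; 0, 1] (by
    rw [mem_Gamma0_iff]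
    simpa [norm_div] using (div_le_one (one_pos.trans h)).2 (ha.trans hpt))
  have h2 := hW.left a _ hdet
  have h3 : !![t, 0; 0, 1] * !![1, a / t; 0, 1] = !![1, a; 0, 1] * !![t, 0; 0, 1] := by
    simp [mul_div_cancel₀ _ ht]
  rw [h3, h2] at h1
  have h4 : (θ a - 1) * W !![t, 0; 0, 1] = 0 := by linear_combination h1
  exact (mul_eq_zero.1 h4).resolve_left (sub_ne_zero.2 hne)

theorem antidiag_eq_zero (hθ : IsStandardCharacter θ) (hW : IsWhittaker θ W) {t : ℚ_[p]}
    (h : (p : ℝ) < ‖t‖) : W !![0, t; 1, 0] = 0 := by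
  have hp : (0 : ℝ) < p := one_lt_p.trans' one_pos
  have ht : t ≠ 0 := norm_pos_iff.1 (hp.trans h)
  obtain ⟨a, ha, hne⟩ := hθ.exists_ne_one
  have hdet : (!![0, t; 1, 0] : Matrix (Fin 2) (Fin 2) ℚ_[p]).det ≠ 0 := by
    simpa [det_fin_two] using ht
  have hpt : (p : ℝ) ^ 2 ≤ ‖t‖ := pow_succ_le_norm_of_pow_lt (p := p) (n := 1) (by simpa using h)
  have hat : ‖a / t‖ ≤ (p : ℝ)⁻¹ := by
    rw [norm_div, div_le_iff₀ (hp.trans h), inv_mul_eq_div, le_div_iff₀ hp]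
    nlinarith
  have h1 := hW.right _ hdet !![1, 0; a / t, 1] (by
    rw [mem_Gamma0_iff]
    simpa [-norm_div] using And.intro (hat.trans inv_p_le_one) hat)
  have h2 := hW.left a _ hdet
  have h3 : !![0, t; 1, 0] * !![1, 0; a / t, 1] = !![1, a; 0, 1] * !![0, t; 1, 0] := by
    simp [mul_div_cancel₀ _ ht]
  rw [h3, h2] at h1
  have h4 : (θ a - 1) * W !![0, t; 1, 0] = 0 := by linear_combination h1
  exact (mul_eq_zero.1 h4).resolve_left (sub_ne_zero.2 hne)

/-- Iwasawa decomposition when the lower right entry dominates. -/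
theorem eq_of_norm_lt (hW : IsWhittaker θ W) {a b c d : ℚ_[p]} (hdet : a * d - b * c ≠ 0)
    (h : ‖c‖ < ‖d‖) :
    W !![a, b; c, d] = θ (b / d) * W !![(a * d - b * c) / d ^ 2, 0; 0, 1] := by
  have hp : (0 : ℝ) < p := one_lt_p.trans' one_pos
  have hd' : 0 < ‖d‖ := (norm_nonneg c).trans_lt h
  have hd : d ≠ 0 := norm_pos_iff.1 hd'
  have hcd : ‖-c / d‖ ≤ (p : ℝ)⁻¹ := by
    rw [norm_div, norm_neg, div_le_iff₀ hd', inv_mul_eq_div, le_div_iff₀ hp, mul_comm]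
    exact p_mul_norm_le_of_norm_lt h
  rw [← hW.right _ (by simpa [det_fin_two] using hdet) !![1, 0; -c / d, 1] (by
    rw [mem_Gamma0_iff]
    simpa [-norm_div] using And.intro (hcd.trans inv_p_le_one) hcd)]
  have hdet2 : (!![(a * d - b * c) / d ^ 2, 0; 0, 1] : Matrix (Fin 2) (Fin 2) ℚ_[p]).det ≠ 0 := by
    simp [det_fin_two, hdet, hd]
  have hmul : !![a, b; c, d] * !![1, 0; -c / d, 1] =
      d • (!![1, b / d; 0, 1] * !![(a * d - b * c) / d ^ 2, 0; 0, 1]) := by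
    ext i j
    fin_cases i <;> fin_cases j <;> simp <;> field_simp <;> ring
  rw [hmul, hW.center d _ hd, hW.left _ _ hdet2]
  rw [det_mul]
  exact mul_ne_zero (by simp [det_fin_two]) hdet2

/-- Iwasawa decomposition when the lower left entry dominates. -/
theorem eq_of_norm_le (hW : IsWhittaker θ W) {a b c d : ℚ_[p]} (hdet : a * d - b * c ≠ 0)
    (hc : c ≠ 0) (h : ‖d‖ ≤ ‖c‖) :
    W !![a, b; c, d] = θ (a / c) * W !![0, -(a * d - b * c) / c ^ 2; 1, 0] := by
  rw [← hW.right _ (by simpa [det_fin_two] using hdet) !![1, -d / c; 0, 1] (by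
    rw [mem_Gamma0_iff]
    simpa [norm_div] using (div_le_one (norm_pos_iff.2 hc)).2 h)]
  have hdet2 : (!![0, -(a * d - b * c) / c ^ 2; 1, 0] :
      Matrix (Fin 2) (Fin 2) ℚ_[p]).det ≠ 0 := by
    rw [det_fin_two_of]
    have := div_ne_zero (neg_ne_zero.2 hdet) (pow_ne_zero 2 hc)
    simpa using this
  have hmul : !![a, b; c, d] * !![1, -d / c; 0, 1] =
      c • (!![1, a / c; 0, 1] * !![0, -(a * d - b * c) / c ^ 2; 1, 0]) := by
    ext i j
    fin_cases i <;> fin_cases j <;> simp <;> field_simp <;> ring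
  rw [hmul, hW.center c _ hc, hW.left _ _ hdet2]
  rw [det_mul]
  exact mul_ne_zero (by simp [det_fin_two]) hdet2

end IsWhittaker

section Integrand

/-- The matrix at which the Whittaker function is evaluated. -/
noncomputable def unipotentMatrix (q : ℚ_[p] × ℚ_[p] × ℚ_[p]) : Matrix (Fin 2) (Fin 2) ℚ_[p] :=
  !![q.1 * q.2.1 - q.2.2, -(q.2.1 ^ 2); -(q.1 ^ 2), q.1 * q.2.1 + q.2.2]

/-- The integrand of the zeta integral. -/
noncomputable def integrand (θ : ℚ_[p] → ℂ) (W : Matrix (Fin 2) (Fin 2) ℚ_[p] → ℂ) (ν : ℂ)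
    (q : ℚ_[p] × ℚ_[p] × ℚ_[p]) : ℂ :=
  (‖q.2.2‖ : ℂ) ^ (-2 - ν) * W (unipotentMatrix q) * θ (-q.1)

/-- The domain of integration. -/
def region (p : ℕ) [Fact p.Prime] : Set (ℚ_[p] × ℚ_[p] × ℚ_[p]) :=
  {q | 1 < ‖q.2.2‖ ∧ ‖q.1‖ < ‖q.2.2‖ ∧ ‖q.2.1‖ < ‖q.2.2‖}

theorem setOf_addValuation_lt_eq_region : {q : ℚ_[p] × ℚ_[p] × ℚ_[p] |
    Padic.addValuation q.2.2 <
      min 0 (min (Padic.addValuation q.1) (Padic.addValuation q.2.1))} = region p := by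
  ext q
  rw [Set.mem_ofPred_eq, lt_min_iff, lt_min_iff,
    ← AddValuation.map_one (Padic.addValuation (p := p)),
    addValuation_lt_iff, addValuation_lt_iff, addValuation_lt_iff, norm_one]
  rfl

theorem det_unipotentMatrix (q : ℚ_[p] × ℚ_[p] × ℚ_[p]) :
    (unipotentMatrix q).det = -q.2.2 ^ 2 := by
  rw [unipotentMatrix, det_fin_two_of]; ring

theorem ne_zero_of_one_lt_norm {z : ℚ_[p]} (h : 1 < ‖z‖) : z ≠ 0 :=
  norm_pos_iff.1 (one_pos.trans h)

theorem det_unipotentMatrix_ne_zero {q : ℚ_[p] × ℚ_[p] × ℚ_[p]} (hq : q ∈ region p) :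
    (unipotentMatrix q).det ≠ 0 := by
  rw [det_unipotentMatrix]
  exact neg_ne_zero.2 (pow_ne_zero 2 (ne_zero_of_one_lt_norm hq.1))

/-- The moderate growth condition on a function on `GL₂(ℚ_p)`. -/
def HasGrowth (W : Matrix (Fin 2) (Fin 2) ℚ_[p] → ℂ) (C A : ℝ) : Prop :=
  ∀ g : Matrix (Fin 2) (Fin 2) ℚ_[p], g.det ≠ 0 →
    ‖W g‖ ≤ C * ((max (max ‖g 0 0‖ ‖g 0 1‖) (max ‖g 1 0‖ ‖g 1 1‖) *
      max (max ‖g⁻¹ 0 0‖ ‖g⁻¹ 0 1‖) (max ‖g⁻¹ 1 0‖ ‖g⁻¹ 1 1‖)) ^ A)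

theorem HasGrowth.norm_apply_unipotentMatrix_le {W : Matrix (Fin 2) (Fin 2) ℚ_[p] → ℂ} {C A : ℝ}
    (hC : 0 ≤ C) (hA : 0 ≤ A) (hW : HasGrowth W C A) {q : ℚ_[p] × ℚ_[p] × ℚ_[p]}
    (hq : q ∈ region p) : ‖W (unipotentMatrix q)‖ ≤ C * (‖q.2.2‖ ^ 2) ^ A := by
  have hdet := det_unipotentMatrix_ne_zero hq
  refine (hW _ hdet).trans ?_
  obtain ⟨x, y, z⟩ := q
  obtain ⟨h1, hx, hy⟩ := hq
  simp only at h1 hx hy ⊢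
  have hz : 0 < ‖z‖ := one_pos.trans h1
  have hz0 : z ≠ 0 := norm_pos_iff.1 hz
  have hz2 : ‖z‖ ≤ ‖z‖ ^ 2 := by nlinarith
  have hxy : ‖x * y‖ ≤ ‖z‖ ^ 2 := by
    rw [norm_mul, sq]; exact mul_le_mul hx.le hy.le (norm_nonneg _) hz.le
  have e1 : ‖x * y - z‖ ≤ ‖z‖ ^ 2 := by
    rw [sub_eq_add_neg]; exact norm_add_le_of_le hxy (by rwa [norm_neg])
  have e2 : ‖-y ^ 2‖ ≤ ‖z‖ ^ 2 := by
    rw [norm_neg, norm_pow]; exact pow_le_pow_left₀ (norm_nonneg _) hy.le 2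
  have e3 : ‖-x ^ 2‖ ≤ ‖z‖ ^ 2 := by
    rw [norm_neg, norm_pow]; exact pow_le_pow_left₀ (norm_nonneg _) hx.le 2
  have e4 : ‖x * y + z‖ ≤ ‖z‖ ^ 2 := norm_add_le_of_le hxy hz2
  have hinv : (unipotentMatrix (x, y, z))⁻¹ =
      (-z ^ 2)⁻¹ • !![x * y + z, y ^ 2; x ^ 2, x * y - z] := by
    rw [Matrix.inv_def, det_unipotentMatrix, unipotentMatrix, adjugate_fin_two_of,
      Ring.inverse_eq_inv']
    simp
  have key : ∀ t : ℚ_[p], ‖t‖ ≤ ‖z‖ ^ 2 → (‖z‖ ^ 2)⁻¹ * ‖t‖ ≤ 1 := fun t ht => by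
    rw [inv_mul_le_iff₀ (by positivity), mul_one]; exact ht
  gcongr
  rw [hinv]
  refine (mul_le_of_le_one_right (by positivity) ?_).trans ?_
  rotate_left
  · simp only [unipotentMatrix]
    exact max_le (max_le e1 e2) (max_le e3 e4)
  · have f2 : ‖y ^ 2‖ ≤ ‖z‖ ^ 2 := by rwa [norm_neg] at e2
    have f3 : ‖x ^ 2‖ ≤ ‖z‖ ^ 2 := by rwa [norm_neg] at e3
    simpa using And.intro ⟨key _ e4, by simpa using key _ f2⟩ ⟨by simpa using key _ f3, key _ e1⟩

variable {θ : ℚ_[p] → ℂ} {W : Matrix (Fin 2) (Fin 2) ℚ_[p] → ℂ}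

variable [MeasurableSpace ℚ_[p]] [BorelSpace ℚ_[p]] {μ : Measure ℚ_[p]}

theorem measurableSet_region : MeasurableSet (region p) := by
  unfold region
  measurability

theorem aestronglyMeasurable_integrand [SigmaFinite μ] (hθ : IsStandardCharacter θ)
    (hW : ContinuousOn W {g | g.det ≠ 0}) (ν : ℂ) {S : Set (ℚ_[p] × ℚ_[p] × ℚ_[p])}
    (hS : MeasurableSet S) (hSR : S ⊆ region p) :
    AEStronglyMeasurable (integrand θ W ν) ((μ.prod (μ.prod μ)).restrict S) := by
  have hθc := hθ.continuous
  have h1 : ContinuousOn (fun q : ℚ_[p] × ℚ_[p] × ℚ_[p] => W (unipotentMatrix q)) S := by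
    refine hW.comp (Continuous.continuousOn ?_) fun q hq => det_unipotentMatrix_ne_zero (hSR hq)
    refine continuous_matrix fun i j => ?_
    fin_cases i <;> fin_cases j <;> simp [unipotentMatrix] <;> fun_prop
  have h2 : ContinuousOn (fun q : ℚ_[p] × ℚ_[p] × ℚ_[p] => (‖q.2.2‖ : ℂ) ^ (-2 - ν)) S := by
    intro q hq
    refine ContinuousAt.continuousWithinAt (ContinuousAt.cpow (by fun_prop) (by fun_prop) ?_)
    simpa using ne_zero_of_one_lt_norm (hSR hq).1
  refine ContinuousOn.aestronglyMeasurable ?_ hS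
  exact (h2.mul h1).mul (Continuous.continuousOn (by fun_prop))

theorem integrableOn_integrand [SigmaFinite μ] (hμ : IsNormalizedHaar μ)
    (hθ : IsStandardCharacter θ) (hWc : ContinuousOn W {g | g.det ≠ 0}) {C A : ℝ}
    (hC : 0 ≤ C) (hA : 0 ≤ A) (hW : HasGrowth W C A) {ν : ℂ} (hν : 1 + 2 * A < ν.re) :
    IntegrableOn (integrand θ W ν) (region p) (μ.prod (μ.prod μ)) := by
  have hp : (0 : ℝ) < p := one_lt_p.trans' one_pos
  let s : ℕ → Set (ℚ_[p] × ℚ_[p] × ℚ_[p]) := fun n => region p ∩ {q | ‖q.2.2‖ = (p : ℝ) ^ (n + 1)}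
  have hs : ∀ n, MeasurableSet (s n) := fun n =>
    measurableSet_region.inter (measurableSet_eq_fun (by fun_prop) (by fun_prop))
  have hunion : region p = ⋃ n, s n := by
    ext q
    simp only [s, Set.mem_iUnion, Set.mem_inter_iff, exists_and_left]
    exact ⟨fun h => ⟨h, exists_norm_eq_pow_succ h.1⟩, And.left⟩
  have hmeas : ∀ n, (μ.prod (μ.prod μ)) (s n) ≤ ((p : ENNReal) ^ (n + 1)) ^ 3 := by
    intro n
    have hsub : s n ⊆ {x : ℚ_[p] | ‖x‖ ≤ (p : ℝ) ^ (n + 1)} ×ˢ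
        ({x : ℚ_[p] | ‖x‖ ≤ (p : ℝ) ^ (n + 1)} ×ˢ {x : ℚ_[p] | ‖x‖ ≤ (p : ℝ) ^ (n + 1)}) := by
      rintro q ⟨⟨-, hx, hy⟩, hz⟩
      simp only [Set.mem_ofPred_eq] at hz
      exact ⟨hz ▸ hx.le, hz ▸ hy.le, hz.le⟩
    refine (measure_mono hsub).trans ?_
    rw [Measure.prod_prod, Measure.prod_prod, hμ.measure_ball_pow]
    ring_nf
    exact le_rfl
  have hfin : ∀ n, (μ.prod (μ.prod μ)) (s n) < ⊤ := fun n =>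
    (hmeas n).trans_lt (by simp)
  let B : ℕ → ℝ := fun n => C * ((p : ℝ) ^ (n + 1)) ^ (2 * A - 2 - ν.re)
  have hbound : ∀ n, ∀ q ∈ s n, ‖integrand θ W ν q‖ ≤ B n := by
    rintro n q ⟨hq, hz⟩
    simp only [Set.mem_ofPred_eq] at hz
    have hzpos : 0 < ‖q.2.2‖ := one_pos.trans hq.1
    rw [integrand, norm_mul, norm_mul, hθ.norm_eq_one, mul_one,
      Complex.norm_cpow_eq_rpow_re_of_pos hzpos]
    refine (mul_le_mul_of_nonneg_left (hW.norm_apply_unipotentMatrix_le hC hA hq)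
      (by positivity)).trans (le_of_eq ?_)
    rw [hz]
    have hr : (0 : ℝ) < (p : ℝ) ^ (n + 1) := by positivity
    simp only [B]
    rw [← Real.rpow_natCast (((p : ℝ) ^ (n + 1))) 2, ← Real.rpow_mul hr.le, mul_left_comm,
      ← Real.rpow_add hr]
    congr 2
    simp
    ring
  have hint : ∀ n, IntegrableOn (integrand θ W ν) (s n) (μ.prod (μ.prod μ)) := fun n =>
    IntegrableOn.of_bound (hfin n)
      (aestronglyMeasurable_integrand hθ hWc ν (hs n) Set.inter_subset_left) (B n)
      ((ae_restrict_iff' (hs n)).2 (Filter.Eventually.of_forall (hbound n)))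
  rw [hunion]
  refine integrableOn_iUnion_of_summable_integral_norm hint ?_
  have hgeom : Summable fun n : ℕ => C * (((p : ℝ) ^ (2 * A + 1 - ν.re)) ^ (n + 1)) := by
    refine Summable.mul_left _ ?_
    refine (summable_nat_add_iff 1).2 (summable_geometric_of_lt_one (by positivity) ?_)
    exact Real.rpow_lt_one_of_one_lt_of_neg one_lt_p (by linarith)
  refine Summable.of_nonneg_of_le (fun n => by positivity) (fun n => ?_) hgeom
  have h1 := norm_setIntegral_le_of_norm_le_const (f := fun q => ‖integrand θ W ν q‖) (hfin n)
    (fun q hq => by simpa using hbound n q hq)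
  refine (Real.le_norm_self _).trans (h1.trans ?_)
  have hr : (0 : ℝ) < (p : ℝ) ^ (n + 1) := by positivity
  have h2 : (μ.prod (μ.prod μ)).real (s n) ≤ ((p : ℝ) ^ (n + 1)) ^ 3 := by
    have := ENNReal.toReal_mono (by simp) (hmeas n)
    simpa [Measure.real] using this
  refine (mul_le_mul_of_nonneg_left h2 (by positivity)).trans (le_of_eq ?_)
  simp only [B]
  rw [mul_assoc, ← Real.rpow_natCast (((p : ℝ) ^ (n + 1))) 3, ← Real.rpow_add hr,
    ← Real.rpow_natCast, ← Real.rpow_natCast, ← Real.rpow_mul hp.le, ← Real.rpow_mul hp.le]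
  congr 2
  push_cast
  ring

end Integrand

section PointwiseFormulas

variable {θ : ℚ_[p] → ℂ} {W : Matrix (Fin 2) (Fin 2) ℚ_[p] → ℂ}

/-- The part of the integrand on the large cell that depends only on norms. -/
noncomputable def cellFactor (W : Matrix (Fin 2) (Fin 2) ℚ_[p] → ℂ) (ν : ℂ)
    (q : ℚ_[p] × ℚ_[p] × ℚ_[p]) : ℂ :=
  (‖q.2.2‖ : ℂ) ^ (-2 - ν) * W !![-q.2.2 ^ 2 / (q.1 * q.2.1 + q.2.2) ^ 2, 0; 0, 1]

theorem integrand_eq_cellFactor_mul (hW : IsWhittaker θ W) (ν : ℂ) {x y z : ℚ_[p]} (hz : z ≠ 0)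
    (h : ‖x‖ ^ 2 < ‖x * y + z‖) : integrand θ W ν (x, y, z) =
      cellFactor W ν (x, y, z) * θ (-x) * θ (-(y ^ 2 / (x * y + z))) := by
  have hdet : (x * y - z) * (x * y + z) - -(y ^ 2) * -(x ^ 2) = -z ^ 2 := by ring
  have h1 := hW.eq_of_norm_lt (a := x * y - z) (b := -(y ^ 2)) (c := -(x ^ 2)) (d := x * y + z)
    (by rw [hdet]; exact neg_ne_zero.2 (pow_ne_zero 2 hz)) (by rwa [norm_neg, norm_pow])
  rw [hdet] at h1
  simp only [integrand, unipotentMatrix, cellFactor, h1, neg_div]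
  ring

theorem cellFactor_congr (hW : IsWhittaker θ W) (ν : ℂ) {x y z x' y' z' : ℚ_[p]} (hz : z ≠ 0)
    (hd : x * y + z ≠ 0) (hzz : ‖z'‖ = ‖z‖) (hdd : ‖x' * y' + z'‖ = ‖x * y + z‖) :
    cellFactor W ν (x', y', z') = cellFactor W ν (x, y, z) := by
  simp only [cellFactor, hzz]
  congr 1
  refine hW.diag_congr ?_ (by simp [norm_div, hzz, hdd])
  exact div_ne_zero (neg_ne_zero.2 (pow_ne_zero 2 hz)) (pow_ne_zero 2 hd)

theorem cellFactor_eq (hW : IsWhittaker θ W) (ν : ℂ) {x y z : ℚ_[p]} (hz : z ≠ 0)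
    (hd : ‖x * y + z‖ = ‖z‖) : cellFactor W ν (x, y, z) = (‖z‖ : ℂ) ^ (-2 - ν) * W 1 := by
  have hz' : ‖z‖ ≠ 0 := norm_ne_zero_iff.2 hz
  simp only [cellFactor]
  rw [hW.diag_congr one_ne_zero (by simp [norm_div, hd, hz']), one_fin_two]

/-- The part of the domain on which the lower right entry dominates. -/
def cellRegion (p : ℕ) [Fact p.Prime] : Set (ℚ_[p] × ℚ_[p] × ℚ_[p]) :=
  {q | 1 < ‖q.2.2‖ ∧ ‖q.1‖ < ‖q.2.2‖ ∧ ‖q.2.1‖ < ‖q.2.2‖ ∧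
    ‖q.1‖ ^ 2 < ‖q.1 * q.2.1 + q.2.2‖ ∧ ‖q.2.2‖ ≤ ‖q.1 * q.2.1 + q.2.2‖}

/-- The part of the domain on which the lower left entry dominates. -/
def antiRegion (p : ℕ) [Fact p.Prime] : Set (ℚ_[p] × ℚ_[p] × ℚ_[p]) :=
  {q | ‖q.1‖ < ‖q.2.2‖ ∧ ‖q.2.2‖ ≤ ‖q.1‖ ^ 2 ∧ ‖q.2.1‖ ≤ ‖q.1‖}

theorem one_lt_norm_of_mem_antiRegion {q : ℚ_[p] × ℚ_[p] × ℚ_[p]} (hq : q ∈ antiRegion p) :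
    1 < ‖q.1‖ := by
  obtain ⟨h1, h2, -⟩ := hq
  nlinarith [norm_nonneg q.1]

theorem antiRegion_subset : antiRegion p ⊆ region p := fun _ hq =>
  ⟨(one_lt_norm_of_mem_antiRegion hq).trans hq.1, hq.1, hq.2.2.trans_lt hq.1⟩

theorem cellRegion_subset : cellRegion p ⊆ region p := fun _ hq => ⟨hq.1, hq.2.1, hq.2.2.1⟩

theorem norm_le_sq_of_mem_antiRegion {x y z : ℚ_[p]} (hq : (x, y, z) ∈ antiRegion p) :
    ‖x * y‖ ≤ ‖x‖ ^ 2 := by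
  rw [norm_mul, sq]
  exact mul_le_mul_of_nonneg_left hq.2.2 (norm_nonneg x)

theorem integrand_eq_antidiag (hW : IsWhittaker θ W) (ν : ℂ) {x y z : ℚ_[p]} (hz : z ≠ 0)
    (hx : x ≠ 0) (h : ‖x * y + z‖ ≤ ‖x‖ ^ 2) : integrand θ W ν (x, y, z) =
      (‖z‖ : ℂ) ^ (-2 - ν) * (θ ((x * y - z) / -(x ^ 2)) * W !![0, z ^ 2 / x ^ 4; 1, 0]) *
        θ (-x) := by
  have hdet : (x * y - z) * (x * y + z) - -(y ^ 2) * -(x ^ 2) = -z ^ 2 := by ring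
  have h1 := hW.eq_of_norm_le (a := x * y - z) (b := -(y ^ 2)) (c := -(x ^ 2)) (d := x * y + z)
    (by rw [hdet]; exact neg_ne_zero.2 (pow_ne_zero 2 hz)) (neg_ne_zero.2 (pow_ne_zero 2 hx))
    (by rwa [norm_neg, norm_pow])
  have h2 : -(-z ^ 2) / (-(x ^ 2)) ^ 2 = z ^ 2 / x ^ 4 := by ring
  rw [hdet, h2] at h1
  simp only [integrand, unipotentMatrix, h1]

theorem integrand_eq_of_mem_antiRegion (hθ : IsStandardCharacter θ) (hW : IsWhittaker θ W)
    (ν : ℂ) {x y z : ℚ_[p]} (hq : (x, y, z) ∈ antiRegion p) : integrand θ W ν (x, y, z) =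
      (‖z‖ : ℂ) ^ (-2 - ν) * W !![0, z ^ 2 / x ^ 4; 1, 0] * θ (-x) := by
  have hx := one_lt_norm_of_mem_antiRegion hq
  have hxy := norm_le_sq_of_mem_antiRegion hq
  obtain ⟨hxz, hzx, hyx⟩ := hq
  simp only at hx hxz hzx hyx
  have hx0 := ne_zero_of_one_lt_norm hx
  rw [integrand_eq_antidiag hW ν (ne_zero_of_one_lt_norm (hx.trans hxz)) hx0
    (norm_add_le_of_le hxy hzx), hθ.eq_one, one_mul]
  rw [norm_div, norm_neg, norm_pow, div_le_one (by positivity), sub_eq_add_neg]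
  exact norm_add_le_of_le hxy (by rwa [norm_neg])

theorem integrand_eq_zero (hθ : IsStandardCharacter θ) (hW : IsWhittaker θ W) (ν : ℂ)
    {q : ℚ_[p] × ℚ_[p] × ℚ_[p]} (hq : q ∈ region p) (h1 : q ∉ cellRegion p)
    (h2 : q ∉ antiRegion p) : integrand θ W ν q = 0 := by
  obtain ⟨x, y, z⟩ := q
  obtain ⟨hz1, hxz, hyz⟩ := hq
  simp only at hz1 hxz hyz
  have hz0 := ne_zero_of_one_lt_norm hz1
  have hzpos : 0 < ‖z‖ := one_pos.trans hz1
  have hp := one_lt_p (p := p)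
  by_cases hd : ‖x‖ ^ 2 < ‖x * y + z‖
  · have hdz : ‖x * y + z‖ < ‖z‖ := by
      by_contra! h
      exact h1 ⟨hz1, hxz, hyz, hd, h⟩
    have hdpos : 0 < ‖x * y + z‖ := (by positivity : 0 ≤ ‖x‖ ^ 2).trans_lt hd
    rw [integrand_eq_cellFactor_mul hW ν hz0 hd, cellFactor, hW.diag_eq_zero hθ]
    · simp
    · simp only [norm_div, norm_neg, norm_pow]
      rw [one_lt_div (by positivity)]
      exact pow_lt_pow_left₀ hdz hdpos.le two_ne_zero
  · push Not at hd
    have hx0 : x ≠ 0 := by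
      rintro rfl
      simp at hd
      exact hz0 hd
    have hxpos : 0 < ‖x‖ := norm_pos_iff.2 hx0
    rw [integrand_eq_antidiag hW ν hz0 hx0 hd]
    by_cases hzx : ‖z‖ ≤ ‖x‖ ^ 2
    · exfalso
      refine h2 ⟨hxz, hzx, ?_⟩
      have hxy : ‖x * y‖ ≤ ‖x‖ ^ 2 := by
        have := norm_add_le_of_le hd (y := -z) (by rwa [norm_neg])
        rwa [add_neg_cancel_right] at this
      rw [norm_mul, sq] at hxy
      exact le_of_mul_le_mul_left hxy hxpos
    · push Not at hzx
      rw [← norm_pow] at hzx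
      have h3 := p_mul_norm_le_of_norm_lt hzx
      rw [norm_pow] at h3
      rw [hW.antidiag_eq_zero hθ]
      · simp
      · rw [norm_div, norm_pow, norm_pow, lt_div_iff₀ (by positivity)]
        calc (p : ℝ) * ‖x‖ ^ 4 < p ^ 2 * ‖x‖ ^ 4 :=
              mul_lt_mul_of_pos_right (by nlinarith) (by positivity)
          _ = (p * ‖x‖ ^ 2) ^ 2 := by ring
          _ ≤ ‖z‖ ^ 2 := pow_le_pow_left₀ (by positivity) h3 2

end PointwiseFormulas

section Transformations

/-- The dilation of `ℚ_p ^ 3` by powers of `u`. -/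
noncomputable def dilation (a b c : ℕ) (u : ℚ_[p]) (q : ℚ_[p] × ℚ_[p] × ℚ_[p]) :
    ℚ_[p] × ℚ_[p] × ℚ_[p] :=
  (u ^ a * q.1, u ^ b * q.2.1, u ^ c * q.2.2)

theorem dilation_inv (a b c : ℕ) {u : ℚ_[p]} (hu : ‖u‖ = 1) (q : ℚ_[p] × ℚ_[p] × ℚ_[p]) :
    dilation a b c u⁻¹ (dilation a b c u q) = q := by
  have hu0 : u ≠ 0 := norm_pos_iff.1 (by rw [hu]; exact one_pos)
  simp [dilation, hu0]

variable [MeasurableSpace ℚ_[p]] [BorelSpace ℚ_[p]] {μ : Measure ℚ_[p]} [SigmaFinite μ]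

theorem measurePreserving_dilation (hμ : IsNormalizedHaar μ) (a b c : ℕ) {u : ℚ_[p]}
    (hu : ‖u‖ = 1) :
    MeasurePreserving (dilation a b c u) (μ.prod (μ.prod μ)) (μ.prod (μ.prod μ)) := by
  have h : ∀ n : ℕ, MeasurePreserving (u ^ n * ·) μ μ := fun n =>
    hμ.measurePreserving_mul (by rw [norm_pow, hu, one_pow])
  exact (h a).prod ((h b).prod (h c))

variable {θ : ℚ_[p] → ℂ} {S : Set (ℚ_[p] × ℚ_[p] × ℚ_[p])} {F : ℚ_[p] × ℚ_[p] × ℚ_[p] → ℂ}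

theorem setIntegral_eq_zero_of_translation (hμ : IsNormalizedHaar μ)
    (hθ : IsStandardCharacter θ) (hS : MeasurableSet S)
    (hTS : ∀ s x y z : ℚ_[p], ‖s‖ ≤ p → (x, y, z) ∈ S → (s + x, y, z) ∈ S)
    (hF : IntegrableOn F S (μ.prod (μ.prod μ)))
    (h : ∀ s x y z : ℚ_[p], ‖s‖ ≤ p → (x, y, z) ∈ S → F (s + x, y, z) = θ (-s) * F (x, y, z)) :
    ∫ q in S, F q ∂(μ.prod (μ.prod μ)) = 0 := by
  obtain ⟨a, ha, hne⟩ := hθ.exists_ne_one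
  have hT : MeasurePreserving (Prod.map (-a + ·) id) (μ.prod (μ.prod μ)) (μ.prod (μ.prod μ)) :=
    (hμ.measurePreserving_add _).prod (MeasurePreserving.id _)
  have ha' : ‖-a‖ ≤ p := by rwa [norm_neg]
  refine setIntegral_eq_zero_of_comp_eq_mul hT hS ?_ hF hne ?_
  · ext ⟨x, y, z⟩
    refine ⟨fun hq => ?_, hTS _ _ _ _ ha'⟩
    simpa using hTS a _ _ _ ha hq
  · rintro ⟨x, y, z⟩ hq
    simpa using h (-a) x y z ha' hq

theorem setIntegral_eq_add {X : Type*} [MeasurableSpace X] {m : Measure X} {S S₁ S₂ : Set X}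
    {F : X → ℂ} (h : ∀ q, q ∈ S ↔ q ∈ S₁ ∨ q ∈ S₂) (hd : ∀ q ∈ S₁, q ∉ S₂)
    (h₂ : MeasurableSet S₂) (hF : IntegrableOn F S m) :
    ∫ q in S, F q ∂m = ∫ q in S₁, F q ∂m + ∫ q in S₂, F q ∂m := by
  have hS : S = S₁ ∪ S₂ := Set.ext h
  rw [hS] at hF ⊢
  exact setIntegral_union (Set.disjoint_left.2 hd) h₂ hF.left_of_union hF.right_of_union

end Transformations

section SmallCell

variable [MeasurableSpace ℚ_[p]] [BorelSpace ℚ_[p]] {μ : Measure ℚ_[p]}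

namespace IsNormalizedHaar

theorem real_ball_pow (hμ : IsNormalizedHaar μ) (n : ℕ) :
    μ.real {x : ℚ_[p] | ‖x‖ ≤ (p : ℝ) ^ n} = (p : ℝ) ^ n := by
  simp [Measure.real, hμ.measure_ball_pow]

theorem real_sphere_pow (hμ : IsNormalizedHaar μ) (n : ℕ) :
    μ.real {x : ℚ_[p] | ‖x‖ = (p : ℝ) ^ (n + 1)} = (p : ℝ) ^ n * (p - 1) := by
  rw [Measure.real, hμ.measure_sphere_pow, ENNReal.toReal_ofReal]
  have := one_lt_p (p := p)
  exact mul_nonneg (by positivity) (by linarith)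

end IsNormalizedHaar

variable [SigmaFinite μ] {θ : ℚ_[p] → ℂ} {W : Matrix (Fin 2) (Fin 2) ℚ_[p] → ℂ} {ν : ℂ}

theorem measurableSet_antiRegion : MeasurableSet (antiRegion p) := by
  unfold antiRegion
  measurability

/-- The part of the small cell that contributes to the integral. -/
theorem setIntegral_antiRegion_core (hμ : IsNormalizedHaar μ) (hθ : IsStandardCharacter θ)
    (hW : IsWhittaker θ W)
    (hF : IntegrableOn (integrand θ W ν) (region p) (μ.prod (μ.prod μ))) :
    ∫ q in {x : ℚ_[p] | ‖x‖ = (p : ℝ) ^ (0 + 1)} ×ˢ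
      ({y : ℚ_[p] | ‖y‖ ≤ (p : ℝ) ^ 1} ×ˢ {z : ℚ_[p] | ‖z‖ = (p : ℝ) ^ (1 + 1)}),
      integrand θ W ν q ∂(μ.prod (μ.prod μ)) =
    -(((p : ℝ) ^ 2 : ℝ) : ℂ) ^ (-2 - ν) * W !![0, 1; 1, 0] * ((p : ℂ) ^ 2 * (p - 1)) := by
  have hp := one_lt_p (p := p)
  set S := {x : ℚ_[p] | ‖x‖ = (p : ℝ) ^ (0 + 1)} ×ˢ
      ({y : ℚ_[p] | ‖y‖ ≤ (p : ℝ) ^ 1} ×ˢ {z : ℚ_[p] | ‖z‖ = (p : ℝ) ^ (1 + 1)}) with hSdef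
  have hSsub : S ⊆ antiRegion p := by
    rintro ⟨x, y, z⟩ ⟨hx, hy, hz⟩
    simp only [Set.mem_ofPred_eq, zero_add, pow_one, one_add_one_eq_two] at hx hy hz
    refine ⟨?_, ?_, ?_⟩ <;> simp only [hx, hz]
    · nlinarith
    · exact le_rfl
    · exact hy
  have hS : MeasurableSet S := by measurability
  have h := (setIntegral_of_unit_dilation (T := dilation 1 0 0) hθ
    (fun u => measurePreserving_dilation hμ 1 0 0) (fun u => dilation_inv 1 0 0) hS (S := S)
    (F := integrand θ W ν)
    (G := fun _ => (((p : ℝ) ^ 2 : ℝ) : ℂ) ^ (-2 - ν) * W !![0, 1; 1, 0]) (b := fun q => -q.1)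
    ?_ (hF.mono_set (hSsub.trans antiRegion_subset)) ?_ ?_).2
  · rw [setIntegral_const, hSdef, measureReal_prod_prod, measureReal_prod_prod,
      hμ.real_sphere_pow, hμ.real_sphere_pow, hμ.real_ball_pow, Complex.real_smul] at h
    refine mul_left_cancel₀ (p_sub_one_ne_zero (p := p)) ?_
    rw [h]
    push_cast
    ring
  · rintro u hu ⟨x, y, z⟩ hq
    simpa [dilation, hu, hSdef] using hq
  · rintro ⟨x, y, z⟩ ⟨hx, -⟩
    simpa using hx
  · rintro u hu ⟨x, y, z⟩ hq
    have hmem : (u * x, y, z) ∈ antiRegion p := by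
      refine hSsub ?_
      obtain ⟨hx, hy, hz⟩ := hq
      exact ⟨by simpa [hu] using hx, hy, hz⟩
    obtain ⟨hx, hy, hz⟩ := hq
    simp only [Set.mem_ofPred_eq, zero_add, pow_one, one_add_one_eq_two] at hx hy hz
    simp only [dilation, pow_one, pow_zero, one_mul]
    rw [integrand_eq_of_mem_antiRegion hθ hW ν hmem, hz,
      hW.antidiag_congr one_ne_zero (t := z ^ 2 / (u * x) ^ 4), mul_neg]
    have hp0 : (p : ℝ) ≠ 0 := by positivity
    simp [hx, hz, hu]
    field_simp

theorem setIntegral_antiRegion (hμ : IsNormalizedHaar μ) (hθ : IsStandardCharacter θ)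
    (hW : IsWhittaker θ W)
    (hF : IntegrableOn (integrand θ W ν) (region p) (μ.prod (μ.prod μ))) :
    ∫ q in antiRegion p, integrand θ W ν q ∂(μ.prod (μ.prod μ)) =
    -(((p : ℝ) ^ 2 : ℝ) : ℂ) ^ (-2 - ν) * W !![0, 1; 1, 0] * ((p : ℂ) ^ 2 * (p - 1)) := by
  have hp := one_lt_p (p := p)
  have hS₂ : MeasurableSet (antiRegion p ∩ {q | (p : ℝ) ^ (1 + 1) ≤ ‖q.1‖}) :=
    measurableSet_antiRegion.inter (by measurability)
  rw [setIntegral_eq_add (S₂ := antiRegion p ∩ {q | (p : ℝ) ^ (1 + 1) ≤ ‖q.1‖})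
    ?_ ?_ hS₂ (hF.mono_set antiRegion_subset), setIntegral_antiRegion_core hμ hθ hW hF,
    setIntegral_eq_zero_of_translation hμ hθ hS₂ ?_
      (hF.mono_set (Set.inter_subset_left.trans antiRegion_subset)) ?_, add_zero]
  · rintro s x y z hs ⟨hq, hx⟩
    simp only [Set.mem_ofPred_eq] at hx
    have hsx : ‖s + x‖ = ‖x‖ := by
      rw [add_comm, norm_add_eq_left]
      exact (hs.trans_lt (lt_self_pow₀ hp one_lt_two)).trans_le hx
    obtain ⟨h1, h2, h3⟩ := hq
    exact ⟨⟨by simpa [hsx] using h1, by simpa [hsx] using h2, by simpa [hsx] using h3⟩,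
      by simpa [hsx] using hx⟩
  · rintro s x y z hs ⟨hq, hx⟩
    simp only [Set.mem_ofPred_eq] at hx
    have hsx : ‖s + x‖ = ‖x‖ := by
      rw [add_comm, norm_add_eq_left]
      exact (hs.trans_lt (lt_self_pow₀ hp one_lt_two)).trans_le hx
    have hmem : (s + x, y, z) ∈ antiRegion p := by
      obtain ⟨h1, h2, h3⟩ := hq
      exact ⟨by simpa [hsx] using h1, by simpa [hsx] using h2, by simpa [hsx] using h3⟩
    have hx0 := ne_zero_of_one_lt_norm (one_lt_norm_of_mem_antiRegion hq)
    have hz0 := ne_zero_of_one_lt_norm (antiRegion_subset hq).1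
    rw [integrand_eq_of_mem_antiRegion hθ hW ν hmem, integrand_eq_of_mem_antiRegion hθ hW ν hq,
      hW.antidiag_congr (s := z ^ 2 / x ^ 4) (t := z ^ 2 / (s + x) ^ 4), neg_add, hθ.map_add]
    · ring
    · exact div_ne_zero (pow_ne_zero 2 hz0) (pow_ne_zero 4 hx0)
    · simp [hsx]
  · rintro ⟨x, y, z⟩
    simp only [Set.mem_prod, Set.mem_ofPred_eq, Set.mem_inter_iff]
    constructor
    · intro hq
      by_cases hx : (p : ℝ) ^ (1 + 1) ≤ ‖x‖
      · exact Or.inr ⟨hq, hx⟩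
      left
      have hx1 := one_lt_norm_of_mem_antiRegion hq
      obtain ⟨h1, h2, h3⟩ := hq
      simp only at h1 h2 h3 hx1
      have hx2 := norm_le_pow_of_lt_pow_succ (not_le.1 hx)
      have hx3 := pow_succ_le_norm_of_pow_lt (p := p) (n := 0) (by simpa using hx1)
      have hx4 : ‖x‖ = (p : ℝ) ^ (0 + 1) := le_antisymm hx2 hx3
      rw [hx4] at h1 h2 h3
      exact ⟨hx4, h3, le_antisymm (h2.trans_eq (by ring)) (pow_succ_le_norm_of_pow_lt h1)⟩
    · rintro (⟨hx, hy, hz⟩ | hq)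
      · refine ⟨?_, ?_, ?_⟩ <;> simp only [hx, hz]
        · exact pow_lt_pow_right₀ hp (by omega)
        · exact (le_of_eq (by ring))
        · exact hy
      · exact hq.1
  · rintro ⟨x, y, z⟩ ⟨hx, -⟩ ⟨-, hx'⟩
    simp only [Set.mem_ofPred_eq] at hx hx'
    rw [hx] at hx'
    exact hx'.not_gt (pow_lt_pow_right₀ hp (by omega))

end SmallCell

section DiagonalPart

variable {θ : ℚ_[p] → ℂ} {W : Matrix (Fin 2) (Fin 2) ℚ_[p] → ℂ} {ν : ℂ}

/-- The part of the large cell on which the integrand involves no character of `y ^ 2`. -/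
def diagonalRegion (p : ℕ) [Fact p.Prime] : Set (ℚ_[p] × ℚ_[p] × ℚ_[p]) :=
  {q | 1 < ‖q.2.2‖ ∧ ‖q.1‖ ^ 2 < ‖q.2.2‖ ∧ ‖q.2.1‖ ^ 2 ≤ ‖q.2.2‖}

theorem norm_mul_add_eq_of_mem_diagonalRegion {x y z : ℚ_[p]}
    (hq : (x, y, z) ∈ diagonalRegion p) : ‖x * y + z‖ = ‖z‖ := by
  obtain ⟨h1, hx, hy⟩ := hq
  simp only at h1 hx hy
  rw [add_comm]
  refine norm_add_eq_left ?_
  rw [norm_mul]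
  refine lt_of_pow_lt_pow_left₀ 2 (norm_nonneg z) ?_
  rw [mul_pow, sq ‖z‖]
  exact mul_lt_mul_of_lt_of_le_of_nonneg_of_pos hx hy (by positivity) (one_pos.trans h1)

theorem diagonalRegion_subset : diagonalRegion p ⊆ cellRegion p := by
  rintro ⟨x, y, z⟩ hq
  have hd := norm_mul_add_eq_of_mem_diagonalRegion hq
  obtain ⟨h1, hx, hy⟩ := hq
  simp only at h1 hx hy
  have hz : ‖z‖ < ‖z‖ ^ 2 := lt_self_pow₀ h1 one_lt_two
  have key : ∀ {t : ℝ}, t ^ 2 ≤ ‖z‖ → t < ‖z‖ := fun h =>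
    lt_of_pow_lt_pow_left₀ 2 (norm_nonneg z) (h.trans_lt hz)
  exact ⟨h1, key hx.le, key hy, hd ▸ hx, hd.ge⟩

theorem mem_diagonalRegion_iff {x y z : ℚ_[p]} : (x, y, z) ∈ diagonalRegion p ↔
    (x, y, z) ∈ cellRegion p ∧ ‖y‖ ^ 2 ≤ ‖x * y + z‖ := by
  refine ⟨fun hq => ⟨diagonalRegion_subset hq, ?_⟩, ?_⟩
  · rw [norm_mul_add_eq_of_mem_diagonalRegion hq]
    exact hq.2.2
  · rintro ⟨⟨h1, hxz, hyz, hxd, hzd⟩, hyd⟩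
    simp only at h1 hxz hyz hxd hzd
    have hxy : ‖-(x * y)‖ < ‖x * y + z‖ := by
      rw [norm_neg, norm_mul]
      refine lt_of_pow_lt_pow_left₀ 2 (norm_nonneg _) ?_
      rw [mul_pow, sq ‖x * y + z‖]
      exact mul_lt_mul_of_lt_of_le_of_nonneg_of_pos hxd hyd (by positivity)
        (one_pos.trans (h1.trans_le hzd))
    have := norm_add_eq_left hxy
    rw [add_neg_cancel_comm] at this
    rw [← this] at hxd hyd
    exact ⟨h1, hxd, hyd⟩

theorem integrand_eq_of_mem_diagonalRegion (hθ : IsStandardCharacter θ) (hW : IsWhittaker θ W)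
    {x y z : ℚ_[p]} (hq : (x, y, z) ∈ diagonalRegion p) :
    integrand θ W ν (x, y, z) = (‖z‖ : ℂ) ^ (-2 - ν) * W 1 * θ (-x) := by
  have hd := norm_mul_add_eq_of_mem_diagonalRegion hq
  obtain ⟨h1, hx, hy⟩ := hq
  simp only at h1 hx hy
  have hz := ne_zero_of_one_lt_norm h1
  rw [integrand_eq_cellFactor_mul hW ν hz (hd ▸ hx), cellFactor_eq hW ν hz hd,
    hθ.eq_one (-(y ^ 2 / (x * y + z))), mul_one]
  rw [norm_neg, norm_div, hd, norm_pow, div_le_one (one_pos.trans h1)]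
  exact hy

variable [MeasurableSpace ℚ_[p]] [BorelSpace ℚ_[p]] {μ : Measure ℚ_[p]} [SigmaFinite μ]

theorem measurableSet_diagonalRegion : MeasurableSet (diagonalRegion p) := by
  unfold diagonalRegion
  measurability

theorem setIntegral_diagonalRegion_box (hμ : IsNormalizedHaar μ) (hθ : IsStandardCharacter θ)
    (hW : IsWhittaker θ W) {k n : ℕ}
    (hsub : {x : ℚ_[p] | ‖x‖ ≤ (p : ℝ) ^ 0} ×ˢ
      ({y : ℚ_[p] | ‖y‖ ≤ (p : ℝ) ^ k} ×ˢ {z : ℚ_[p] | ‖z‖ = (p : ℝ) ^ (n + 1)}) ⊆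
        diagonalRegion p) :
    ∫ q in {x : ℚ_[p] | ‖x‖ ≤ (p : ℝ) ^ 0} ×ˢ
      ({y : ℚ_[p] | ‖y‖ ≤ (p : ℝ) ^ k} ×ˢ {z : ℚ_[p] | ‖z‖ = (p : ℝ) ^ (n + 1)}),
      integrand θ W ν q ∂(μ.prod (μ.prod μ)) =
    (((p : ℝ) ^ (n + 1) : ℝ) : ℂ) ^ (-2 - ν) * W 1 * ((p : ℂ) ^ (k + n) * (p - 1)) := by
  rw [setIntegral_congr_fun (g := fun _ => (((p : ℝ) ^ (n + 1) : ℝ) : ℂ) ^ (-2 - ν) * W 1)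
    (by measurability)]
  · rw [setIntegral_const, measureReal_prod_prod, measureReal_prod_prod,
      hμ.real_sphere_pow, hμ.real_ball_pow, hμ.real_ball_pow, Complex.real_smul]
    push_cast
    ring
  · rintro ⟨x, y, z⟩ hq
    simp only
    rw [integrand_eq_of_mem_diagonalRegion hθ hW (hsub hq), hθ.eq_one, hq.2.2, mul_one]
    rw [norm_neg]
    exact hq.1.trans_eq (pow_zero _)

theorem setIntegral_diagonalRegion_high (hμ : IsNormalizedHaar μ) (hθ : IsStandardCharacter θ)
    (hW : IsWhittaker θ W)
    (hF : IntegrableOn (integrand θ W ν) (region p) (μ.prod (μ.prod μ))) :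
    ∫ q in diagonalRegion p ∩ {q | (p : ℝ) ^ (2 + 1) ≤ ‖q.2.2‖},
      integrand θ W ν q ∂(μ.prod (μ.prod μ)) = 0 := by
  have hmem : ∀ s x y z : ℚ_[p], ‖s‖ ≤ p →
      (x, y, z) ∈ diagonalRegion p ∩ {q | (p : ℝ) ^ (2 + 1) ≤ ‖q.2.2‖} →
      (s + x, y, z) ∈ diagonalRegion p ∩ {q | (p : ℝ) ^ (2 + 1) ≤ ‖q.2.2‖} := by
    rintro s x y z hs ⟨⟨h1, hx, hy⟩, hz⟩
    refine ⟨⟨h1, norm_add_sq_lt ?_ hx, hy⟩, hz⟩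
    exact (pow_le_pow_left₀ (norm_nonneg s) hs 2).trans_lt
      ((pow_lt_pow_right₀ one_lt_p (by omega)).trans_le hz)
  refine setIntegral_eq_zero_of_translation hμ hθ
    (measurableSet_diagonalRegion.inter (by measurability)) hmem
    (hF.mono_set (Set.inter_subset_left.trans (diagonalRegion_subset.trans cellRegion_subset))) ?_
  intro s x y z hs hq
  rw [integrand_eq_of_mem_diagonalRegion hθ hW (hmem s x y z hs hq).1,
    integrand_eq_of_mem_diagonalRegion hθ hW hq.1, neg_add, hθ.map_add]
  ring

theorem setIntegral_diagonalRegion (hμ : IsNormalizedHaar μ) (hθ : IsStandardCharacter θ)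
    (hW : IsWhittaker θ W)
    (hF : IntegrableOn (integrand θ W ν) (region p) (μ.prod (μ.prod μ))) :
    ∫ q in diagonalRegion p, integrand θ W ν q ∂(μ.prod (μ.prod μ)) =
      (((p : ℝ) ^ 1 : ℝ) : ℂ) ^ (-2 - ν) * W 1 * (p - 1) +
      (((p : ℝ) ^ 2 : ℝ) : ℂ) ^ (-2 - ν) * W 1 * ((p : ℂ) ^ 2 * (p - 1)) := by
  have hp := one_lt_p (p := p)
  have hpp : (p : ℝ) < p ^ 2 := lt_self_pow₀ hp one_lt_two
  have hFd := hF.mono_set (diagonalRegion_subset.trans cellRegion_subset)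
  have hsub₁ : {x : ℚ_[p] | ‖x‖ ≤ (p : ℝ) ^ 0} ×ˢ
      ({y : ℚ_[p] | ‖y‖ ≤ (p : ℝ) ^ 0} ×ˢ {z : ℚ_[p] | ‖z‖ = (p : ℝ) ^ (0 + 1)}) ⊆
        diagonalRegion p := by
    rintro ⟨x, y, z⟩ ⟨hx, hy, hz⟩
    simp only [Set.mem_ofPred_eq, pow_zero, zero_add, pow_one] at hx hy hz
    exact ⟨hz ▸ hp, hz ▸ (pow_le_one₀ (norm_nonneg x) hx).trans_lt hp,
      hz ▸ (pow_le_one₀ (norm_nonneg y) hy).trans hp.le⟩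
  have hsub₂ : {x : ℚ_[p] | ‖x‖ ≤ (p : ℝ) ^ 0} ×ˢ
      ({y : ℚ_[p] | ‖y‖ ≤ (p : ℝ) ^ 1} ×ˢ {z : ℚ_[p] | ‖z‖ = (p : ℝ) ^ (1 + 1)}) ⊆
        diagonalRegion p := by
    rintro ⟨x, y, z⟩ ⟨hx, hy, hz⟩
    simp only [Set.mem_ofPred_eq, pow_zero, one_add_one_eq_two, pow_one] at hx hy hz
    exact ⟨hz ▸ hp.trans hpp, hz ▸ (pow_le_one₀ (norm_nonneg x) hx).trans_lt (hp.trans hpp),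
      hz ▸ pow_le_pow_left₀ (norm_nonneg y) hy 2⟩
  have hS₃ : MeasurableSet (diagonalRegion p ∩ {q | (p : ℝ) ^ (2 + 1) ≤ ‖q.2.2‖}) :=
    measurableSet_diagonalRegion.inter (by measurability)
  have hS₂ : MeasurableSet ({x : ℚ_[p] | ‖x‖ ≤ (p : ℝ) ^ 0} ×ˢ
      ({y : ℚ_[p] | ‖y‖ ≤ (p : ℝ) ^ 1} ×ˢ {z : ℚ_[p] | ‖z‖ = (p : ℝ) ^ (1 + 1)})) := by
    measurability
  rw [setIntegral_eq_add (S₁ := ({x : ℚ_[p] | ‖x‖ ≤ (p : ℝ) ^ 0} ×ˢ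
      ({y : ℚ_[p] | ‖y‖ ≤ (p : ℝ) ^ 0} ×ˢ {z : ℚ_[p] | ‖z‖ = (p : ℝ) ^ (0 + 1)})) ∪
      ({x : ℚ_[p] | ‖x‖ ≤ (p : ℝ) ^ 0} ×ˢ
      ({y : ℚ_[p] | ‖y‖ ≤ (p : ℝ) ^ 1} ×ˢ {z : ℚ_[p] | ‖z‖ = (p : ℝ) ^ (1 + 1)}))) ?_ ?_ hS₃ hFd,
    setIntegral_diagonalRegion_high hμ hθ hW hF, add_zero,
    setIntegral_union ?_ hS₂ (hFd.mono_set hsub₁) (hFd.mono_set hsub₂),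
    setIntegral_diagonalRegion_box hμ hθ hW hsub₁, setIntegral_diagonalRegion_box hμ hθ hW hsub₂]
  · norm_num
  · refine Set.disjoint_left.2 ?_
    rintro ⟨x, y, z⟩ ⟨-, -, hz⟩ ⟨-, -, hz'⟩
    exact (pow_lt_pow_right₀ hp (by omega)).ne (hz.symm.trans hz')
  · rintro ⟨x, y, z⟩
    refine ⟨fun hq => ?_, ?_⟩
    · by_cases hz3 : (p : ℝ) ^ (2 + 1) ≤ ‖z‖
      · exact Or.inr ⟨hq, hz3⟩
      left
      obtain ⟨h1, hx, hy⟩ := hq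
      simp only at h1 hx hy
      have hz2 := norm_le_pow_of_lt_pow_succ (not_le.1 hz3)
      have hx1 : ‖x‖ ≤ (p : ℝ) ^ 0 := norm_le_pow_of_lt_pow_succ
        (lt_of_pow_lt_pow_left₀ 2 (by positivity) (hx.trans_le (by simpa using hz2)))
      by_cases hzp : ‖z‖ < (p : ℝ) ^ (1 + 1)
      · have hz1 := le_antisymm (norm_le_pow_of_lt_pow_succ hzp)
          (pow_succ_le_norm_of_pow_lt (n := 0) (by simpa using h1))
        refine Or.inl ⟨hx1, norm_le_pow_of_lt_pow_succ ?_, hz1⟩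
        refine lt_of_pow_lt_pow_left₀ 2 (by positivity) (hy.trans_lt ?_)
        simpa [hz1] using hpp
      · have hz2' : ‖z‖ = (p : ℝ) ^ 2 := le_antisymm hz2 (not_lt.1 hzp)
        refine Or.inr ⟨hx1, ?_, hz2'⟩
        refine (pow_le_pow_iff_left₀ (norm_nonneg y) (by positivity) two_ne_zero).1 ?_
        simpa [hz2'] using hy
    · rintro ((hq | hq) | hq)
      · exact hsub₁ hq
      · exact hsub₂ hq
      · exact hq.1
  · rintro ⟨x, y, z⟩ (⟨-, -, hz⟩ | ⟨-, -, hz⟩) ⟨-, hz'⟩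
    · exact (pow_lt_pow_right₀ hp (by omega)).not_ge (hz'.trans_eq hz)
    · exact (pow_lt_pow_right₀ hp (by omega)).not_ge (hz'.trans_eq hz)

end DiagonalPart

section CharacterIntegral

variable [MeasurableSpace ℚ_[p]] [BorelSpace ℚ_[p]] {μ : Measure ℚ_[p]} [SigmaFinite μ]
variable {θ : ℚ_[p] → ℂ}

theorem measurePreserving_shear (hμ : IsNormalizedHaar μ) :
    MeasurePreserving (fun q : ℚ_[p] × ℚ_[p] × ℚ_[p] => (q.1, q.2.1, q.1 * q.2.1 + q.2.2))
      (μ.prod (μ.prod μ)) (μ.prod (μ.prod μ)) := by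
  have h : ∀ x : ℚ_[p], MeasurePreserving (fun r : ℚ_[p] × ℚ_[p] => (r.1, x * r.1 + r.2))
      (μ.prod μ) (μ.prod μ) := fun x =>
    (MeasurePreserving.id μ).skew_product (g := fun y z => x * y + z)
      (by simp only [Function.uncurry_def]; fun_prop)
      (Filter.Eventually.of_forall fun y => hμ.map_add _)
  exact (MeasurePreserving.id μ).skew_product
    (g := fun (x : ℚ_[p]) (r : ℚ_[p] × ℚ_[p]) => (r.1, x * r.1 + r.2))
    (by simp only [Function.uncurry_def]; fun_prop)
    (Filter.Eventually.of_forall fun x => (h x).map_eq)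

/-- The part of the large cell that contributes to the integral through a character of `y ^ 2`. -/
def shellRegion (p : ℕ) [Fact p.Prime] : Set (ℚ_[p] × ℚ_[p] × ℚ_[p]) :=
  {q | ‖q.1‖ ≤ (p : ℝ) ^ 1 ∧ ‖q.2.1‖ = (p : ℝ) ^ 2 ∧ ‖q.2.2‖ = (p : ℝ) ^ 3 ∧
    ‖q.1 * q.2.1 + q.2.2‖ = (p : ℝ) ^ 3}

theorem setIntegral_shellRegion (hμ : IsNormalizedHaar μ) (hθ : IsStandardCharacter θ) :
    ∫ q in shellRegion p, θ (-q.1) ∂(μ.prod (μ.prod μ)) = (p : ℂ) ^ 3 * (p - 1) := by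
  have hp := one_lt_p (p := p)
  have hpow : ∀ {k l : ℕ}, k < l → (p : ℝ) ^ k < (p : ℝ) ^ l := fun h => pow_lt_pow_right₀ hp h
  have hθc := hθ.continuous
  set S : Set (ℚ_[p] × ℚ_[p] × ℚ_[p]) := {x : ℚ_[p] | ‖x‖ ≤ (p : ℝ) ^ 1} ×ˢ
    ({y : ℚ_[p] | ‖y‖ = (p : ℝ) ^ (1 + 1)} ×ˢ {z : ℚ_[p] | ‖z‖ = (p : ℝ) ^ (2 + 1)}) with hSdef
  have hS : MeasurableSet S := by measurability
  have hSF : IntegrableOn (fun q : ℚ_[p] × ℚ_[p] × ℚ_[p] => θ (-q.1)) S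
      (μ.prod (μ.prod μ)) := by
    refine IntegrableOn.of_bound ?_
      (Continuous.aestronglyMeasurable (by fun_prop)) 1 (by simp [hθ.norm_eq_one])
    rw [hSdef, Measure.prod_prod, Measure.prod_prod, hμ.measure_sphere_pow, hμ.measure_sphere_pow,
      hμ.measure_ball_pow]
    exact ENNReal.mul_lt_top (by simp)
      (ENNReal.mul_lt_top ENNReal.ofReal_lt_top ENNReal.ofReal_lt_top)
  set B : Set (ℚ_[p] × ℚ_[p] × ℚ_[p]) := {x : ℚ_[p] | ‖x‖ = (p : ℝ) ^ (0 + 1)} ×ˢ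
    ({y : ℚ_[p] | ‖y‖ = (p : ℝ) ^ (1 + 1)} ×ˢ {z : ℚ_[p] | ‖z‖ ≤ (p : ℝ) ^ 2}) with hBdef
  have hB : MeasurableSet B := by measurability
  set N : Set (ℚ_[p] × ℚ_[p] × ℚ_[p]) :=
    (fun q : ℚ_[p] × ℚ_[p] × ℚ_[p] => (q.1, q.2.1, q.1 * q.2.1 + q.2.2)) ⁻¹' B with hNdef
  have hN : MeasurableSet N := (measurePreserving_shear hμ).measurable hB
  have hmemN : ∀ x y z : ℚ_[p], (x, y, z) ∈ N ↔ ‖x‖ = (p : ℝ) ^ (0 + 1) ∧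
      ‖y‖ = (p : ℝ) ^ (1 + 1) ∧ ‖x * y + z‖ ≤ (p : ℝ) ^ 2 := fun x y z => Iff.rfl
  have hNz : ∀ x y z : ℚ_[p], (x, y, z) ∈ N → ‖z‖ = (p : ℝ) ^ 3 := by
    intro x y z hq
    obtain ⟨hx, hy, hd⟩ := (hmemN x y z).1 hq
    have hxy : ‖-(x * y)‖ = (p : ℝ) ^ 3 := by rw [norm_neg, norm_mul, hx, hy]; ring
    rw [← hxy, ← norm_add_eq_left (x := -(x * y)) (y := x * y + z), neg_add_cancel_left]
    rw [hxy]
    exact hd.trans_lt (hpow (by omega))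
  have hNS : N ⊆ S := by
    rintro ⟨x, y, z⟩ hq
    obtain ⟨hx, hy, -⟩ := (hmemN x y z).1 hq
    exact ⟨hx.le, hy, hNz x y z hq⟩
  have h0 : ∫ q in S, θ (-q.1) ∂(μ.prod (μ.prod μ)) = 0 := by
    refine setIntegral_eq_zero_of_translation hμ hθ hS ?_ hSF ?_
    · rintro s x y z hs ⟨hx, hyz⟩
      exact ⟨norm_add_le_of_le (by simpa using hs) hx, hyz⟩
    · intro s x y z _ _
      simp only
      rw [neg_add, hθ.map_add]
  have h1 : ∫ q in N, θ (-q.1) ∂(μ.prod (μ.prod μ)) = -((p : ℂ) ^ 3 * (p - 1)) := by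
    have h := (setIntegral_of_unit_dilation (T := dilation 1 0 1) hθ
      (fun u => measurePreserving_dilation hμ 1 0 1) (fun u => dilation_inv 1 0 1) hN (S := N)
      (G := fun _ => 1) (b := fun q => -q.1) ?_ (hSF.mono_set hNS) ?_ ?_).2
    · have hvol : (μ.prod (μ.prod μ)).real N = (μ.prod (μ.prod μ)).real B := by
        rw [Measure.real, (measurePreserving_shear hμ).measure_preimage hB.nullMeasurableSet,
          Measure.real]
      rw [setIntegral_const, hvol, hBdef, measureReal_prod_prod, measureReal_prod_prod,
        hμ.real_sphere_pow, hμ.real_sphere_pow, hμ.real_ball_pow, Complex.real_smul] at h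
      refine mul_left_cancel₀ (p_sub_one_ne_zero (p := p)) ?_
      rw [h]
      push_cast
      ring
    · rintro u hu ⟨x, y, z⟩ hq
      simp only [dilation, pow_one, pow_zero, one_mul]
      rw [hmemN] at hq ⊢
      rw [mul_assoc, ← mul_add, norm_mul, norm_mul, hu, one_mul, one_mul]
      exact hq
    · rintro ⟨x, y, z⟩ ⟨hx, -⟩
      simpa using hx
    · rintro u hu ⟨x, y, z⟩ hq
      simp [dilation]
  rw [setIntegral_eq_add (S₁ := shellRegion p) (S₂ := N) ?_ ?_ hN hSF, h1] at h0
  · linear_combination h0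
  · rintro ⟨x, y, z⟩
    refine ⟨fun hq => ?_, ?_⟩
    · obtain ⟨hx, hy, hz⟩ := hq
      simp only [Set.mem_ofPred_eq] at hx hy hz
      by_cases hd : ‖x * y + z‖ = (p : ℝ) ^ 3
      · exact Or.inl ⟨hx, hy, hz, hd⟩
      right
      have hxy : ‖x * y‖ ≤ (p : ℝ) ^ 3 := by
        rw [norm_mul, hy]
        calc ‖x‖ * (p : ℝ) ^ (1 + 1) ≤ (p : ℝ) ^ 1 * (p : ℝ) ^ (1 + 1) := by gcongr
          _ = (p : ℝ) ^ 3 := by ring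
      have hd2 : ‖x * y + z‖ ≤ (p : ℝ) ^ 2 :=
        norm_le_pow_of_lt_pow_succ (lt_of_le_of_ne (norm_add_le_of_le hxy hz.le) hd)
      refine (hmemN x y z).2 ⟨le_antisymm hx (not_lt.1 fun hx' => ?_), hy, hd2⟩
      have hx0 := norm_le_pow_of_lt_pow_succ hx'
      have hxy' : ‖x * y‖ < ‖z‖ := by
        rw [norm_mul, hy, hz]
        refine lt_of_le_of_lt (mul_le_of_le_one_left (by positivity) ?_) (hpow (by omega))
        simpa using hx0
      exact hd ((add_comm (x * y) z ▸ norm_add_eq_left hxy').trans hz)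
    · rintro (hq | hq)
      · exact ⟨hq.1, hq.2.1, hq.2.2.1⟩
      · exact hNS hq
  · rintro ⟨x, y, z⟩ ⟨-, -, -, hd⟩ hq
    exact (hpow (by omega)).not_ge (hd.ge.trans ((hmemN x y z).1 hq).2.2)

end CharacterIntegral

section LargeCell

variable {θ : ℚ_[p] → ℂ} {W : Matrix (Fin 2) (Fin 2) ℚ_[p] → ℂ} {ν : ℂ}

theorem dilation_mem_cellRegion {u : ℚ_[p]} (hu : ‖u‖ = 1) {x y z : ℚ_[p]}
    (hq : (x, y, z) ∈ cellRegion p) : (x, u * y, u * z) ∈ cellRegion p := by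
  obtain ⟨h1, h2, h3, h4, h5⟩ := hq
  have hd : x * (u * y) + u * z = u * (x * y + z) := by ring
  refine ⟨?_, ?_, ?_, ?_, ?_⟩ <;> simp only [hd, norm_mul u, hu, one_mul] <;> assumption

theorem ne_zero_of_mem_cellRegion {x y z : ℚ_[p]} (hq : (x, y, z) ∈ cellRegion p) :
    z ≠ 0 ∧ x * y + z ≠ 0 :=
  ⟨ne_zero_of_one_lt_norm hq.1, ne_zero_of_one_lt_norm (hq.1.trans_le hq.2.2.2.2)⟩

theorem integrand_dilation (hW : IsWhittaker θ W) {u : ℚ_[p]} (hu : ‖u‖ = 1)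
    {x y z : ℚ_[p]} (hq : (x, y, z) ∈ cellRegion p) :
    integrand θ W ν (x, u * y, u * z) =
      cellFactor W ν (x, y, z) * θ (-x) * θ (u * -(y ^ 2 / (x * y + z))) := by
  have hu0 : u ≠ 0 := norm_pos_iff.1 (by rw [hu]; exact one_pos)
  obtain ⟨hz, hd0⟩ := ne_zero_of_mem_cellRegion hq
  have hd : x * (u * y) + u * z = u * (x * y + z) := by ring
  rw [integrand_eq_cellFactor_mul hW ν (mul_ne_zero hu0 hz)
    (dilation_mem_cellRegion hu hq).2.2.2.1,
    cellFactor_congr hW ν hz hd0 (by rw [norm_mul, hu, one_mul])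
      (by rw [hd, norm_mul, hu, one_mul]), hd]
  congr 2
  field_simp

/-- The locus in the large cell where the character of `y ^ 2` has a given conductor. -/
def conductorRegion (p : ℕ) [Fact p.Prime] (n : ℕ) : Set (ℚ_[p] × ℚ_[p] × ℚ_[p]) :=
  cellRegion p ∩ {q | ‖q.2.1‖ ^ 2 = (p : ℝ) ^ n * ‖q.1 * q.2.1 + q.2.2‖}

theorem dilation_mem_conductorRegion {n : ℕ} {u : ℚ_[p]} (hu : ‖u‖ = 1)
    {q : ℚ_[p] × ℚ_[p] × ℚ_[p]} (hq : q ∈ conductorRegion p n) :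
    dilation 0 1 1 u q ∈ conductorRegion p n := by
  obtain ⟨x, y, z⟩ := q
  obtain ⟨hq, hn⟩ := hq
  have hd : x * (u * y) + u * z = u * (x * y + z) := by ring
  simp only [dilation, pow_one, pow_zero, one_mul]
  refine ⟨dilation_mem_cellRegion hu hq, ?_⟩
  simpa only [Set.mem_ofPred_eq, hd, norm_mul u, hu, one_mul] using hn

theorem norm_div_of_mem_conductorRegion {n : ℕ} {x y z : ℚ_[p]}
    (hq : (x, y, z) ∈ conductorRegion p n) : ‖-(y ^ 2 / (x * y + z))‖ = (p : ℝ) ^ n := by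
  obtain ⟨hq, hn⟩ := hq
  have hd := (ne_zero_of_mem_cellRegion hq).2
  rw [norm_neg, norm_div, norm_pow, div_eq_iff (norm_ne_zero_iff.2 hd)]
  exact hn

theorem conductorRegion_subset (n : ℕ) : conductorRegion p n ⊆ region p :=
  Set.inter_subset_left.trans cellRegion_subset

theorem disjoint_conductorRegion {k l : ℕ} (h : k ≠ l) :
    Disjoint (conductorRegion p k) (conductorRegion p l) := by
  refine Set.disjoint_left.2 ?_
  rintro ⟨x, y, z⟩ hk hl
  have := (norm_div_of_mem_conductorRegion hk).symm.trans (norm_div_of_mem_conductorRegion hl)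
  exact h (pow_right_injective₀ (one_pos.trans one_lt_p) one_lt_p.ne' this)

variable [MeasurableSpace ℚ_[p]] [BorelSpace ℚ_[p]] {μ : Measure ℚ_[p]} [SigmaFinite μ]

theorem measurableSet_cellRegion : MeasurableSet (cellRegion p) := by
  unfold cellRegion
  measurability

theorem measurableSet_conductorRegion (n : ℕ) : MeasurableSet (conductorRegion p n) :=
  measurableSet_cellRegion.inter (by measurability)

theorem setIntegral_conductorRegion_add_two (hμ : IsNormalizedHaar μ) (hθ : IsStandardCharacter θ)
    (hW : IsWhittaker θ W) (hF : IntegrableOn (integrand θ W ν) (region p) (μ.prod (μ.prod μ)))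
    (k : ℕ) : ∫ q in conductorRegion p (k + 2), integrand θ W ν q ∂(μ.prod (μ.prod μ)) = 0 := by
  refine setIntegral_eq_zero_of_unit_dilation (T := dilation 0 1 1) hθ
    (fun u => measurePreserving_dilation hμ 0 1 1) (fun u => dilation_inv 0 1 1)
    (measurableSet_conductorRegion _) (fun u hu q hq => dilation_mem_conductorRegion hu hq)
    (hF.mono_set (conductorRegion_subset _)) (G := fun q => cellFactor W ν q * θ (-q.1))
    (b := fun q => -(q.2.1 ^ 2 / (q.1 * q.2.1 + q.2.2)))
    (fun q hq => norm_div_of_mem_conductorRegion hq) ?_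
  rintro u hu ⟨x, y, z⟩ hq
  simpa only [dilation, pow_one, pow_zero, one_mul] using integrand_dilation hW hu hq.1

theorem setIntegral_conductorRegion_one (hμ : IsNormalizedHaar μ) (hθ : IsStandardCharacter θ)
    (hW : IsWhittaker θ W)
    (hF : IntegrableOn (integrand θ W ν) (region p) (μ.prod (μ.prod μ))) :
    ∫ q in conductorRegion p 1, integrand θ W ν q ∂(μ.prod (μ.prod μ)) =
      -(((p : ℝ) ^ 3 : ℝ) : ℂ) ^ (-2 - ν) * W 1 * (p : ℂ) ^ 3 := by
  have hp := one_lt_p (p := p)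
  have hpow : ∀ {k l : ℕ}, k < l → (p : ℝ) ^ k < (p : ℝ) ^ l := fun h => pow_lt_pow_right₀ hp h
  obtain ⟨hG, h⟩ := setIntegral_of_unit_dilation (T := dilation 0 1 1) hθ
    (fun u => measurePreserving_dilation hμ 0 1 1) (fun u => dilation_inv 0 1 1)
    (measurableSet_conductorRegion 1) (fun u hu q hq => dilation_mem_conductorRegion hu hq)
    (hF.mono_set (conductorRegion_subset _)) (G := fun q => cellFactor W ν q * θ (-q.1))
    (b := fun q => -(q.2.1 ^ 2 / (q.1 * q.2.1 + q.2.2)))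
    (fun q hq => by simpa using norm_div_of_mem_conductorRegion hq) (by
      rintro u hu ⟨x, y, z⟩ hq
      simpa only [dilation, pow_one, pow_zero, one_mul] using integrand_dilation hW hu hq.1)
  have hS₂ : MeasurableSet (conductorRegion p 1 ∩ {q | (p : ℝ) ^ (2 + 1) ≤ ‖q.2.1‖}) :=
    (measurableSet_conductorRegion 1).inter (by measurability)
  have hshell : ∫ q in shellRegion p, cellFactor W ν q * θ (-q.1) ∂(μ.prod (μ.prod μ)) =
      (((p : ℝ) ^ 3 : ℝ) : ℂ) ^ (-2 - ν) * W 1 * ((p : ℂ) ^ 3 * (p - 1)) := by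
    rw [← setIntegral_shellRegion hμ hθ, ← integral_const_mul]
    refine setIntegral_congr_fun (by unfold shellRegion; measurability) ?_
    rintro ⟨x, y, z⟩ ⟨hx, hy, hz, hd⟩
    simp only at hx hy hz hd ⊢
    rw [cellFactor_eq hW ν (norm_pos_iff.1 (by rw [hz]; positivity)) (hd.trans hz.symm), hz]
  have hnorm : ∀ x y z : ℚ_[p], (x, y, z) ∈ conductorRegion p 1 →
      ‖y‖ ^ 2 = p * ‖x * y + z‖ := fun x y z hq => by simpa using hq.2
  have hlow : ∀ x y z : ℚ_[p], (x, y, z) ∈ conductorRegion p 1 →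
      ∀ s : ℚ_[p], ‖s‖ ≤ p → (p : ℝ) ^ (2 + 1) ≤ ‖y‖ →
      (s + x, y, z) ∈ conductorRegion p 1 ∧ ‖(s + x) * y + z‖ = ‖x * y + z‖ := by
    intro x y z hq s hs hy
    have hn := hnorm x y z hq
    have hy0 : 0 < ‖y‖ := lt_of_lt_of_le (by positivity) hy
    have hpy : (p : ℝ) < ‖y‖ := (lt_self_pow₀ hp (by omega)).trans_le hy
    have hd : ‖(s + x) * y + z‖ = ‖x * y + z‖ := by
      have : (s + x) * y + z = (x * y + z) + s * y := by ring
      rw [this, norm_add_eq_left]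
      rw [← mul_lt_mul_iff_right₀ (one_pos.trans hp), ← hn, norm_mul]
      calc (p : ℝ) * (‖s‖ * ‖y‖) ≤ p * (p * ‖y‖) := by gcongr
        _ = p ^ 2 * ‖y‖ := by ring
        _ < ‖y‖ * ‖y‖ := by
          gcongr
          exact (hpow (by omega)).trans_le hy
        _ = ‖y‖ ^ 2 := by ring
    obtain ⟨⟨h1, h2, h3, h4, h5⟩, -⟩ := hq
    simp only at h1 h2 h3 h4 h5
    refine ⟨⟨⟨h1, ?_, h3, ?_, ?_⟩, ?_⟩, hd⟩
    · exact (Padic.nonarchimedean s x).trans_lt (max_lt (hs.trans_lt (hpy.trans h3)) h2)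
    · simp only [hd]
      refine norm_add_sq_lt ?_ h4
      rw [← mul_lt_mul_iff_right₀ (one_pos.trans hp), ← hn]
      calc (p : ℝ) * ‖s‖ ^ 2 ≤ p * (p : ℝ) ^ 2 := by gcongr
        _ = (p : ℝ) ^ (2 + 1) := by ring
        _ ≤ ‖y‖ := hy
        _ < ‖y‖ ^ 2 := lt_self_pow₀ (hp.trans hpy) one_lt_two
    · simpa only [hd] using h5
    · simpa only [Set.mem_ofPred_eq, hd, pow_one] using hn
  rw [setIntegral_eq_add (S₁ := shellRegion p) ?_ ?_ hS₂ hG, hshell,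
    setIntegral_eq_zero_of_translation hμ hθ hS₂ ?_ (hG.mono_set Set.inter_subset_left) ?_,
    add_zero] at h
  · refine mul_left_cancel₀ (p_sub_one_ne_zero (p := p)) ?_
    rw [h]
    ring
  · rintro s x y z hs ⟨hq, hy⟩
    exact ⟨(hlow x y z hq s hs hy).1, hy⟩
  · rintro s x y z hs ⟨hq, hy⟩
    obtain ⟨hz, hd⟩ := ne_zero_of_mem_cellRegion hq.1
    simp only
    rw [cellFactor_congr hW ν hz hd rfl (hlow x y z hq s hs hy).2, neg_add, hθ.map_add]
    ring
  · rintro ⟨x, y, z⟩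
    refine ⟨fun hq => ?_, ?_⟩
    · by_cases hy3 : (p : ℝ) ^ (2 + 1) ≤ ‖y‖
      · exact Or.inr ⟨hq, hy3⟩
      left
      have hn := hnorm x y z hq
      obtain ⟨⟨h1, h2, h3, h4, h5⟩, -⟩ := hq
      simp only at h1 h2 h3 h4 h5
      have hy2 := norm_le_pow_of_lt_pow_succ (not_le.1 hy3)
      have hyz := p_mul_norm_le_of_norm_lt h3
      have hy0 : 0 < ‖y‖ := by
        refine (norm_nonneg y).lt_of_ne' fun h0 => ?_
        rw [h0] at hn
        nlinarith
      have hy2' : (p : ℝ) ^ 2 ≤ ‖y‖ := by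
        refine le_of_mul_le_mul_right ?_ hy0
        nlinarith
      have hy : ‖y‖ = (p : ℝ) ^ 2 := le_antisymm hy2 hy2'
      have hd : ‖x * y + z‖ = (p : ℝ) ^ 3 := by
        refine mul_left_cancel₀ (one_pos.trans hp).ne' (hn.symm.trans ?_)
        rw [hy]
        ring
      rw [hd] at h4 h5
      refine ⟨?_, hy, le_antisymm h5 ?_, hd⟩
      · refine norm_le_pow_of_lt_pow_succ (lt_of_pow_lt_pow_left₀ 2 (by positivity) (h4.trans ?_))
        rw [← pow_mul]
        exact hpow (by omega)
      · rw [hy] at hyz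
        exact (pow_succ' (p : ℝ) 2).trans_le hyz
    · rintro (⟨hx, hy, hz, hd⟩ | hq)
      · simp only at hx hy hz hd
        refine ⟨⟨?_, ?_, ?_, ?_, ?_⟩, ?_⟩ <;> simp only [hy, hz, hd, Set.mem_ofPred_eq]
        · exact one_lt_pow₀ hp (by omega)
        · exact hx.trans_lt (hpow (by omega))
        · exact hpow (by omega)
        · refine (pow_le_pow_left₀ (norm_nonneg x) hx 2).trans_lt ?_
          rw [← pow_mul]
          exact hpow (by omega)
        · exact le_rfl
        · ring
      · exact hq.1
  · rintro ⟨x, y, z⟩ ⟨-, hy, -⟩ ⟨-, hy'⟩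
    exact (hpow (by omega)).not_ge (hy'.trans_eq hy)

theorem setIntegral_cellRegion (hμ : IsNormalizedHaar μ) (hθ : IsStandardCharacter θ)
    (hW : IsWhittaker θ W)
    (hF : IntegrableOn (integrand θ W ν) (region p) (μ.prod (μ.prod μ))) :
    ∫ q in cellRegion p, integrand θ W ν q ∂(μ.prod (μ.prod μ)) =
      (((p : ℝ) ^ 1 : ℝ) : ℂ) ^ (-2 - ν) * W 1 * (p - 1) +
      (((p : ℝ) ^ 2 : ℝ) : ℂ) ^ (-2 - ν) * W 1 * ((p : ℂ) ^ 2 * (p - 1)) -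
      (((p : ℝ) ^ 3 : ℝ) : ℂ) ^ (-2 - ν) * W 1 * (p : ℂ) ^ 3 := by
  have hp := one_lt_p (p := p)
  have hU : ⋃ k, conductorRegion p (k + 2) ⊆ region p :=
    Set.iUnion_subset fun k => conductorRegion_subset _
  rw [setIntegral_eq_add (S₁ := diagonalRegion p)
      (S₂ := conductorRegion p 1 ∪ ⋃ k, conductorRegion p (k + 2)) ?_ ?_
      ((measurableSet_conductorRegion 1).union
        (MeasurableSet.iUnion fun k => measurableSet_conductorRegion _))
      (hF.mono_set cellRegion_subset),
    setIntegral_union ?_ (MeasurableSet.iUnion fun k => measurableSet_conductorRegion _)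
      (hF.mono_set (conductorRegion_subset 1)) (hF.mono_set hU),
    setIntegral_diagonalRegion hμ hθ hW hF, setIntegral_conductorRegion_one hμ hθ hW hF,
    setIntegral_eq_zero_of_iUnion (fun k => measurableSet_conductorRegion _)
      (fun k l h => disjoint_conductorRegion (by simpa using h)) (hF.mono_set hU)
      (setIntegral_conductorRegion_add_two hμ hθ hW hF)]
  · ring
  · exact Set.disjoint_iUnion_right.2 fun k => disjoint_conductorRegion (by omega)
  · rintro ⟨x, y, z⟩
    rw [mem_diagonalRegion_iff]
    refine ⟨fun hq => ?_, ?_⟩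
    · by_cases hy : ‖y‖ ^ 2 ≤ ‖x * y + z‖
      · exact Or.inl ⟨hq, hy⟩
      right
      have hd : 0 < ‖x * y + z‖ := norm_pos_iff.2 (ne_zero_of_mem_cellRegion hq).2
      obtain ⟨n, hn⟩ := exists_norm_eq_pow_succ (x := y ^ 2 / (x * y + z)) (by
        rw [norm_div, norm_pow, one_lt_div hd]
        exact not_le.1 hy)
      rw [norm_div, norm_pow, div_eq_iff hd.ne'] at hn
      cases n with
      | zero => exact Or.inl ⟨hq, hn⟩
      | succ k => exact Or.inr (Set.mem_iUnion.2 ⟨k, hq, hn⟩)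
    · rintro (hq | hq | hq)
      · exact hq.1
      · exact hq.1
      · obtain ⟨k, hk⟩ := Set.mem_iUnion.1 hq
        exact hk.1
  · have key : ∀ n, n ≠ 0 → ∀ q ∈ diagonalRegion p, q ∉ conductorRegion p n := by
      rintro n hn ⟨x, y, z⟩ hq hq'
      have h1 := (mem_diagonalRegion_iff.1 hq).2
      have h2 : ‖y‖ ^ 2 = (p : ℝ) ^ n * ‖x * y + z‖ := hq'.2
      have hd : 0 < ‖x * y + z‖ := norm_pos_iff.2 (ne_zero_of_mem_cellRegion hq'.1).2
      rw [h2] at h1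
      exact (lt_mul_of_one_lt_left hd (one_lt_pow₀ hp hn)).not_ge h1
    rintro q hq (h | h)
    · exact key 1 one_ne_zero q hq h
    · obtain ⟨k, hk⟩ := Set.mem_iUnion.1 h
      exact key (k + 2) (by omega) q hq hk

end LargeCell

section ZetaIntegral

theorem cpow_pow_neg_two_sub (n : ℕ) (ν : ℂ) :
    (((p : ℝ) ^ n : ℝ) : ℂ) ^ (-2 - ν) = ((p : ℂ) ^ (2 * n))⁻¹ * ((p : ℂ) ^ (-ν)) ^ n := by
  have hp : (p : ℂ) ≠ 0 := Nat.cast_ne_zero.2 (Fact.out : p.Prime).ne_zero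
  have h1 : ((p : ℂ) ^ n) ^ (-ν) = ((p : ℂ) ^ (-ν)) ^ n := by
    rw [← Complex.natCast_cpow_natCast_mul, Complex.cpow_nat_mul]
  push_cast
  rw [sub_eq_add_neg, Complex.cpow_add _ _ (pow_ne_zero n hp), h1, Complex.cpow_neg,
    show (2 : ℂ) = ((2 : ℕ) : ℂ) by norm_num, Complex.cpow_natCast, ← pow_mul, mul_comm n 2]

theorem cpow_neg_sub_mul (a n : ℕ) (ν : ℂ) :
    (p : ℂ) ^ (-a - n * ν) = ((p : ℂ) ^ a)⁻¹ * ((p : ℂ) ^ (-ν)) ^ n := by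
  have hp : (p : ℂ) ≠ 0 := Nat.cast_ne_zero.2 (Fact.out : p.Prime).ne_zero
  rw [sub_eq_add_neg, Complex.cpow_add _ _ hp, Complex.cpow_neg, Complex.cpow_natCast,
    ← mul_neg, Complex.cpow_nat_mul]

variable [MeasurableSpace ℚ_[p]] [BorelSpace ℚ_[p]] {μ : Measure ℚ_[p]} [SigmaFinite μ]
variable {θ : ℚ_[p] → ℂ} {W : Matrix (Fin 2) (Fin 2) ℚ_[p] → ℂ} {ν : ℂ}

theorem setIntegral_region (hμ : IsNormalizedHaar μ) (hθ : IsStandardCharacter θ)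
    (hW : IsWhittaker θ W)
    (hF : IntegrableOn (integrand θ W ν) (region p) (μ.prod (μ.prod μ))) :
    ∫ q in region p, integrand θ W ν q ∂(μ.prod (μ.prod μ)) =
      W 1 * ((1 - (p : ℂ)⁻¹) * ((p : ℂ) ^ (-1 - ν) + (p : ℂ) ^ (-1 - 2 * ν)) -
          (p : ℂ) ^ (-3 - 3 * ν)) -
        W !![0, 1; 1, 0] * ((p : ℂ) ^ (-1 - 2 * ν) * (1 - (p : ℂ)⁻¹)) := by
  have hp : (p : ℂ) ≠ 0 := Nat.cast_ne_zero.2 (Fact.out : p.Prime).ne_zero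
  rw [setIntegral_eq_of_subset_of_forall_sdiff_eq_zero measurableSet_region
      (Set.union_subset cellRegion_subset antiRegion_subset)
      (fun q hq => integrand_eq_zero hθ hW ν hq.1 (fun h => hq.2 (Or.inl h))
        (fun h => hq.2 (Or.inr h))),
    setIntegral_union ?_ measurableSet_antiRegion (hF.mono_set cellRegion_subset)
      (hF.mono_set antiRegion_subset),
    setIntegral_cellRegion hμ hθ hW hF, setIntegral_antiRegion hμ hθ hW hF,
    cpow_pow_neg_two_sub, cpow_pow_neg_two_sub, cpow_pow_neg_two_sub]
  · have h1 := cpow_neg_sub_mul (p := p) 1 1 ν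
    have h2 := cpow_neg_sub_mul (p := p) 1 2 ν
    have h3 := cpow_neg_sub_mul (p := p) 3 3 ν
    push_cast at h1 h2 h3
    rw [one_mul] at h1
    rw [h1, h2, h3]
    field_simp
    ring
  · refine Set.disjoint_left.2 ?_
    rintro ⟨x, y, z⟩ hq hq'
    exact hq.2.2.2.1.not_ge (norm_add_le_of_le (norm_le_sq_of_mem_antiRegion hq') hq'.2.1)

end ZetaIntegral

end PadicWhittaker

/-- With `θ` a standard additive character, `μ` the Haar measure on
`ℚ_p` giving `ℤ_p` measure 1, and `W` a `Γ₀(p)`-invariant Whittaker-type function on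
`GL₂(ℚ_p)`, for `Re(ν)` large enough the function
`(x,y,z) ↦ |z|^{−2−ν}·W([[xy−z, −y²],[−x², xy+z]])·θ(−x)` is absolutely integrable on
`R = {v_p(z) < min{0, v_p(x), v_p(y)}}` and its integral equals
`W(1)·((1−p⁻¹)(p^{−1−ν}+p^{−1−2ν}) − p^{−3−3ν}) − W(w)·p^{−1−2ν}(1−p⁻¹)`. -/
theorem stmt_12 (p : ℕ) [Fact p.Prime]
    [MeasurableSpace ℚ_[p]] [BorelSpace ℚ_[p]]
    (μ : Measure ℚ_[p]) [SigmaFinite μ]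
    (hμ_inv : ∀ a : ℚ_[p], μ.map (a + ·) = μ)
    (hμ_norm : μ {x : ℚ_[p] | ‖x‖ ≤ 1} = 1)
    (θ : ℚ_[p] → ℂ) (hθ_cont : Continuous θ)
    (hθ_add : ∀ a b : ℚ_[p], θ (a + b) = θ a * θ b)
    (hθ_unit : ∀ a : ℚ_[p], ‖θ a‖ = 1)
    (hθ_triv : ∀ a : ℚ_[p], ‖a‖ ≤ 1 → θ a = 1)
    (hθ_nontriv : ∃ a : ℚ_[p], ‖a‖ ≤ (p : ℝ) ∧ θ a ≠ 1)
    (W : Matrix (Fin 2) (Fin 2) ℚ_[p] → ℂ)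
    (hW_cont : ContinuousOn W {g | g.det ≠ 0})
    (hW_left : ∀ (t : ℚ_[p]) (g : Matrix (Fin 2) (Fin 2) ℚ_[p]), g.det ≠ 0 →
      W (!![1, t; 0, 1] * g) = θ t * W g)
    (hW_right : ∀ (g : Matrix (Fin 2) (Fin 2) ℚ_[p]), g.det ≠ 0 → ∀ γ ∈ Gamma0 p,
      W (g * γ) = W g)
    (hW_center : ∀ (lam : ℚ_[p]) (g : Matrix (Fin 2) (Fin 2) ℚ_[p]), lam ≠ 0 →
      g.det ≠ 0 → W (lam • g) = W g)
    (hW_bound : ∃ C : ℝ, 0 < C ∧ ∃ A : ℝ, 0 ≤ A ∧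
      ∀ g : Matrix (Fin 2) (Fin 2) ℚ_[p], g.det ≠ 0 →
        ‖W g‖ ≤ C * ((max (max ‖g 0 0‖ ‖g 0 1‖) (max ‖g 1 0‖ ‖g 1 1‖) *
          max (max ‖g⁻¹ 0 0‖ ‖g⁻¹ 0 1‖) (max ‖g⁻¹ 1 0‖ ‖g⁻¹ 1 1‖)) ^ A)) :
    ∃ ν₀ : ℝ, ∀ ν : ℂ, ν₀ < ν.re →
      IntegrableOn
        (fun q : ℚ_[p] × ℚ_[p] × ℚ_[p] =>
          (‖q.2.2‖ : ℂ) ^ (-2 - ν) *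
            W !![q.1 * q.2.1 - q.2.2, -(q.2.1 ^ 2); -(q.1 ^ 2), q.1 * q.2.1 + q.2.2] *
            θ (-q.1))
        {q : ℚ_[p] × ℚ_[p] × ℚ_[p] |
          Padic.addValuation q.2.2 <
            min 0 (min (Padic.addValuation q.1) (Padic.addValuation q.2.1))}
        (μ.prod (μ.prod μ)) ∧
      ∫ q in {q : ℚ_[p] × ℚ_[p] × ℚ_[p] |
          Padic.addValuation q.2.2 <
            min 0 (min (Padic.addValuation q.1) (Padic.addValuation q.2.1))},
          (‖q.2.2‖ : ℂ) ^ (-2 - ν) *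
            W !![q.1 * q.2.1 - q.2.2, -(q.2.1 ^ 2); -(q.1 ^ 2), q.1 * q.2.1 + q.2.2] *
            θ (-q.1) ∂(μ.prod (μ.prod μ)) =
        W 1 * ((1 - (p : ℂ)⁻¹) * ((p : ℂ) ^ (-1 - ν) + (p : ℂ) ^ (-1 - 2 * ν)) -
            (p : ℂ) ^ (-3 - 3 * ν)) -
          W !![0, 1; 1, 0] * ((p : ℂ) ^ (-1 - 2 * ν) * (1 - (p : ℂ)⁻¹)) := by
  obtain ⟨C, hC, A, hA, hbound⟩ := hW_bound
  have hμ : PadicWhittaker.IsNormalizedHaar μ := ⟨hμ_inv, hμ_norm⟩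
  have hθ : PadicWhittaker.IsStandardCharacter θ :=
    ⟨hθ_cont, hθ_add, hθ_unit, hθ_triv, hθ_nontriv⟩
  have hW : PadicWhittaker.IsWhittaker θ W := ⟨hW_left, hW_right, hW_center⟩
  refine ⟨1 + 2 * A, fun ν hν => ?_⟩
  rw [PadicWhittaker.setOf_addValuation_lt_eq_region]
  have hF := PadicWhittaker.integrableOn_integrand hμ hθ hW_cont hC.le hA hbound hν
  exact ⟨hF, PadicWhittaker.setIntegral_region hμ hθ hW hF⟩
end

section
/- Let p be a prime and θ, W as below. Let R = { (x,y,z) ∈ ℚ_p³ : v_p(y) < min{0, v_p(x), v_p(z) + 1} }. Then there exists ν₀ ∈ ℝ (depending on W) such that for every ν ∈ ℂ with Re(ν) > ν₀, the function (x,y,z) ↦ |y|^{−2−ν} · W([[0, −y],[y⁻¹, x + z/y]]) · θ(−x) is absolutely integrable on R and ∫_R |y|^{−2−ν} W([[0, −y],[y⁻¹, x + z/y]]) θ(−x) dx dy dz = p^{−1−2ν}·W([[p²,0],[0,1]]) − (1 − p⁻¹)·p^{−1−ν}·W(1), where 1 denotes the identity matrix of GL₂(ℚ_p). -/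
open Matrix MeasureTheory

section PadicBalls

open Metric Set

variable {p : ℕ} [Fact p.Prime]

lemma one_lt_prime_cast (p : ℕ) [hp : Fact p.Prime] : (1 : ℝ) < p :=
  mod_cast hp.out.one_lt

/-- A closed ball of radius `p ^ (n + 1)` in `ℚ_p` is the union of `p` translates of the closed ball
of radius `p ^ n`. -/
lemma Padic.closedBall_zpow_succ (n : ℤ) :
    closedBall (0 : ℚ_[p]) ((p : ℝ) ^ (n + 1)) =
      ⋃ i ∈ Finset.range p, closedBall ((i : ℚ_[p]) * (p : ℚ_[p]) ^ (-(n + 1))) ((p : ℝ) ^ n) := by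
  have hp := one_lt_prime_cast p
  have hp0 : (0 : ℝ) < p := by linarith
  have hq : (p : ℚ_[p]) ≠ 0 := mod_cast (Fact.out : p.Prime).ne_zero
  have hfac (x : ℚ_[p]) (i : ℕ) : x - i * (p : ℚ_[p]) ^ (-(n + 1)) =
      (x * (p : ℚ_[p]) ^ (n + 1) - i) * (p : ℚ_[p]) ^ (-(n + 1)) := by
    rw [sub_mul, mul_assoc, ← zpow_add₀ hq]; simp
  ext x
  simp only [mem_iUnion, Finset.mem_range, mem_closedBall, dist_eq_norm,
    exists_prop]
  constructor
  · intro hx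
    rw [sub_zero] at hx
    have hx' : ‖x * (p : ℚ_[p]) ^ (n + 1)‖ ≤ 1 := by
      rw [norm_mul, Padic.norm_p_zpow, _root_.zpow_neg, ← div_eq_mul_inv]
      exact div_le_one_of_le₀ hx (by positivity)
    obtain ⟨i, hi, him⟩ := PadicInt.exists_mem_range (⟨_, hx'⟩ : ℤ_[p])
    refine ⟨i, hi, ?_⟩
    rw [IsLocalRing.mem_maximalIdeal, PadicInt.mem_nonunits, PadicInt.norm_def] at him
    rw [hfac, Padic.norm_le_pow_iff_norm_lt_pow_add_one, norm_mul, Padic.norm_p_zpow, neg_neg]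
    exact mul_lt_of_lt_one_left (by positivity) him
  · rintro ⟨i, -, hi⟩
    rw [sub_zero, ← sub_add_cancel x (i * (p : ℚ_[p]) ^ (-(n + 1)))]
    refine (Padic.nonarchimedean _ _).trans (max_le (hi.trans ?_) ?_)
    · exact zpow_le_zpow_right₀ hp.le (by lia)
    · rw [norm_mul, Padic.norm_p_zpow, neg_neg]
      refine mul_le_of_le_one_left (by positivity) ?_
      exact mod_cast Padic.norm_int_le_one (p := p) i

lemma Padic.sphere_zpow_eq_diff (n : ℤ) :
    sphere (0 : ℚ_[p]) ((p : ℝ) ^ n) =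
      closedBall 0 ((p : ℝ) ^ n) \ closedBall 0 ((p : ℝ) ^ (n - 1)) := by
  ext x
  simp [Padic.norm_le_pow_iff_norm_lt_pow_add_one x (n - 1), le_antisymm_iff]

variable [MeasurableSpace ℚ_[p]] [BorelSpace ℚ_[p]] {μ : Measure ℚ_[p]} [μ.IsAddLeftInvariant]

lemma Padic.measure_closedBall_zpow_succ (n : ℤ) :
    μ (closedBall 0 ((p : ℝ) ^ (n + 1))) = p * μ (closedBall 0 ((p : ℝ) ^ n)) := by
  have hp := one_lt_prime_cast p
  rw [Padic.closedBall_zpow_succ, measure_biUnion_finset _ fun _ _ => measurableSet_closedBall]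
  · have (a : ℚ_[p]) : μ (closedBall a ((p : ℝ) ^ n)) = μ (closedBall 0 ((p : ℝ) ^ n)) := by
      rw [← measure_preimage_add μ a (closedBall a _)]
      congr 1
      ext x
      simp
    simp [this]
  · intro i hi j hj hij
    refine (IsUltrametricDist.closedBall_eq_or_disjoint _ _ _).resolve_left fun h => ?_
    have hmem := h ▸ mem_closedBall_self (x := (i : ℚ_[p]) * (p : ℚ_[p]) ^ (-(n + 1)))
      (ε := (p : ℝ) ^ n) (by positivity)
    have hn : ‖(((i : ℤ) - j : ℤ) : ℚ_[p])‖ < 1 := by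
      rw [mem_closedBall, dist_eq_norm, ← sub_mul, norm_mul, Padic.norm_p_zpow, neg_neg,
        zpow_add_one₀ (by positivity)] at hmem
      have h1 : ‖(i : ℚ_[p]) - j‖ * p ≤ 1 := by
        have : (0 : ℝ) < (p : ℝ) ^ n := by positivity
        nlinarith
      push_cast
      nlinarith [norm_nonneg ((i : ℚ_[p]) - j)]
    rw [Padic.norm_intCast_lt_one_iff] at hn
    simp only [Finset.coe_range, mem_Iio] at hi hj
    obtain ⟨c, hc⟩ := hn
    have : c = 0 := by
      by_contra hc0
      have := Int.eq_zero_of_abs_lt_dvd ⟨c, hc⟩ (by rw [abs_lt]; constructor <;> lia)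
      lia
    subst this
    lia

/-- With the normalization `μ ℤ_p = 1`, balls of radius `p ^ n` have measure `p ^ n`. -/
lemma Padic.measure_closedBall_zpow (hμ : μ (closedBall 0 1) = 1) (n : ℤ) :
    μ (closedBall 0 ((p : ℝ) ^ n)) = (p : ENNReal) ^ n := by
  have hp0 : (p : ENNReal) ≠ 0 := mod_cast (Fact.out : p.Prime).ne_zero
  have hpt : (p : ENNReal) ≠ ⊤ := ENNReal.natCast_ne_top p
  induction n with
  | zero => simpa using hμ
  | succ n ih => rw [Padic.measure_closedBall_zpow_succ, ih, ENNReal.zpow_add hp0 hpt, zpow_one,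
      mul_comm]
  | pred n ih =>
    have h := Padic.measure_closedBall_zpow_succ (μ := μ) (-(n : ℤ) - 1)
    rw [sub_add_cancel, ih] at h
    refine (ENNReal.mul_right_inj hp0 hpt).1 ?_
    have hz := ENNReal.zpow_add hp0 hpt (-(n : ℤ) - 1) 1
    rw [sub_add_cancel, zpow_one] at hz
    rw [← h, mul_comm, ← hz]

lemma Padic.measureReal_closedBall_zpow (hμ : μ (closedBall 0 1) = 1) (n : ℤ) :
    μ.real (closedBall 0 ((p : ℝ) ^ n)) = (p : ℝ) ^ n := by
  rw [measureReal_def, Padic.measure_closedBall_zpow hμ]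
  cases n <;> simp

lemma Padic.measure_closedBall_zpow_lt_top (hμ : μ (closedBall 0 1) = 1) (n : ℤ) :
    μ (closedBall 0 ((p : ℝ) ^ n)) < ⊤ := by
  rw [Padic.measure_closedBall_zpow hμ]
  exact ENNReal.zpow_lt_top (mod_cast (Fact.out : p.Prime).ne_zero) (ENNReal.natCast_ne_top p) _

/-- Orthogonality: the integral over a ball of an additive character of `ℚ_p` of conductor `ℤ_p`. -/
lemma Padic.integral_closedBall_addChar (hμ : μ (closedBall 0 1) = 1)
    {ψ : AddChar ℚ_[p] ℂ} (hψ : ∀ a, ‖a‖ ≤ 1 → ψ a = 1) (hψ' : ∃ a, ‖a‖ ≤ (p : ℝ) ∧ ψ a ≠ 1)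
    (c : ℚ_[p]) (n : ℤ) :
    ∫ x in closedBall 0 ((p : ℝ) ^ n), ψ (c * x) ∂μ =
      if ‖c‖ ≤ (p : ℝ) ^ (-n) then (p : ℂ) ^ n else 0 := by
  have hp := one_lt_prime_cast p
  have hp0 : (0 : ℝ) < p := by linarith
  split_ifs with hc
  · have : EqOn (fun x => ψ (c * x)) 1 (closedBall 0 ((p : ℝ) ^ n)) := fun x hx => by
      refine hψ _ ?_
      rw [mem_closedBall_zero_iff] at hx
      calc ‖c * x‖ ≤ (p : ℝ) ^ (-n) * (p : ℝ) ^ n := by rw [norm_mul]; gcongr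
        _ = 1 := by rw [← zpow_add₀ hp0.ne']; simp
    rw [setIntegral_congr_fun measurableSet_closedBall this]
    simp [Padic.measureReal_closedBall_zpow hμ]
  · obtain ⟨a, ha, hψa⟩ := hψ'
    rw [Padic.norm_le_pow_iff_norm_lt_pow_add_one, not_lt] at hc
    have hc0 : c ≠ 0 := by
      rintro rfl
      rw [norm_zero] at hc
      exact absurd hc (not_le.2 (by positivity))
    have hac : ‖a / c‖ ≤ (p : ℝ) ^ n := by
      rw [norm_div, div_le_iff₀ (norm_pos_iff.2 hc0)]
      calc ‖a‖ ≤ p := ha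
        _ = (p : ℝ) ^ n * (p : ℝ) ^ (-n + 1) := by rw [← zpow_add₀ hp0.ne']; simp
        _ ≤ _ := by gcongr
    have hshift := integral_add_left_eq_self (μ := μ)
      ((closedBall 0 ((p : ℝ) ^ n)).indicator fun x => ψ (c * x)) (a / c)
    have hind (x : ℚ_[p]) : (closedBall 0 ((p : ℝ) ^ n)).indicator (fun x => ψ (c * x)) (a / c + x)
        = ψ a * (closedBall 0 ((p : ℝ) ^ n)).indicator (fun x => ψ (c * x)) x := by
      have hiff : a / c + x ∈ closedBall (0 : ℚ_[p]) ((p : ℝ) ^ n) ↔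
          x ∈ closedBall (0 : ℚ_[p]) ((p : ℝ) ^ n) := by
        simp only [mem_closedBall_zero_iff]
        refine ⟨fun h => ?_, fun h => (Padic.nonarchimedean _ _).trans (max_le hac h)⟩
        have hx := Padic.nonarchimedean (a / c + x) (-(a / c))
        rw [norm_neg, add_neg_cancel_comm] at hx
        exact hx.trans (max_le h hac)
      by_cases hx : x ∈ closedBall (0 : ℚ_[p]) ((p : ℝ) ^ n)
      · rw [indicator_of_mem hx, indicator_of_mem (hiff.2 hx), mul_add, mul_div_cancel₀ _ hc0,
          AddChar.map_add_eq_mul]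
      · rw [indicator_of_notMem hx, indicator_of_notMem (mt hiff.1 hx), mul_zero]
    simp_rw [hind, integral_const_mul, integral_indicator measurableSet_closedBall] at hshift
    exact (mul_left_eq_self₀.1 hshift).resolve_left hψa

/-- The integral over a sphere of an additive character of `ℚ_p` of conductor `ℤ_p`. -/
lemma Padic.integral_sphere_addChar (hμ : μ (closedBall 0 1) = 1)
    {ψ : AddChar ℚ_[p] ℂ} (hψc : Continuous ψ) (hψu : ∀ a, ‖ψ a‖ = 1)
    (hψ : ∀ a, ‖a‖ ≤ 1 → ψ a = 1) (hψ' : ∃ a, ‖a‖ ≤ (p : ℝ) ∧ ψ a ≠ 1)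
    (c : ℚ_[p]) (n : ℤ) :
    ∫ x in sphere 0 ((p : ℝ) ^ n), ψ (c * x) ∂μ =
      (if ‖c‖ ≤ (p : ℝ) ^ (-n) then (p : ℂ) ^ n else 0) -
        if ‖c‖ ≤ (p : ℝ) ^ (-(n - 1)) then (p : ℂ) ^ (n - 1) else 0 := by
  have hp := one_lt_prime_cast p
  rw [Padic.sphere_zpow_eq_diff, setIntegral_sdiff measurableSet_closedBall _
    (closedBall_subset_closedBall (zpow_le_zpow_right₀ hp.le (by lia))),
    Padic.integral_closedBall_addChar hμ hψ hψ', Padic.integral_closedBall_addChar hμ hψ hψ']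
  exact Measure.integrableOn_of_bounded (M := 1) (Padic.measure_closedBall_zpow_lt_top hμ n).ne
    (by fun_prop) (.of_forall fun x => (hψu _).le)

end PadicBalls

section Whittaker

open Metric Set

variable {p : ℕ} [Fact p.Prime]

/-- The matrix `[[0, -y], [y⁻¹, x]]`. -/
noncomputable def bigCellMatrix (y x : ℚ_[p]) : Matrix (Fin 2) (Fin 2) ℚ_[p] :=
  !![0, -y; y⁻¹, x]

lemma det_bigCellMatrix {y : ℚ_[p]} (hy : y ≠ 0) (x : ℚ_[p]) : (bigCellMatrix y x).det = 1 := by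
  simp [bigCellMatrix, Matrix.det_fin_two, hy]

lemma inv_bigCellMatrix {y : ℚ_[p]} (hy : y ≠ 0) (x : ℚ_[p]) :
    (bigCellMatrix y x)⁻¹ = !![x, y; -y⁻¹, 0] := by
  rw [Matrix.inv_def, det_bigCellMatrix hy]
  simp [bigCellMatrix, Matrix.adjugate_fin_two]

lemma lowerUnipotent_mem_Gamma0 {c : ℚ_[p]} (hc : ‖c‖ ≤ (p : ℝ)⁻¹) : !![1, 0; c, 1] ∈ Gamma0 p := by
  have hc1 : ‖c‖ ≤ 1 := hc.trans (inv_le_one_of_one_le₀ (one_lt_prime_cast p).le)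
  refine ⟨fun i j => ?_, by simp [Matrix.det_fin_two], by simpa using hc⟩
  fin_cases i <;> fin_cases j <;> simp [hc1]

lemma upperUnipotent_mem_Gamma0 {t : ℚ_[p]} (ht : ‖t‖ ≤ 1) : !![1, t; 0, 1] ∈ Gamma0 p := by
  refine ⟨fun i j => ?_, by simp [Matrix.det_fin_two], by simp⟩
  fin_cases i <;> fin_cases j <;> simp [ht]

lemma diagonalUnit_mem_Gamma0 {u : ℚ_[p]} (hu : ‖u‖ = 1) : !![u, 0; 0, 1] ∈ Gamma0 p := by
  refine ⟨fun i j => ?_, by simp [Matrix.det_fin_two, hu], by simp⟩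
  fin_cases i <;> fin_cases j <;> simp [hu]

lemma Padic.le_norm_of_one_lt {y : ℚ_[p]} (hy : 1 < ‖y‖) : (p : ℝ) ≤ ‖y‖ := by
  by_contra! h
  have := (Padic.norm_le_pow_iff_norm_lt_pow_add_one y 0).2 (by simpa using h)
  rw [zpow_zero] at this
  exact absurd this (not_le.2 hy)

variable {ψ : AddChar ℚ_[p] ℂ} {W : Matrix (Fin 2) (Fin 2) ℚ_[p] → ℂ}

/-- Near the Weyl element the values of a `Γ₀(p)`-invariant Whittaker function on the big cell
vanish. -/
lemma whittaker_bigCellMatrix_eq_zero (hψ' : ∃ a, ‖a‖ ≤ (p : ℝ) ∧ ψ a ≠ 1)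
    (hW_left : ∀ (t : ℚ_[p]) (g : Matrix (Fin 2) (Fin 2) ℚ_[p]), g.det ≠ 0 →
      W (!![1, t; 0, 1] * g) = ψ t * W g)
    (hW_right : ∀ (g : Matrix (Fin 2) (Fin 2) ℚ_[p]), g.det ≠ 0 → ∀ γ ∈ Gamma0 p,
      W (g * γ) = W g)
    {x y : ℚ_[p]} (hy : 1 < ‖y‖) (hxy : ‖x * y‖ ≤ 1) : W (bigCellMatrix y x) = 0 := by
  have hp := one_lt_prime_cast p
  have hy0 : y ≠ 0 := norm_pos_iff.1 (by linarith)
  have hdet : (bigCellMatrix y 0).det ≠ 0 := by simp [det_bigCellMatrix hy0]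
  have hx : bigCellMatrix y x = bigCellMatrix y 0 * !![1, x * y; 0, 1] := by
    ext i j
    fin_cases i <;> fin_cases j <;> simp [bigCellMatrix]
    field_simp
  rw [hx, hW_right _ hdet _ (upperUnipotent_mem_Gamma0 hxy)]
  obtain ⟨a, ha, hψa⟩ := hψ'
  have hpy := Padic.le_norm_of_one_lt hy
  have hγ : !![1, 0; -(a / y ^ 2), 1] ∈ Gamma0 p := lowerUnipotent_mem_Gamma0 <| by
    rw [norm_neg, norm_div, norm_pow, div_le_iff₀ (by positivity)]
    calc ‖a‖ ≤ p := ha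
      _ = (p : ℝ)⁻¹ * p ^ 2 := by field_simp
      _ ≤ _ := by gcongr
  have hcomm : bigCellMatrix y 0 * !![1, 0; -(a / y ^ 2), 1] =
      !![1, a; 0, 1] * bigCellMatrix y 0 := by
    ext i j
    fin_cases i <;> fin_cases j <;> simp [bigCellMatrix]
    field_simp
  have h := hW_right _ hdet _ hγ
  rw [hcomm, hW_left _ _ hdet] at h
  exact (mul_left_eq_self₀.1 h).resolve_left hψa

/-- Away from the Weyl element, the Iwasawa decomposition computes a Whittaker function on the big
cell. -/
lemma whittaker_bigCellMatrix
    (hW_left : ∀ (t : ℚ_[p]) (g : Matrix (Fin 2) (Fin 2) ℚ_[p]), g.det ≠ 0 →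
      W (!![1, t; 0, 1] * g) = ψ t * W g)
    (hW_right : ∀ (g : Matrix (Fin 2) (Fin 2) ℚ_[p]), g.det ≠ 0 → ∀ γ ∈ Gamma0 p,
      W (g * γ) = W g)
    (hW_center : ∀ (lam : ℚ_[p]) (g : Matrix (Fin 2) (Fin 2) ℚ_[p]), lam ≠ 0 →
      g.det ≠ 0 → W (lam • g) = W g)
    {x y : ℚ_[p]} (hxy : 1 < ‖x * y‖) :
    W (bigCellMatrix y x) = ψ (-x⁻¹ * y) * W !![(x ^ 2)⁻¹, 0; 0, 1] := by
  have hp := one_lt_prime_cast p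
  have hxy0 : x * y ≠ 0 := norm_pos_iff.1 (by linarith)
  obtain ⟨hx0, hy0⟩ := mul_ne_zero_iff.1 hxy0
  have hdet : (!![(x ^ 2)⁻¹, 0; 0, 1] : Matrix (Fin 2) (Fin 2) ℚ_[p]).det ≠ 0 := by
    simp [Matrix.det_fin_two, hx0]
  have hγ : !![1, 0; (x * y)⁻¹, 1] ∈ Gamma0 p := lowerUnipotent_mem_Gamma0 <| by
    rw [norm_inv]
    exact inv_anti₀ (by linarith) (Padic.le_norm_of_one_lt hxy)
  have hM : bigCellMatrix y x =
      x • (!![1, -x⁻¹ * y; 0, 1] * !![(x ^ 2)⁻¹, 0; 0, 1] * !![1, 0; (x * y)⁻¹, 1]) := by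
    ext i j
    fin_cases i <;> fin_cases j <;> simp [bigCellMatrix] <;> field_simp
    simp
  have hdet' : (!![1, -x⁻¹ * y; 0, 1] * !![(x ^ 2)⁻¹, 0; 0, 1] :
      Matrix (Fin 2) (Fin 2) ℚ_[p]).det ≠ 0 := by
    simp [Matrix.det_fin_two, hx0]
  rw [hM, hW_center _ _ hx0 (by rw [Matrix.det_mul]; simpa [Matrix.det_fin_two] using hx0),
    hW_right _ hdet' _ hγ, hW_left _ _ hdet]

lemma whittaker_diagonal_congr
    (hW_right : ∀ (g : Matrix (Fin 2) (Fin 2) ℚ_[p]), g.det ≠ 0 → ∀ γ ∈ Gamma0 p,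
      W (g * γ) = W g)
    {a b : ℚ_[p]} (ha : a ≠ 0) (hab : ‖a‖ = ‖b‖) : W !![b, 0; 0, 1] = W !![a, 0; 0, 1] := by
  have hu : ‖b / a‖ = 1 := by rw [norm_div, hab, div_self (by rwa [← hab, norm_ne_zero_iff])]
  rw [← hW_right !![a, 0; 0, 1] (by simpa [Matrix.det_fin_two] using ha) _
    (diagonalUnit_mem_Gamma0 hu)]
  congr 1
  ext i j
  fin_cases i <;> fin_cases j <;> simp
  field_simp

lemma norm_whittaker_bigCellMatrix_le {C A : ℝ} (hA : 0 ≤ A) (hC : 0 < C)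
    (hW_bound : ∀ g : Matrix (Fin 2) (Fin 2) ℚ_[p], g.det ≠ 0 →
      ‖W g‖ ≤ C * ((max (max ‖g 0 0‖ ‖g 0 1‖) (max ‖g 1 0‖ ‖g 1 1‖) *
        max (max ‖g⁻¹ 0 0‖ ‖g⁻¹ 0 1‖) (max ‖g⁻¹ 1 0‖ ‖g⁻¹ 1 1‖)) ^ A))
    {x y : ℚ_[p]} (hy : 1 ≤ ‖y‖) (hxy : ‖x‖ ≤ ‖y‖) :
    ‖W (bigCellMatrix y x)‖ ≤ C * (‖y‖ ^ 2) ^ A := by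
  have hy0 : y ≠ 0 := norm_pos_iff.1 (by linarith)
  have hinv : ‖y‖⁻¹ ≤ ‖y‖ := (inv_le_one_of_one_le₀ hy).trans hy
  refine (hW_bound _ (by simp [det_bigCellMatrix hy0])).trans ?_
  rw [inv_bigCellMatrix hy0, pow_two]
  gcongr <;> simp [bigCellMatrix, hxy, hinv]

lemma continuousOn_whittaker_bigCellMatrix {X : Type*} [TopologicalSpace X]
    (hW_cont : ContinuousOn W {g | g.det ≠ 0}) {f g : X → ℚ_[p]} {s : Set X}
    (hf : ContinuousOn f s) (hg : ContinuousOn g s) (hf0 : ∀ x ∈ s, f x ≠ 0) :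
    ContinuousOn (fun x => W (bigCellMatrix (f x) (g x))) s := by
  refine hW_cont.comp (f := fun x => bigCellMatrix (f x) (g x)) ?_
    fun x hx => by simp [det_bigCellMatrix (hf0 x hx)]
  refine continuousOn_pi.2 fun i => continuousOn_pi.2 fun j => ?_
  fin_cases i <;> fin_cases j
  · exact continuousOn_const
  · exact hf.neg
  · exact hf.inv₀ hf0
  · exact hg

variable (p) in
/-- The set of `(x, y, z)` with `|x| ≤ p ^ n`, `|y| = p ^ (n + 1)` and `|z| ≤ p ^ (n + 1)`. -/
def shell (n : ℤ) : Set (ℚ_[p] × ℚ_[p] × ℚ_[p]) :=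
  closedBall 0 ((p : ℝ) ^ n) ×ˢ sphere 0 ((p : ℝ) ^ (n + 1)) ×ˢ closedBall 0 ((p : ℝ) ^ (n + 1))

lemma ne_zero_of_mem_sphere_zpow {n : ℤ} {y : ℚ_[p]} (hy : y ∈ sphere 0 ((p : ℝ) ^ n)) :
    y ≠ 0 := by
  have hp := one_lt_prime_cast p
  refine norm_pos_iff.1 ?_
  rw [mem_sphere_zero_iff_norm.1 hy]
  positivity

/-- On a shell the argument `x + z / y` of the Whittaker function is bounded by `|y|`. -/
lemma norm_le_of_mem_shell {n : ℤ} (hn : 0 ≤ n) {q : ℚ_[p] × ℚ_[p] × ℚ_[p]} (hq : q ∈ shell p n) :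
    ‖q.2.2 / q.2.1‖ ≤ (p : ℝ) ^ n ∧ ‖q.1 + q.2.2 / q.2.1‖ ≤ ‖q.2.1‖ := by
  have hp := one_lt_prime_cast p
  obtain ⟨hx, hy, hz⟩ := hq
  rw [mem_closedBall_zero_iff] at hx hz
  rw [mem_sphere_zero_iff_norm] at hy
  have h1 : ‖q.2.2 / q.2.1‖ ≤ (p : ℝ) ^ n := by
    rw [norm_div, hy]
    exact (div_le_one_of_le₀ hz (by positivity)).trans (one_le_zpow₀ hp.le hn)
  refine ⟨h1, (Padic.nonarchimedean _ _).trans ((max_le hx h1).trans ?_)⟩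
  rw [hy]
  exact zpow_le_zpow_right₀ hp.le (by lia)

lemma Padic.addValuation_lt_iff {x y : ℚ_[p]} (hy : y ≠ 0) :
    Padic.addValuation y < Padic.addValuation x ↔ ‖x‖ < ‖y‖ := by
  have hp := one_lt_prime_cast p
  rcases eq_or_ne x 0 with rfl | hx
  · simp [Padic.addValuation.apply hy, hy]
  · rw [Padic.addValuation.apply hy, Padic.addValuation.apply hx, WithTop.coe_lt_coe,
      Padic.norm_eq_zpow_neg_valuation hx, Padic.norm_eq_zpow_neg_valuation hy,
      zpow_lt_zpow_iff_right₀ hp, neg_lt_neg_iff]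

lemma Padic.addValuation_lt_add_one_iff {z y : ℚ_[p]} (hy : y ≠ 0) :
    Padic.addValuation y < Padic.addValuation z + 1 ↔ ‖z‖ ≤ ‖y‖ := by
  have hp := one_lt_prime_cast p
  rcases eq_or_ne z 0 with rfl | hz
  · simp [Padic.addValuation.apply hy]
  · rw [Padic.addValuation.apply hy, Padic.addValuation.apply hz, ← WithTop.coe_one,
      ← WithTop.coe_add, WithTop.coe_lt_coe,
      Padic.norm_eq_zpow_neg_valuation hz, Padic.norm_eq_zpow_neg_valuation hy,
      zpow_le_zpow_iff_right₀ hp, neg_le_neg_iff, Int.lt_add_one_iff]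

/-- The region `v(y) < min{0, v(x), v(z) + 1}` decomposes into shells. -/
lemma iUnion_shell :
    {q : ℚ_[p] × ℚ_[p] × ℚ_[p] | Padic.addValuation q.2.1 <
      min 0 (min (Padic.addValuation q.1) (Padic.addValuation q.2.2 + 1))} =
      ⋃ n : ℕ, shell p n := by
  have hp := one_lt_prime_cast p
  ext ⟨x, y, z⟩
  rw [mem_ofPred_eq, lt_min_iff, lt_min_iff, mem_iUnion]
  simp only [shell, mem_prod, mem_closedBall_zero_iff, mem_sphere_zero_iff_norm]
  rcases eq_or_ne y 0 with rfl | hy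
  · have (n : ℕ) : (0 : ℝ) ≠ (p : ℝ) ^ ((n : ℤ) + 1) := by positivity
    simp [this]
  rw [Padic.addValuation_lt_iff hy, Padic.addValuation_lt_add_one_iff hy,
    ← (Padic.addValuation (p := p)).map_one, Padic.addValuation_lt_iff hy, norm_one]
  constructor
  · rintro ⟨h1, hx, hz⟩
    obtain ⟨m, hm⟩ : ∃ m : ℤ, ‖y‖ = (p : ℝ) ^ m := ⟨_, Padic.norm_eq_zpow_neg_valuation hy⟩
    rw [hm, one_lt_zpow_iff_right₀ hp] at h1
    obtain ⟨n, hn⟩ := Int.eq_ofNat_of_zero_le (show 0 ≤ m - 1 by lia)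
    obtain rfl : m = n + 1 := by lia
    exact ⟨n, by rwa [Padic.norm_le_pow_iff_norm_lt_pow_add_one, ← hm], hm, hm ▸ hz⟩
  · rintro ⟨n, hx, hy, hz⟩
    rw [Padic.norm_le_pow_iff_norm_lt_pow_add_one] at hx
    exact ⟨hy ▸ one_lt_zpow₀ hp (by lia), hy ▸ hx, hy ▸ hz⟩

lemma pairwise_disjoint_shell :
    Pairwise (Function.onFun Disjoint fun n : ℕ => shell p n) := fun m n hmn => by
  have hp := one_lt_prime_cast p
  refine Set.disjoint_left.2 fun q hm hn => hmn ?_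
  have h := (mem_sphere_zero_iff_norm.1 hm.2.1).symm.trans (mem_sphere_zero_iff_norm.1 hn.2.1)
  have := zpow_right_injective₀ (by linarith) hp.ne' h
  lia

variable [MeasurableSpace ℚ_[p]] [BorelSpace ℚ_[p]] {μ : Measure ℚ_[p]} [μ.IsAddLeftInvariant]

/-- Integrating a Whittaker function on the big cell over the sphere `|y| = p ^ (n + 1)`. -/
lemma integral_sphere_whittaker_bigCellMatrix (hμ : μ (closedBall 0 1) = 1)
    (hψc : Continuous ψ) (hψu : ∀ a, ‖ψ a‖ = 1)
    (hψ : ∀ a, ‖a‖ ≤ 1 → ψ a = 1) (hψ' : ∃ a, ‖a‖ ≤ (p : ℝ) ∧ ψ a ≠ 1)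
    (hW_left : ∀ (t : ℚ_[p]) (g : Matrix (Fin 2) (Fin 2) ℚ_[p]), g.det ≠ 0 →
      W (!![1, t; 0, 1] * g) = ψ t * W g)
    (hW_right : ∀ (g : Matrix (Fin 2) (Fin 2) ℚ_[p]), g.det ≠ 0 → ∀ γ ∈ Gamma0 p,
      W (g * γ) = W g)
    (hW_center : ∀ (lam : ℚ_[p]) (g : Matrix (Fin 2) (Fin 2) ℚ_[p]), lam ≠ 0 →
      g.det ≠ 0 → W (lam • g) = W g)
    {n : ℤ} (hn : 0 ≤ n) {x : ℚ_[p]} (hx : ‖x‖ ≤ (p : ℝ) ^ n) :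
    ∫ y in sphere 0 ((p : ℝ) ^ (n + 1)), W (bigCellMatrix y x) ∂μ =
      (sphere 0 ((p : ℝ) ^ n)).indicator
        (fun _ => -(p : ℂ) ^ n * W !![(p : ℚ_[p]) ^ (2 * n), 0; 0, 1]) x := by
  have hp := one_lt_prime_cast p
  have hp0 : (0 : ℝ) < p := by linarith
  have hq : (p : ℚ_[p]) ≠ 0 := mod_cast (Fact.out : p.Prime).ne_zero
  rcases le_or_gt (‖x‖ * (p : ℝ) ^ (n + 1)) 1 with hx1 | hx1
  · have hxn : x ∉ sphere (0 : ℚ_[p]) ((p : ℝ) ^ n) := fun h => by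
      rw [mem_sphere_zero_iff_norm] at h
      rw [h, ← zpow_add₀ hp0.ne'] at hx1
      exact absurd hx1 (not_le.2 (one_lt_zpow₀ hp (by lia)))
    rw [indicator_of_notMem hxn]
    refine setIntegral_eq_zero_of_forall_eq_zero fun y hy => ?_
    rw [mem_sphere_zero_iff_norm] at hy
    exact whittaker_bigCellMatrix_eq_zero hψ' hW_left hW_right
      (hy ▸ one_lt_zpow₀ hp (by lia)) (by rwa [norm_mul, hy])
  · have hx0 : 0 < ‖x‖ := pos_of_mul_pos_left (by linarith) (by positivity)
    have hW : EqOn (fun y => W (bigCellMatrix y x))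
        (fun y => ψ (-x⁻¹ * y) * W !![(x ^ 2)⁻¹, 0; 0, 1]) (sphere 0 ((p : ℝ) ^ (n + 1))) :=
      fun y hy => whittaker_bigCellMatrix hW_left hW_right hW_center (by
        rw [mem_sphere_zero_iff_norm] at hy
        rwa [norm_mul, hy])
    rw [setIntegral_congr_fun isClosed_sphere.measurableSet hW, integral_mul_const,
      Padic.integral_sphere_addChar hμ hψc hψu hψ hψ', norm_neg, norm_inv, if_neg,
      add_sub_cancel_right, zero_sub]
    · have hiff : ‖x‖⁻¹ ≤ (p : ℝ) ^ (-n) ↔ (p : ℝ) ^ n ≤ ‖x‖ := by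
        rw [_root_.zpow_neg, inv_le_inv₀ hx0 (by positivity)]
      by_cases hxn : ‖x‖ = (p : ℝ) ^ n
      · rw [indicator_of_mem (mem_sphere_zero_iff_norm.2 hxn), if_pos (hiff.2 hxn.ge),
          whittaker_diagonal_congr hW_right (zpow_ne_zero _ hq)]
        rw [norm_inv, norm_pow, hxn, Padic.norm_p_zpow, _root_.zpow_neg, mul_comm 2 n, _root_.zpow_mul]
        rfl
      · rw [indicator_of_notMem (mt mem_sphere_zero_iff_norm.1 hxn),
          if_neg fun h => hxn (le_antisymm hx (hiff.1 h))]
        simp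
    · rw [_root_.zpow_neg, inv_le_inv₀ hx0 (by positivity), not_le]
      exact hx.trans_lt (zpow_lt_zpow_right₀ hp (by lia))

lemma measurableSet_shell (n : ℤ) : MeasurableSet (shell p n) :=
  measurableSet_closedBall.prod (isClosed_sphere.measurableSet.prod measurableSet_closedBall)

lemma Padic.measure_sphere_zpow_lt_top (hμ : μ (closedBall 0 1) = 1) (n : ℤ) :
    μ (sphere 0 ((p : ℝ) ^ n)) < ⊤ :=
  (measure_mono sphere_subset_closedBall).trans_lt (Padic.measure_closedBall_zpow_lt_top hμ n)

lemma measureReal_shell_le [SigmaFinite μ] (hμ : μ (closedBall 0 1) = 1) (n : ℤ) :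
    (μ.prod (μ.prod μ)).real (shell p n) ≤ (p : ℝ) ^ n * ((p : ℝ) ^ (n + 1) * (p : ℝ) ^ (n + 1)) := by
  rw [shell, measureReal_prod_prod, measureReal_prod_prod,
    Padic.measureReal_closedBall_zpow hμ, Padic.measureReal_closedBall_zpow hμ]
  gcongr
  refine le_of_le_of_eq ?_ (Padic.measureReal_closedBall_zpow hμ (n + 1))
  exact measureReal_mono sphere_subset_closedBall (Padic.measure_closedBall_zpow_lt_top hμ _).ne

lemma measure_shell_lt_top [SigmaFinite μ] (hμ : μ (closedBall 0 1) = 1) (n : ℤ) :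
    (μ.prod (μ.prod μ)) (shell p n) < ⊤ := by
  rw [shell, Measure.prod_prod, Measure.prod_prod]
  exact ENNReal.mul_lt_top (Padic.measure_closedBall_zpow_lt_top hμ _) <|
    ENNReal.mul_lt_top (Padic.measure_sphere_zpow_lt_top hμ _)
      (Padic.measure_closedBall_zpow_lt_top hμ _)

lemma integrableOn_shell [SigmaFinite μ] (hμ : μ (closedBall 0 1) = 1)
    (hψc : Continuous ψ) (hψu : ∀ a, ‖ψ a‖ = 1) (hW_cont : ContinuousOn W {g | g.det ≠ 0})
    {B : ℝ → ℝ} (hB : ∀ {x y : ℚ_[p]}, 1 ≤ ‖y‖ → ‖x‖ ≤ ‖y‖ → ‖W (bigCellMatrix y x)‖ ≤ B ‖y‖)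
    {n : ℤ} (hn : 0 ≤ n) :
    IntegrableOn (fun q : ℚ_[p] × ℚ_[p] × ℚ_[p] =>
      W (bigCellMatrix q.2.1 (q.1 + q.2.2 / q.2.1)) * ψ (-q.1)) (shell p n)
      (μ.prod (μ.prod μ)) := by
  have hp := one_lt_prime_cast p
  have hy0 : ∀ q ∈ shell p n, q.2.1 ≠ 0 := fun q hq => ne_zero_of_mem_sphere_zpow hq.2.1
  refine IntegrableOn.of_bound (C := B ((p : ℝ) ^ (n + 1))) (measure_shell_lt_top hμ n)
    (ContinuousOn.aestronglyMeasurable (.mul ?_ (by fun_prop)) (measurableSet_shell n))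
    (ae_restrict_of_forall_mem (measurableSet_shell n) fun q hq => ?_)
  · exact continuousOn_whittaker_bigCellMatrix hW_cont (by fun_prop)
      (continuousOn_fst.add (.div (by fun_prop) (by fun_prop) hy0)) hy0
  · have hy := mem_sphere_zero_iff_norm.1 hq.2.1
    rw [norm_mul, hψu, mul_one, ← hy]
    exact hB (hy ▸ one_le_zpow₀ hp.le (by lia)) (norm_le_of_mem_shell hn hq).2

lemma integrableOn_closedBall_prod_sphere [SigmaFinite μ] (hμ : μ (closedBall 0 1) = 1)
    (hψc : Continuous ψ) (hψu : ∀ a, ‖ψ a‖ = 1) (hW_cont : ContinuousOn W {g | g.det ≠ 0})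
    {B : ℝ → ℝ} (hB : ∀ {x y : ℚ_[p]}, 1 ≤ ‖y‖ → ‖x‖ ≤ ‖y‖ → ‖W (bigCellMatrix y x)‖ ≤ B ‖y‖)
    {n : ℤ} (hn : 0 ≤ n) :
    IntegrableOn (fun q : ℚ_[p] × ℚ_[p] => W (bigCellMatrix q.1 q.2) * ψ (-q.2))
      (sphere 0 ((p : ℝ) ^ (n + 1)) ×ˢ closedBall 0 ((p : ℝ) ^ n)) (μ.prod μ) := by
  have hp := one_lt_prime_cast p
  have hms : MeasurableSet (sphere (0 : ℚ_[p]) ((p : ℝ) ^ (n + 1)) ×ˢ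
    closedBall (0 : ℚ_[p]) ((p : ℝ) ^ n)) :=
      isClosed_sphere.measurableSet.prod measurableSet_closedBall
  refine IntegrableOn.of_bound (C := B ((p : ℝ) ^ (n + 1))) ?_
    (ContinuousOn.aestronglyMeasurable (.mul ?_ (by fun_prop)) hms)
    (ae_restrict_of_forall_mem hms fun q hq => ?_)
  · rw [Measure.prod_prod]
    exact ENNReal.mul_lt_top (Padic.measure_sphere_zpow_lt_top hμ _)
      (Padic.measure_closedBall_zpow_lt_top hμ _)
  · exact continuousOn_whittaker_bigCellMatrix hW_cont (by fun_prop) (by fun_prop)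
      fun q hq => ne_zero_of_mem_sphere_zpow hq.1
  · have hy := mem_sphere_zero_iff_norm.1 hq.1
    rw [norm_mul, hψu, mul_one, ← hy]
    refine hB (hy ▸ one_le_zpow₀ hp.le (by lia)) ?_
    rw [hy]
    exact (mem_closedBall_zero_iff.1 hq.2).trans (zpow_le_zpow_right₀ hp.le (by lia))

lemma Padic.setIntegral_closedBall_add_right {r : ℝ} {a : ℚ_[p]} (ha : ‖a‖ ≤ r) (f : ℚ_[p] → ℂ) :
    ∫ x in closedBall 0 r, f (x + a) ∂μ = ∫ x in closedBall 0 r, f x ∂μ := by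
  rw [← (measurePreserving_add_right μ a).setIntegral_preimage_emb
    (measurableEmbedding_addRight a) f]
  congr 2
  ext x
  simp only [mem_closedBall_zero_iff, mem_preimage]
  refine ⟨fun h => (Padic.nonarchimedean _ _).trans (max_le h ha), fun h => ?_⟩
  have := Padic.nonarchimedean (x + a) (-a)
  rw [norm_neg, add_neg_cancel_right] at this
  exact this.trans (max_le h ha)

lemma integral_shell [SigmaFinite μ] (hμ : μ (closedBall 0 1) = 1)
    (hψc : Continuous ψ) (hψu : ∀ a, ‖ψ a‖ = 1)
    (hψ : ∀ a, ‖a‖ ≤ 1 → ψ a = 1) (hψ' : ∃ a, ‖a‖ ≤ (p : ℝ) ∧ ψ a ≠ 1)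
    (hW_cont : ContinuousOn W {g | g.det ≠ 0})
    (hW_left : ∀ (t : ℚ_[p]) (g : Matrix (Fin 2) (Fin 2) ℚ_[p]), g.det ≠ 0 →
      W (!![1, t; 0, 1] * g) = ψ t * W g)
    (hW_right : ∀ (g : Matrix (Fin 2) (Fin 2) ℚ_[p]), g.det ≠ 0 → ∀ γ ∈ Gamma0 p,
      W (g * γ) = W g)
    (hW_center : ∀ (lam : ℚ_[p]) (g : Matrix (Fin 2) (Fin 2) ℚ_[p]), lam ≠ 0 →
      g.det ≠ 0 → W (lam • g) = W g)
    {B : ℝ → ℝ} (hB : ∀ {x y : ℚ_[p]}, 1 ≤ ‖y‖ → ‖x‖ ≤ ‖y‖ → ‖W (bigCellMatrix y x)‖ ≤ B ‖y‖)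
    {n : ℤ} (hn : 0 ≤ n) :
    ∫ q in shell p n, W (bigCellMatrix q.2.1 (q.1 + q.2.2 / q.2.1)) * ψ (-q.1)
        ∂(μ.prod (μ.prod μ)) =
      -(p : ℂ) ^ (n + 1) * (p : ℂ) ^ n * W !![(p : ℚ_[p]) ^ (2 * n), 0; 0, 1] *
        ((if n ≤ 0 then (p : ℂ) ^ n else 0) - if n ≤ 1 then (p : ℂ) ^ (n - 1) else 0) := by
  have hp := one_lt_prime_cast p
  have hint := integrableOn_shell hμ hψc hψu hW_cont hB hn
  have hint' := integrableOn_closedBall_prod_sphere hμ hψc hψu hW_cont hB hn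
  rw [IntegrableOn, shell, ← Measure.prod_restrict] at hint
  rw [IntegrableOn, ← Measure.prod_restrict] at hint'
  rw [shell, ← Measure.prod_restrict, integral_prod_symm _ hint]
  have hx : EqOn (fun q : ℚ_[p] × ℚ_[p] => ∫ x in closedBall 0 ((p : ℝ) ^ n),
        W (bigCellMatrix q.1 (x + q.2 / q.1)) * ψ (-x) ∂μ)
      (fun q => (∫ x in closedBall 0 ((p : ℝ) ^ n), W (bigCellMatrix q.1 x) * ψ (-x) ∂μ) *
        (fun _ => 1) q.2)
      (sphere 0 ((p : ℝ) ^ (n + 1)) ×ˢ closedBall 0 ((p : ℝ) ^ (n + 1))) := fun q hq => by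
    have hz : ‖q.2 / q.1‖ ≤ 1 := by
      rw [norm_div, mem_sphere_zero_iff_norm.1 hq.1]
      exact div_le_one_of_le₀ (mem_closedBall_zero_iff.1 hq.2) (by positivity)
    have hψz (x : ℚ_[p]) : ψ (-x) = ψ (-(x + q.2 / q.1)) := by
      rw [neg_add, AddChar.map_add_eq_mul, hψ (-(q.2 / q.1)) (by rwa [norm_neg]), mul_one]
    simp only [mul_one]
    rw [← Padic.setIntegral_closedBall_add_right (hz.trans (one_le_zpow₀ hp.le hn))
      fun x => W (bigCellMatrix q.1 x) * ψ (-x)]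
    simp_rw [← hψz]
  rw [setIntegral_congr_fun
      (isClosed_sphere.measurableSet.prod measurableSet_closedBall) hx,
    setIntegral_prod_mul (μ := μ) (ν := μ) (fun y => ∫ x in closedBall 0 ((p : ℝ) ^ n),
      W (bigCellMatrix y x) * ψ (-x) ∂μ)
      (fun _ => 1),
    integral_integral_swap hint']
  have hy : EqOn (fun x => ∫ y in sphere 0 ((p : ℝ) ^ (n + 1)), W (bigCellMatrix y x) * ψ (-x) ∂μ)
      ((sphere 0 ((p : ℝ) ^ n)).indicator fun x =>
        -(p : ℂ) ^ n * W !![(p : ℚ_[p]) ^ (2 * n), 0; 0, 1] * ψ (-1 * x))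
      (closedBall 0 ((p : ℝ) ^ n)) := fun x hx => by
    dsimp only
    rw [integral_mul_const, integral_sphere_whittaker_bigCellMatrix hμ hψc hψu hψ hψ' hW_left
      hW_right hW_center hn (mem_closedBall_zero_iff.1 hx)]
    by_cases hxs : x ∈ sphere (0 : ℚ_[p]) ((p : ℝ) ^ n)
    · rw [indicator_of_mem hxs, indicator_of_mem hxs, neg_one_mul]
    · rw [indicator_of_notMem hxs, indicator_of_notMem hxs, zero_mul]
  rw [setIntegral_congr_fun measurableSet_closedBall hy,
    setIntegral_indicator isClosed_sphere.measurableSet,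
    inter_eq_right.2 sphere_subset_closedBall, integral_const_mul,
    Padic.integral_sphere_addChar hμ hψc hψu hψ hψ', setIntegral_const,
    Padic.measureReal_closedBall_zpow hμ, norm_neg, norm_one]
  simp only [one_le_zpow_iff_right₀ hp, neg_nonneg, sub_nonpos, Complex.real_smul, mul_one]
  push_cast
  ring

end Whittaker

/-- With `θ`, `μ`, `W` as usual, for `Re(ν)` large enough the function
`(x,y,z) ↦ |y|^{−2−ν}·W([[0,−y],[y⁻¹, x+z/y]])·θ(−x)` is absolutely integrable on
`R = {v_p(y) < min{0, v_p(x), v_p(z)+1}}` and its integral equals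
`p^{−1−2ν}·W(diag(p²,1)) − (1−p⁻¹)·p^{−1−ν}·W(1)`. -/
theorem stmt_13 (p : ℕ) [Fact p.Prime]
    [MeasurableSpace ℚ_[p]] [BorelSpace ℚ_[p]]
    (μ : Measure ℚ_[p]) [SigmaFinite μ]
    (hμ_inv : ∀ a : ℚ_[p], μ.map (a + ·) = μ)
    (hμ_norm : μ {x : ℚ_[p] | ‖x‖ ≤ 1} = 1)
    (θ : ℚ_[p] → ℂ) (hθ_cont : Continuous θ)
    (hθ_add : ∀ a b : ℚ_[p], θ (a + b) = θ a * θ b)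
    (hθ_unit : ∀ a : ℚ_[p], ‖θ a‖ = 1)
    (hθ_triv : ∀ a : ℚ_[p], ‖a‖ ≤ 1 → θ a = 1)
    (hθ_nontriv : ∃ a : ℚ_[p], ‖a‖ ≤ (p : ℝ) ∧ θ a ≠ 1)
    (W : Matrix (Fin 2) (Fin 2) ℚ_[p] → ℂ)
    (hW_cont : ContinuousOn W {g | g.det ≠ 0})
    (hW_left : ∀ (t : ℚ_[p]) (g : Matrix (Fin 2) (Fin 2) ℚ_[p]), g.det ≠ 0 →
      W (!![1, t; 0, 1] * g) = θ t * W g)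
    (hW_right : ∀ (g : Matrix (Fin 2) (Fin 2) ℚ_[p]), g.det ≠ 0 → ∀ γ ∈ Gamma0 p,
      W (g * γ) = W g)
    (hW_center : ∀ (lam : ℚ_[p]) (g : Matrix (Fin 2) (Fin 2) ℚ_[p]), lam ≠ 0 →
      g.det ≠ 0 → W (lam • g) = W g)
    (hW_bound : ∃ C : ℝ, 0 < C ∧ ∃ A : ℝ, 0 ≤ A ∧
      ∀ g : Matrix (Fin 2) (Fin 2) ℚ_[p], g.det ≠ 0 →
        ‖W g‖ ≤ C * ((max (max ‖g 0 0‖ ‖g 0 1‖) (max ‖g 1 0‖ ‖g 1 1‖) *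
          max (max ‖g⁻¹ 0 0‖ ‖g⁻¹ 0 1‖) (max ‖g⁻¹ 1 0‖ ‖g⁻¹ 1 1‖)) ^ A)) :
    ∃ ν₀ : ℝ, ∀ ν : ℂ, ν₀ < ν.re →
      IntegrableOn
        (fun q : ℚ_[p] × ℚ_[p] × ℚ_[p] =>
          (‖q.2.1‖ : ℂ) ^ (-2 - ν) *
            W !![0, -q.2.1; q.2.1⁻¹, q.1 + q.2.2 / q.2.1] * θ (-q.1))
        {q : ℚ_[p] × ℚ_[p] × ℚ_[p] |
          Padic.addValuation q.2.1 <
            min 0 (min (Padic.addValuation q.1) (Padic.addValuation q.2.2 + 1))}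
        (μ.prod (μ.prod μ)) ∧
      ∫ q in {q : ℚ_[p] × ℚ_[p] × ℚ_[p] |
          Padic.addValuation q.2.1 <
            min 0 (min (Padic.addValuation q.1) (Padic.addValuation q.2.2 + 1))},
          (‖q.2.1‖ : ℂ) ^ (-2 - ν) *
            W !![0, -q.2.1; q.2.1⁻¹, q.1 + q.2.2 / q.2.1] * θ (-q.1)
          ∂(μ.prod (μ.prod μ)) =
        (p : ℂ) ^ (-1 - 2 * ν) * W !![(p : ℚ_[p]) ^ 2, 0; 0, 1] -
          (1 - (p : ℂ)⁻¹) * (p : ℂ) ^ (-1 - ν) * W 1 := by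
  have hp := one_lt_prime_cast p
  have hp0 : (0 : ℝ) < p := by linarith
  have hpC : (p : ℂ) ≠ 0 := mod_cast (Fact.out : p.Prime).ne_zero
  have hθ0 : θ 0 = 1 := hθ_triv 0 (by simp)
  obtain ⟨ψ, rfl⟩ : ∃ ψ : AddChar ℚ_[p] ℂ, ψ = θ := ⟨⟨θ, hθ0, hθ_add⟩, rfl⟩
  have : μ.IsAddLeftInvariant := ⟨hμ_inv⟩
  have hμ : μ (Metric.closedBall 0 1) = 1 := by
    rw [← hμ_norm]
    congr 1
    ext x
    simp
  obtain ⟨C, hC, A, hA, hWb⟩ := hW_bound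
  have hB {x y : ℚ_[p]} (hy : 1 ≤ ‖y‖) (hxy : ‖x‖ ≤ ‖y‖) :
      ‖W (bigCellMatrix y x)‖ ≤ C * (‖y‖ ^ 2) ^ A :=
    norm_whittaker_bigCellMatrix_le hA hC hWb hy hxy
  refine ⟨2 * A + 2, fun ν hν => ?_⟩
  rw [iUnion_shell]
  set F : ℚ_[p] × ℚ_[p] × ℚ_[p] → ℂ := fun q => (‖q.2.1‖ : ℂ) ^ (-2 - ν) *
    W !![0, -q.2.1; q.2.1⁻¹, q.1 + q.2.2 / q.2.1] * ψ (-q.1) with hF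
  have hF_eq (n : ℕ) : Set.EqOn F (fun q => (((p : ℝ) ^ ((n : ℤ) + 1) : ℝ) : ℂ) ^ (-2 - ν) *
      (W (bigCellMatrix q.2.1 (q.1 + q.2.2 / q.2.1)) * ψ (-q.1))) (shell p n) := fun q hq => by
    simp only [hF, mem_sphere_zero_iff_norm.1 hq.2.1, bigCellMatrix, mul_assoc]
  have hF_int (n : ℕ) : IntegrableOn F (shell p n) (μ.prod (μ.prod μ)) :=
    IntegrableOn.congr_fun ((integrableOn_shell hμ hθ_cont hθ_unit hW_cont (B := fun t => C * (t ^ 2) ^ A) hB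
      (Int.natCast_nonneg n)).const_mul _) (hF_eq n).symm (measurableSet_shell _)
  have hF_norm (n : ℕ) : ‖∫ q in shell p n, ‖F q‖ ∂(μ.prod (μ.prod μ))‖ ≤
      C * (p : ℝ)⁻¹ ^ (n + 1) := by
    set r : ℝ := (p : ℝ) ^ ((n : ℤ) + 1) with hr
    have hr1 : 1 ≤ r := one_le_zpow₀ hp.le (by lia)
    have hr0 : 0 < r := by linarith
    have hbd (q) (hq : q ∈ shell p n) : ‖‖F q‖‖ ≤ r ^ (-2 - ν.re) * (C * (r ^ 2) ^ A) := by
      have hy : ‖q.2.1‖ = r := mem_sphere_zero_iff_norm.1 hq.2.1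
      rw [norm_norm, hF_eq n hq, norm_mul, norm_mul, hθ_unit, mul_one,
        Complex.norm_cpow_eq_rpow_re_of_pos hr0]
      have hre : (-2 - ν).re = -2 - ν.re := by simp
      rw [hre]
      gcongr
      rw [← hy]
      exact hB (hy ▸ hr1) (norm_le_of_mem_shell (Int.natCast_nonneg n) hq).2
    have hrr : r⁻¹ = (p : ℝ)⁻¹ ^ (n + 1) := by
      rw [hr, inv_pow]
      norm_cast
    calc _ ≤ r ^ (-2 - ν.re) * (C * (r ^ 2) ^ A) * (μ.prod (μ.prod μ)).real (shell p n) :=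
          norm_setIntegral_le_of_norm_le_const (measure_shell_lt_top hμ _) hbd
      _ ≤ r ^ (-2 - ν.re) * (C * (r ^ 2) ^ A) * (r * (r * r)) := by
          gcongr
          refine (measureReal_shell_le hμ _).trans ?_
          gcongr
          exact zpow_le_zpow_right₀ hp.le (by lia)
      _ = C * r ^ (-2 - ν.re + 2 * A + 3) := by
          rw [Real.rpow_add hr0, Real.rpow_add hr0, Real.rpow_mul hr0.le]
          norm_cast
          ring
      _ ≤ C * r ^ (-1 : ℝ) := by
          gcongr C * ?_
          exact Real.rpow_le_rpow_of_exponent_le hr1 (by linarith)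
      _ = C * (p : ℝ)⁻¹ ^ (n + 1) := by rw [Real.rpow_neg_one, hrr]
  have hF_int' : IntegrableOn F (⋃ n : ℕ, shell p n) (μ.prod (μ.prod μ)) := by
    refine integrableOn_iUnion_of_summable_integral_norm hF_int
      (Summable.of_norm_bounded (Summable.mul_left C ?_) hF_norm)
    exact (summable_nat_add_iff 1).2
      (summable_geometric_of_lt_one (by positivity) (inv_lt_one_of_one_lt₀ hp))
  refine ⟨hF_int', ?_⟩
  have hF_val (n : ℕ) := (setIntegral_congr_fun (μ := μ.prod (μ.prod μ))
    (measurableSet_shell _) (hF_eq n)).trans <| (integral_const_mul _ _).trans <|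
      congrArg _ <| integral_shell hμ hθ_cont hθ_unit hθ_triv hθ_nontriv hW_cont hW_left hW_right
        hW_center (B := fun t => C * (t ^ 2) ^ A) hB (Int.natCast_nonneg n)
  have hsum := hasSum_integral_iUnion (fun n : ℕ => measurableSet_shell (p := p) n)
    pairwise_disjoint_shell hF_int'
  refine (hsum.unique (hasSum_sum_of_ne_finset_zero (s := Finset.range 2) fun n hn => ?_)).trans ?_
  · rw [Finset.mem_range, not_lt] at hn
    rw [hF_val, if_neg (by lia), if_neg (by lia)]
    simp
  · have h1 : !![(1 : ℚ_[p]), 0; 0, 1] = 1 := Matrix.one_fin_two.symm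
    have hcpow : (p : ℂ) ^ (-1 - ν) = p * (p : ℂ) ^ (-2 - ν) := by
      rw [show -1 - ν = 1 + (-2 - ν) by ring, Complex.cpow_add _ _ hpC, Complex.cpow_one]
    have hcpow' : (p : ℂ) ^ (-1 - 2 * ν) = p ^ 3 * ((p : ℂ) ^ (-2 - ν) * (p : ℂ) ^ (-2 - ν)) := by
      rw [← Complex.cpow_add _ _ hpC, ← Complex.cpow_natCast, ← Complex.cpow_add _ _ hpC]
      push_cast
      ring_nf
    have hsq : (((p : ℝ) ^ (((1 : ℕ) : ℤ) + 1) : ℝ) : ℂ) ^ (-2 - ν) =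
        (p : ℂ) ^ (-2 - ν) * (p : ℂ) ^ (-2 - ν) := by
      rw [← Complex.natCast_mul_natCast_cpow]
      norm_cast
      rw [pow_two]
    rw [Finset.sum_range_succ, Finset.sum_range_one, hF_val, hF_val, hsq, hcpow, hcpow']
    norm_num [h1]
    norm_cast
    field_simp
    ring_nf
end
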